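/- arXiv:2507.14974 — 2 statements merged into one kernel-verified Lean document; each statement's English description precedes it below -/
import Mathlib

section
/- Let n ≥ 2, 1 < q < ∞ and s = n/2 − 1/q. Then there is a constant C such that ‖ Σ_j λ_j |e^{itΔ}f_j|² ‖_{L^{q,∞}(ℝ, L^∞(ℝⁿ))} ≤ C ‖{λ_j}‖_{ℓ^{q,1}} for all families {f_j} of functions orthonormal in Ḣ^s(ℝⁿ) and all sequences {λ_j} ∈ ℓ^{q,1}. -/
noncomputable section

open MeasureTheory ENNReal Real Set

namespace OS

/-- `ℝⁿ` as a Euclidean space. -/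
abbrev Rn (n : ℕ) := EuclideanSpace ℝ (Fin n)

/-- The real dot product `x·ξ`, viewed as a complex number. -/
def dotC {n : ℕ} (x ξ : Rn n) : ℂ := ((∑ i, x i * ξ i : ℝ) : ℂ)

/-- The Fourier transform `f̂(ξ) = ∫ f(x) e^{-i x·ξ} dx`. -/
def FT {n : ℕ} (f : Rn n → ℂ) (ξ : Rn n) : ℂ :=
  ∫ x : Rn n, Complex.exp (-(Complex.I * dotC x ξ)) * f x

/-- The propagator `e^{itΔ}` composed with a Fourier multiplier `m`:
`x ↦ (2π)^{-n} ∫ e^{i(x·ξ - t|ξ|²)} m(ξ) f̂(ξ) dξ`. -/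
def prop {n : ℕ} (m : Rn n → ℂ) (f : Rn n → ℂ) (t : ℝ) (x : Rn n) : ℂ :=
  ((2 * π : ℝ) ^ (-(n : ℝ)) : ℝ) •
    ∫ ξ : Rn n, Complex.exp (Complex.I * (dotC x ξ - (t : ℂ) * ((‖ξ‖ : ℝ) : ℂ) ^ 2)) *
      (m ξ * FT f ξ)

/-- The free Schrödinger propagator `e^{itΔ} f`, as a function of `(t, x)`. -/
def schrodinger {n : ℕ} (f : Rn n → ℂ) : ℝ → Rn n → ℂ := prop (fun _ => 1) f

/-- The Fourier multiplier `|ξ|^{-s} ψ(2^{-k}|ξ|)` of `(-Δ)^{-s/2} P_k`. -/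
def LPmult {n : ℕ} (s : ℝ) (ψ : ℝ → ℝ) (k : ℤ) (ξ : Rn n) : ℂ :=
  ((‖ξ‖ ^ (-s) * ψ ((2 : ℝ) ^ (-k) * ‖ξ‖) : ℝ) : ℂ)

/-- The Littlewood–Paley projection `P_k h`. -/
def LP {n : ℕ} (ψ : ℝ → ℝ) (k : ℤ) (h : Rn n → ℂ) (x : Rn n) : ℂ :=
  ((2 * π : ℝ) ^ (-(n : ℝ)) : ℝ) •
    ∫ ξ : Rn n, Complex.exp (Complex.I * dotC x ξ) *
      (((ψ ((2 : ℝ) ^ (-k) * ‖ξ‖) : ℝ) : ℂ) * FT h ξ)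

/-- The standing hypotheses on the Littlewood–Paley bump function `ψ`:
smooth, `[0,1]`-valued, supported in `[1/2,2]`, with `∑_{k∈ℤ} ψ(2^{-k} r) = 1` for `r ≠ 0`. -/
structure IsLPF (ψ : ℝ → ℝ) : Prop where
  smooth : ContDiff ℝ (⊤ : ℕ∞) ψ
  mem_Icc : ∀ r, ψ r ∈ Icc (0 : ℝ) 1
  supp : Function.support ψ ⊆ Icc (1 / 2 : ℝ) 2
  sum_one : ∀ r : ℝ, r ≠ 0 → ∑' k : ℤ, ψ ((2 : ℝ) ^ (-k) * r) = 1

/-- Orthonormality in `L²(ℝⁿ)`. -/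
def OrthonormalL2 {n : ℕ} (f : ℕ → Rn n → ℂ) : Prop :=
  ∀ j k, (∫ x : Rn n, f j x * (starRingEnd ℂ) (f k x)) = if j = k then 1 else 0

/-- Orthonormality in the homogeneous Sobolev space `Ḣ^s(ℝⁿ)`:
`(2π)^{-n} ∫ |ξ|^{2s} f̂_j(ξ) conj(f̂_k(ξ)) dξ = δ_{jk}`. -/
def OrthonormalHs {n : ℕ} (s : ℝ) (f : ℕ → Rn n → ℂ) : Prop :=
  ∀ j k, ((2 * π : ℝ) ^ (-(n : ℝ)) : ℝ) •
    (∫ ξ : Rn n, ((‖ξ‖ ^ (2 * s) : ℝ) : ℂ) * (FT (f j) ξ * (starRingEnd ℂ) (FT (f k) ξ)))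
      = if j = k then 1 else 0

/-- The density `Σ_j λ_j |u_j(t,x)|²` of a system of space-time functions. -/
def density2 {n : ℕ} (lam : ℕ → ℝ) (u : ℕ → ℝ → Rn n → ℂ) (t : ℝ) (x : Rn n) : ℝ :=
  ∑' j, lam j * ‖u j t x‖ ^ 2

/-- The density `Σ_j λ_j |e^{itΔ}f_j(x)|²`. -/
def density {n : ℕ} (lam : ℕ → ℝ) (f : ℕ → Rn n → ℂ) : ℝ → Rn n → ℝ :=
  density2 lam fun j => schrodinger (f j)

/-- The `L^q` norm (w.r.t. `μ`) of an `ℝ≥0∞`-valued function. -/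
def eLp {α : Type*} [MeasurableSpace α] (μ : Measure α) (q : ℝ≥0∞) (F : α → ℝ≥0∞) : ℝ≥0∞ :=
  if q = ∞ then essSup F μ
  else (∫⁻ t, F t ^ q.toReal ∂μ) ^ (1 / q.toReal)

/-- The Lorentz `L^{p,r}` (quasi)norm of an `ℝ≥0∞`-valued function, via the
distribution function.  For `r = ∞` this is the weak-`L^p` quasinorm
`sup_{s>0} s μ(G > s)^{1/p} = sup_{t>0} t^{1/p} G^*(t)`. -/
def lor {α : Type*} [MeasurableSpace α] (μ : Measure α) (p r : ℝ≥0∞) (G : α → ℝ≥0∞) : ℝ≥0∞ :=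
  if p = ∞ then essSup G μ
  else if r = ∞ then
    ⨆ (s : ℝ) (_ : 0 < s), ENNReal.ofReal s * μ {x | ENNReal.ofReal s < G x} ^ (1 / p.toReal)
  else
    (∫⁻ s in Ioi (0 : ℝ),
      (ENNReal.ofReal s * μ {x | ENNReal.ofReal s < G x} ^ (1 / p.toReal)) ^ r.toReal *
        (ENNReal.ofReal s)⁻¹) ^ (1 / r.toReal)

/-- The mixed norm `‖u‖_{L^q(ℝ, L^p(ℝⁿ))}`. -/
def mixedLp {n : ℕ} {E : Type*} [NormedAddCommGroup E] (q p : ℝ≥0∞)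
    (u : ℝ → Rn n → E) : ℝ≥0∞ :=
  eLp volume q fun t => eLpNorm (u t) p volume

/-- The mixed norm `‖u‖_{L^{q,∞}(ℝ, L^p(ℝⁿ))}` (weak in time). -/
def mixedWeakLp {n : ℕ} {E : Type*} [NormedAddCommGroup E] (q p : ℝ≥0∞)
    (u : ℝ → Rn n → E) : ℝ≥0∞ :=
  lor volume q ∞ fun t => eLpNorm (u t) p volume

/-- The weak `L^{p,∞}(ℝⁿ)` quasinorm. -/
def wLp {n : ℕ} {E : Type*} [NormedAddCommGroup E] (p : ℝ≥0∞) (g : Rn n → E) : ℝ≥0∞ :=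
  lor volume p ∞ fun x => (‖g x‖₊ : ℝ≥0∞)

/-- The mixed Lorentz norm `‖u‖_{L^{q,r}(ℝ, L^{p,r̃}(ℝⁿ))}`. -/
def mixedLorentz {n : ℕ} {E : Type*} [NormedAddCommGroup E] (q r p rt : ℝ≥0∞)
    (u : ℝ → Rn n → E) : ℝ≥0∞ :=
  lor volume q r fun t => lor volume p rt fun x => (‖u t x‖₊ : ℝ≥0∞)

/-- The `ℓ^a` norm of a sequence (with `ℓ^∞` the supremum norm). -/
def seqNormE (a : ℝ≥0∞) (lam : ℕ → ℝ) : ℝ≥0∞ :=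
  if a = ∞ then ⨆ j, ENNReal.ofReal |lam j|
  else (∑' j, ENNReal.ofReal |lam j| ^ a.toReal) ^ (1 / a.toReal)

/-- The decreasing rearrangement of a sequence: `seqRearr lam j` is the
`(j+1)`-th largest value of `|lam i|`. -/
def seqRearr (lam : ℕ → ℝ) (j : ℕ) : ℝ≥0∞ :=
  sInf {s : ℝ≥0∞ | Measure.count {i : ℕ | s < ENNReal.ofReal |lam i|} ≤ (j : ℝ≥0∞)}

/-- The Lorentz sequence norm `‖lam‖_{ℓ^{q,r}} = (Σ_j (j^{1/q} λ*_j)^r / j)^{1/r}`,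
parametrized by `qinv = 1/q` and a finite second exponent `r`. -/
def seqLor (qinv r : ℝ) (lam : ℕ → ℝ) : ℝ≥0∞ :=
  (∑' j : ℕ, (((j : ℝ≥0∞) + 1) ^ qinv * seqRearr lam j) ^ r * ((j : ℝ≥0∞) + 1)⁻¹) ^ (1 / r)

/-- The interior of the triangle `OAB`, in the coordinates `(a, b) = (1/p, 1/q)`. -/
def IntOAB (n : ℕ) (a b : ℝ) : Prop :=
  a ∈ Ioo (0 : ℝ) 1 ∧ b ∈ Ioo (0 : ℝ) 1 ∧ b < (n : ℝ) / (n - 1) * a ∧ 2 * b + n * a < n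

/-- The interior of the quadrilateral `OCDA`, in the coordinates `(a, b) = (1/p, 1/q)`. -/
def IntOCDA (n : ℕ) (a b : ℝ) : Prop :=
  a ∈ Ioo (0 : ℝ) 1 ∧ b ∈ Ioo (0 : ℝ) 1 ∧ (n : ℝ) / (n - 1) * a < b ∧ 2 * b + n * a < n

def ptO : ℝ × ℝ := (0, 0)
def ptA (n : ℕ) : ℝ × ℝ := (((n : ℝ) - 1) / (n + 1), (n : ℝ) / (n + 1))
def ptB : ℝ × ℝ := (1, 0)
def ptC : ℝ × ℝ := (0, 1)
def ptD (n : ℕ) : ℝ × ℝ := (((n : ℝ) - 2) / n, 1)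

/-- The closed triangle `OAB`. -/
def OAB (n : ℕ) : Set (ℝ × ℝ) := convexHull ℝ {ptO, ptA n, ptB}

/-- The closed quadrilateral `OCDA`. -/
def OCDA (n : ℕ) : Set (ℝ × ℝ) := convexHull ℝ {ptO, ptC, ptD n, ptA n}

/-- The half-open segment `[A, D)`. -/
def segAD (n : ℕ) : Set (ℝ × ℝ) := {x | ∃ t ∈ Ico (0 : ℝ) 1, x = (1 - t) • ptA n + t • ptD n}

/-- The Lebesgue exponent with reciprocal `a` (so `expOf 0 = ∞`). -/
def expOf (a : ℝ) : ℝ≥0∞ := (ENNReal.ofReal a)⁻¹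

/-- The weighted velocity average `∫ f(x - tv, v) |v|^{-2s} dv` of the solution of
the kinetic transport equation with datum `f`. -/
def velAvg {n : ℕ} (s : ℝ) (f : Rn n × Rn n → ℂ) (t : ℝ) (x : Rn n) : ℂ :=
  ∫ v : Rn n, ((‖v‖ ^ (-(2 * s)) : ℝ) : ℂ) * f (x - t • v, v)

end OS

open OS

namespace OS

open scoped ComplexConjugate

/-- Expansion of the squared Hilbert–Schmidt norm of a finite-rank kernel. -/
lemma lintegral_kernel_sq {ι : Type*} [Fintype ι] (μ : Measure ℝ) [IsFiniteMeasure μ]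
    (w : ι → ℝ → ℂ) (hw : ∀ j, Measurable (w j)) (C : ℝ) (hb : ∀ j t, ‖w j t‖ ≤ C) :
    ∫⁻ z, ‖∑ j, conj (w j z.1) * w j z.2‖ₑ ^ 2 ∂(μ.prod μ)
      = ∑ j, ∑ k, ‖∫ t, w k t * conj (w j t) ∂μ‖ₑ ^ 2 := by
  have hC : ∀ j k t, ‖w k t * conj (w j t)‖ ≤ C * C := fun j k t => by
    rw [norm_mul, RCLike.norm_conj]
    exact mul_le_mul (hb k t) (hb j t) (norm_nonneg _) ((norm_nonneg _).trans (hb k t))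
  have hm : ∀ j k, Measurable fun t => w k t * conj (w j t) := fun j k =>
    (hw k).mul (Complex.continuous_conj.measurable.comp (hw j))
  have hint : ∀ j k, Integrable (fun t => w k t * conj (w j t)) μ := fun j k =>
    Integrable.of_bound (hm j k).aestronglyMeasurable (C * C) (.of_forall (hC j k))
  set K : ℝ × ℝ → ℂ := fun z => ∑ j, conj (w j z.1) * w j z.2 with hK
  have hKK : ∀ z, ((‖K z‖ ^ 2 : ℝ) : ℂ)
      = ∑ j, ∑ k, (w k z.1 * conj (w j z.1)) * (w j z.2 * conj (w k z.2)) := by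
    intro z
    rw [Complex.ofReal_pow, ← Complex.mul_conj', hK]
    simp only [map_sum, map_mul, Complex.conj_conj, Finset.sum_mul_sum]
    exact Finset.sum_congr rfl fun j _ => Finset.sum_congr rfl fun k _ => by ring
  have hpi : ∀ j k, Integrable (fun z : ℝ × ℝ =>
      (w k z.1 * conj (w j z.1)) * (w j z.2 * conj (w k z.2))) (μ.prod μ) := fun j k =>
    (hint j k).mul_prod (hint k j)
  have hsum : ∫ z, ((‖K z‖ ^ 2 : ℝ) : ℂ) ∂(μ.prod μ)
      = ((∑ j, ∑ k, ‖∫ t, w k t * conj (w j t) ∂μ‖ ^ 2 : ℝ) : ℂ) := by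
    simp_rw [hKK]
    rw [integral_finsetSum _ fun j _ => integrable_finsetSum _ fun k _ => hpi j k]
    push_cast
    refine Finset.sum_congr rfl fun j _ => ?_
    rw [integral_finsetSum _ fun k _ => hpi j k]
    refine Finset.sum_congr rfl fun k _ => ?_
    rw [integral_prod_mul (fun t => w k t * conj (w j t)) (fun t => w j t * conj (w k t)),
      ← Complex.mul_conj', ← integral_conj]
    congr 2
    ext t
    simp [mul_comm]
  have hKm : Measurable K := Finset.measurable_sum _ fun j _ =>
    (Complex.continuous_conj.measurable.comp ((hw j).comp measurable_fst)).mul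
      ((hw j).comp measurable_snd)
  have hKi : Integrable (fun z => ((‖K z‖ ^ 2 : ℝ) : ℂ)) (μ.prod μ) := by
    simp_rw [hKK]
    exact integrable_finsetSum _ fun j _ => integrable_finsetSum _ fun k _ => hpi j k
  have hKr : Integrable (fun z => ‖K z‖ ^ 2) (μ.prod μ) := by
    simpa only [RCLike.re_eq_complex_re, Complex.ofReal_re] using hKi.re
  rw [integral_complex_ofReal, Complex.ofReal_inj] at hsum
  have := ofReal_integral_eq_lintegral_ofReal hKr (.of_forall fun z => by positivity)
  rw [hsum] at this
  rw [ENNReal.ofReal_sum_of_nonneg (fun _ _ => by positivity)] at this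
  simp_rw [ENNReal.ofReal_sum_of_nonneg (fun _ _ => sq_nonneg _),
    ENNReal.ofReal_pow (norm_nonneg _), ofReal_norm] at this
  exact this.symm

lemma two_mul_enorm_mul_le (a b : ℂ) : 2 * ‖a * b‖ₑ ≤ ‖a‖ₑ ^ 2 + ‖b‖ₑ ^ 2 := by
  have h : 2 * ‖a * b‖₊ ≤ ‖a‖₊ ^ 2 + ‖b‖₊ ^ 2 := by
    rw [nnnorm_mul, ← mul_assoc]; exact two_mul_le_add_sq _ _
  simp only [enorm]
  exact_mod_cast h

lemma lintegral_near_le {ι : Type*} [Fintype ι] (μ : Measure ℝ) [IsFiniteMeasure μ]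
    (hμ : μ ≤ volume) (w : ι → ℝ → ℂ) (hw : ∀ j, Measurable (w j))
    (k : ℝ → ℝ≥0∞) (hk : Measurable k) :
    ∫⁻ z, ‖∑ j, conj (w j z.1) * w j z.2‖ₑ * k (z.1 - z.2) ∂(μ.prod μ)
      ≤ (∑ j, ∫⁻ t, ‖w j t‖ₑ ^ 2 ∂μ) * ∫⁻ r, k r := by
  set m : ℝ → ℝ≥0∞ := fun t => ∑ j, ‖w j t‖ₑ ^ 2 with hm
  have hmm : Measurable m := Finset.measurable_sum _ fun j _ => (hw j).enorm.pow_const 2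
  have hS : ∑ j, ∫⁻ t, ‖w j t‖ₑ ^ 2 ∂μ = ∫⁻ t, m t ∂μ :=
    (lintegral_finsetSum _ fun j _ => (hw j).enorm.pow_const 2).symm
  have hk' : Measurable fun z : ℝ × ℝ => k (z.1 - z.2) :=
    hk.comp (measurable_fst.sub measurable_snd)
  have hm₁ : Measurable fun z : ℝ × ℝ => m z.1 * k (z.1 - z.2) :=
    (hmm.comp measurable_fst).mul hk'
  have hm₂ : Measurable fun z : ℝ × ℝ => m z.2 * k (z.1 - z.2) :=
    (hmm.comp measurable_snd).mul hk'
  have h1 : ∫⁻ z, m z.1 * k (z.1 - z.2) ∂(μ.prod μ) ≤ (∫⁻ t, m t ∂μ) * ∫⁻ r, k r := by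
    rw [lintegral_prod _ hm₁.aemeasurable,
      ← lintegral_mul_const _ hmm]
    refine lintegral_mono fun t => ?_
    simp only
    rw [lintegral_const_mul _ (by fun_prop : Measurable fun y => k (t - y))]
    gcongr m t * ?_
    calc ∫⁻ y, k (t - y) ∂μ ≤ ∫⁻ y, k (t - y) := lintegral_mono' hμ le_rfl
      _ = _ := lintegral_sub_left_eq_self k t
  have h2 : ∫⁻ z, m z.2 * k (z.1 - z.2) ∂(μ.prod μ) ≤ (∫⁻ t, m t ∂μ) * ∫⁻ r, k r := by
    rw [lintegral_prod_symm _ hm₂.aemeasurable,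
      ← lintegral_mul_const _ hmm]
    refine lintegral_mono fun t => ?_
    simp only
    rw [lintegral_const_mul _ (by fun_prop : Measurable fun y => k (y - t))]
    gcongr m t * ?_
    calc ∫⁻ y, k (y - t) ∂μ ≤ ∫⁻ y, k (y - t) := lintegral_mono' hμ le_rfl
      _ = _ := lintegral_sub_right_eq_self k t
  rw [hS]
  have hp : ∀ z : ℝ × ℝ, 2 * ‖∑ j, conj (w j z.1) * w j z.2‖ₑ ≤ m z.1 + m z.2 := by
    intro z
    calc 2 * ‖∑ j, conj (w j z.1) * w j z.2‖ₑ
        ≤ 2 * ∑ j, ‖conj (w j z.1) * w j z.2‖ₑ := by gcongr; exact enorm_sum_le _ _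
      _ ≤ ∑ j, (‖w j z.1‖ₑ ^ 2 + ‖w j z.2‖ₑ ^ 2) := by
        rw [Finset.mul_sum]
        refine Finset.sum_le_sum fun j _ => ?_
        have := two_mul_enorm_mul_le (conj (w j z.1)) (w j z.2)
        rwa [RCLike.enorm_conj] at this
      _ = _ := Finset.sum_add_distrib
  have h3 : 2 * ∫⁻ z, ‖∑ j, conj (w j z.1) * w j z.2‖ₑ * k (z.1 - z.2) ∂(μ.prod μ)
      ≤ 2 * ((∫⁻ t, m t ∂μ) * ∫⁻ r, k r) := by
    rw [← lintegral_const_mul' _ _ (by simp), two_mul (_ * _)]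
    refine le_trans ?_ (add_le_add h1 h2)
    rw [← lintegral_add_left hm₁]
    refine lintegral_mono fun z => ?_
    simp only
    rw [← mul_assoc, ← add_mul]
    gcongr
    exact hp z
  exact (ENNReal.mul_le_mul_iff_right (by simp) (by simp)).1 h3

lemma lintegral_far_le {μ : Measure ℝ} [IsFiniteMeasure μ]
    (hμ : μ ≤ volume) (P : ℝ × ℝ → ℝ≥0∞) (hP : Measurable P)
    (k : ℝ → ℝ≥0∞) (hk : Measurable k) :
    ∫⁻ z, P z * k (z.1 - z.2) ∂(μ.prod μ)
      ≤ (∫⁻ z, P z ^ 2 ∂(μ.prod μ)) ^ (1 / 2 : ℝ) *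
        (μ univ * ∫⁻ r, k r ^ 2) ^ (1 / 2 : ℝ) := by
  have hk' : Measurable fun z : ℝ × ℝ => k (z.1 - z.2) :=
    hk.comp (measurable_fst.sub measurable_snd)
  have := ENNReal.lintegral_mul_le_Lp_mul_Lq (μ.prod μ) Real.HolderConjugate.two_two
    hP.aemeasurable hk'.aemeasurable
  simp only [Pi.mul_apply, ENNReal.rpow_two] at this
  refine this.trans ?_
  gcongr
  rw [lintegral_prod _ (hk'.pow_const 2).aemeasurable, mul_comm (μ univ), ← lintegral_const]
  refine lintegral_mono fun t => ?_
  calc ∫⁻ y, k (t - y) ^ 2 ∂μ ≤ ∫⁻ y, k (t - y) ^ 2 := lintegral_mono' hμ le_rfl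
    _ = _ := lintegral_sub_left_eq_self (fun r => k r ^ 2) t

/-- If the squared Hilbert–Schmidt norm of `∑ j, conj (w j) ⊗ w j` is dominated by its pairing with a
convolution kernel `k₁ + k₂`, then its trace is controlled by the Schur norm of `k₁` and the
Hilbert–Schmidt norm of `k₂`. -/
lemma trace_le_of_kernel {ι : Type*} [Fintype ι] (μ : Measure ℝ) [IsFiniteMeasure μ]
    (hμ : μ ≤ volume) (w : ι → ℝ → ℂ) (hw : ∀ j, Measurable (w j)) (C : ℝ)
    (hb : ∀ j t, ‖w j t‖ ≤ C) (k₁ k₂ : ℝ → ℝ≥0∞) (hk₁ : Measurable k₁) (hk₂ : Measurable k₂)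
    (h : ∑ j, ∑ k, ‖∫ t, w k t * conj (w j t) ∂μ‖ₑ ^ 2
      ≤ ∫⁻ z, ‖∑ j, conj (w j z.1) * w j z.2‖ₑ * (k₁ (z.1 - z.2) + k₂ (z.1 - z.2)) ∂(μ.prod μ)) :
    ∑ j, ∫⁻ t, ‖w j t‖ₑ ^ 2 ∂μ ≤ (Fintype.card ι : ℝ≥0∞) * (∫⁻ r, k₁ r) +
      (Fintype.card ι : ℝ≥0∞) ^ (1 / 2 : ℝ) * (μ univ * ∫⁻ r, k₂ r ^ 2) ^ (1 / 2 : ℝ) := by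
  set N : ℝ≥0∞ := (Fintype.card ι : ℝ≥0∞) with hN
  set S := ∑ j, ∫⁻ t, ‖w j t‖ₑ ^ 2 ∂μ with hS
  set X2 := ∑ j, ∑ k, ‖∫ t, w k t * conj (w j t) ∂μ‖ₑ ^ 2 with hX2
  set P : ℝ × ℝ → ℝ≥0∞ := fun z => ‖∑ j, conj (w j z.1) * w j z.2‖ₑ with hP
  have hPm : Measurable P := (Finset.measurable_sum _ fun j _ =>
    (Complex.continuous_conj.measurable.comp ((hw j).comp measurable_fst)).mul
      ((hw j).comp measurable_snd)).enorm
  have hPX : ∫⁻ z, P z ^ 2 ∂(μ.prod μ) = X2 := lintegral_kernel_sq μ w hw C hb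
  have hX2top : X2 ≠ ∞ := by
    rw [hX2]
    exact ENNReal.sum_ne_top.2 fun j _ => ENNReal.sum_ne_top.2 fun k _ =>
      ENNReal.pow_ne_top enorm_ne_top
  set X := X2 ^ (1 / 2 : ℝ) with hX
  have hXtop : X ≠ ∞ := ENNReal.rpow_ne_top_of_nonneg (by norm_num) hX2top
  have hXX : X2 = X * X := by
    rw [hX, ← ENNReal.rpow_add_of_nonneg _ _ (by norm_num) (by norm_num)]; norm_num
  set a := ∫⁻ r, k₁ r
  set b := (μ univ * ∫⁻ r, k₂ r ^ 2) ^ (1 / 2 : ℝ)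
  have hk₁' : Measurable fun z : ℝ × ℝ => k₁ (z.1 - z.2) :=
    hk₁.comp (measurable_fst.sub measurable_snd)
  have hmain : X * X ≤ S * a + X * b := by
    rw [← hXX]
    refine h.trans ?_
    simp_rw [mul_add]
    have hPk : Measurable fun z : ℝ × ℝ => P z * k₁ (z.1 - z.2) := hPm.mul hk₁'
    rw [lintegral_add_left hPk]
    refine add_le_add (lintegral_near_le μ hμ w hw k₁ hk₁) ?_
    have := lintegral_far_le hμ P hPm k₂ hk₂
    rwa [hPX] at this
  have hSX : S ≤ N ^ (1 / 2 : ℝ) * X := by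
    have h1 : ∀ j, ∫⁻ t, ‖w j t‖ₑ ^ 2 ∂μ ≤ ‖∫ t, w j t * conj (w j t) ∂μ‖ₑ := by
      intro j
      have hi : Integrable (fun t => ‖w j t‖ ^ 2) μ :=
        Integrable.of_bound ((hw j).norm.pow_const 2).aestronglyMeasurable (C ^ 2)
          (.of_forall fun t => by
            rw [norm_pow, norm_norm]; exact pow_le_pow_left₀ (norm_nonneg _) (hb j t) 2)
      have := ofReal_integral_eq_lintegral_ofReal hi (.of_forall fun z => by positivity)
      simp_rw [ENNReal.ofReal_pow (norm_nonneg _), ofReal_norm] at this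
      rw [← this]
      simp_rw [Complex.mul_conj', ← Complex.ofReal_pow]
      rw [integral_complex_ofReal, ← ofReal_norm, Complex.norm_real, Real.norm_eq_abs]
      exact ENNReal.ofReal_le_ofReal (le_abs_self _)
    have h2 := ENNReal.inner_le_Lp_mul_Lq Finset.univ (fun _ : ι => (1 : ℝ≥0∞))
      (fun j => ∫⁻ t, ‖w j t‖ₑ ^ 2 ∂μ) Real.HolderConjugate.two_two
    simp only [one_mul, ENNReal.rpow_two, one_pow, Finset.sum_const, nsmul_eq_mul, mul_one,
      Finset.card_univ] at h2
    refine h2.trans ?_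
    rw [hX]
    gcongr
    refine Finset.sum_le_sum fun j _ => ?_
    calc (∫⁻ t, ‖w j t‖ₑ ^ 2 ∂μ) ^ 2 ≤ ‖∫ t, w j t * conj (w j t) ∂μ‖ₑ ^ 2 := by
          gcongr; exact h1 j
      _ ≤ _ := Finset.single_le_sum
          (f := fun k => ‖∫ t, w k t * conj (w j t) ∂μ‖ₑ ^ 2) (fun _ _ => zero_le)
          (Finset.mem_univ j)
  have hX' : X ≤ N ^ (1 / 2 : ℝ) * a + b := by
    rcases eq_or_ne X 0 with h0 | h0
    · rw [h0]; exact zero_le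
    refine (ENNReal.mul_le_mul_iff_right h0 hXtop).1 (hmain.trans ?_)
    calc S * a + X * b ≤ N ^ (1 / 2 : ℝ) * X * a + X * b := by gcongr
      _ = _ := by ring
  calc S ≤ N ^ (1 / 2 : ℝ) * X := hSX
    _ ≤ N ^ (1 / 2 : ℝ) * (N ^ (1 / 2 : ℝ) * a + b) := by gcongr
    _ = (N ^ (1 / 2 : ℝ) * N ^ (1 / 2 : ℝ)) * a + N ^ (1 / 2 : ℝ) * b := by ring
    _ = N * a + _ := by
      rw [← ENNReal.rpow_add_of_nonneg _ _ (by norm_num) (by norm_num)]; norm_num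

lemma lintegral_comp_abs {g : ℝ → ℝ≥0∞} (hg : Measurable g) :
    ∫⁻ r, g |r| = 2 * ∫⁻ r in Ioi 0, g r := by
  have hneg : ∫⁻ r in Iic (0 : ℝ), g |r| = ∫⁻ r in Ioi (0 : ℝ), g r := by
    rw [setLIntegral_congr Iio_ae_eq_Iic.symm]
    have := (Measure.measurePreserving_neg (volume : Measure ℝ)).setLIntegral_comp_preimage
      (measurableSet_Ioi (a := (0 : ℝ))) hg
    rw [← this]
    have hs : Neg.neg ⁻¹' Ioi (0 : ℝ) = Iio 0 := by ext; simp
    rw [hs]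
    exact setLIntegral_congr_fun measurableSet_Iio fun r hr => by
      simp only [abs_of_neg (mem_Iio.1 hr)]
  rw [← lintegral_add_compl (fun r => g |r|) measurableSet_Ioi (A := Ioi (0 : ℝ)), compl_Ioi, hneg,
    two_mul]
  congr 1
  exact setLIntegral_congr_fun measurableSet_Ioi fun r hr => by simp only [abs_of_pos (mem_Ioi.1 hr)]

lemma lintegral_Ioo_rpow {p δ : ℝ} (hp : -1 < p) (hδ : 0 < δ) :
    ∫⁻ r in Ioo 0 δ, ENNReal.ofReal (r ^ p) = ENNReal.ofReal (δ ^ (p + 1) / (p + 1)) := by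
  rw [setLIntegral_congr Ioo_ae_eq_Ioc, ← ofReal_integral_eq_lintegral_ofReal,
    ← intervalIntegral.integral_of_le hδ.le, integral_rpow (Or.inl hp),
    Real.zero_rpow (by linarith), sub_zero]
  · exact (intervalIntegrable_iff_integrableOn_Ioc_of_le hδ.le).1
      (intervalIntegral.intervalIntegrable_rpow' hp)
  · exact (ae_restrict_iff' measurableSet_Ioc).2 (.of_forall fun r hr =>
      Real.rpow_nonneg hr.1.le _)

lemma lintegral_Ioi_rpow {p δ : ℝ} (hp : p < -1) (hδ : 0 < δ) :
    ∫⁻ r in Ioi δ, ENNReal.ofReal (r ^ p) = ENNReal.ofReal (δ ^ (p + 1) / (-(p + 1))) := by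
  rw [← ofReal_integral_eq_lintegral_ofReal, integral_Ioi_rpow_of_lt hp hδ, div_neg, neg_div]
  · exact integrableOn_Ioi_rpow_of_lt hp hδ
  · exact (ae_restrict_iff' measurableSet_Ioi).2 (.of_forall fun r hr =>
      Real.rpow_nonneg (hδ.le.trans (le_of_lt hr)) _)

/-- The Gaussian-averaged dispersive kernel `∫₀^δ τ^{s-1} |τ + i r|^{-β} dτ`. -/
def dispKer (β s δ r : ℝ) : ℝ≥0∞ :=
  ∫⁻ τ in Ioo 0 δ, ENNReal.ofReal (τ ^ (s - 1) * ‖(τ + r * Complex.I : ℂ)‖ ^ (-β))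

lemma measurable_dispKer (β s δ : ℝ) : Measurable (dispKer β s δ) := by
  refine Measurable.lintegral_prod_right'
    (f := fun z : ℝ × ℝ => ENNReal.ofReal (z.2 ^ (s - 1) * ‖(z.2 + z.1 * Complex.I : ℂ)‖ ^ (-β))) ?_
  fun_prop

lemma dispKer_le {β s δ a r : ℝ} (hδ : 0 < δ) (ha : 0 ≤ a) (has : a < s) (haβ : a ≤ β)
    (hr : r ≠ 0) :
    dispKer β s δ r ≤ ENNReal.ofReal (δ ^ (s - a) / (s - a)) * ENNReal.ofReal (|r| ^ (a - β)) := by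
  have hr' : 0 < |r| := abs_pos.2 hr
  have h1 : ∀ τ ∈ Ioo 0 δ, ENNReal.ofReal (τ ^ (s - 1) * ‖(τ + r * Complex.I : ℂ)‖ ^ (-β))
      ≤ ENNReal.ofReal (τ ^ (s - a - 1)) * ENNReal.ofReal (|r| ^ (a - β)) := by
    intro τ hτ
    have hτ0 : 0 < τ := hτ.1
    have hre : τ ≤ ‖(τ + r * Complex.I : ℂ)‖ := by
      simpa [abs_of_pos hτ0] using Complex.abs_re_le_norm (τ + r * Complex.I : ℂ)
    have him : |r| ≤ ‖(τ + r * Complex.I : ℂ)‖ := by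
      simpa using Complex.abs_im_le_norm (τ + r * Complex.I : ℂ)
    rw [← ENNReal.ofReal_mul (by positivity)]
    refine ENNReal.ofReal_le_ofReal ?_
    have hsplit : ‖(τ + r * Complex.I : ℂ)‖ ^ (-β)
        = ‖(τ + r * Complex.I : ℂ)‖ ^ (-a) * ‖(τ + r * Complex.I : ℂ)‖ ^ (a - β) := by
      rw [← Real.rpow_add (hτ0.trans_le hre)]; ring_nf
    rw [hsplit, show s - a - 1 = (s - 1) + -a by ring, Real.rpow_add hτ0, mul_assoc]
    gcongr ?_ * (?_ * ?_)
    · exact Real.rpow_le_rpow_of_nonpos hτ0 hre (by linarith)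
    · exact Real.rpow_le_rpow_of_nonpos hr' him (by linarith)
  refine (setLIntegral_mono' measurableSet_Ioo h1).trans ?_
  rw [lintegral_mul_const _ (by fun_prop), lintegral_Ioo_rpow (by linarith) hδ]
  simp

lemma lintegral_dispKer_near {β s δ a : ℝ} (hδ : 0 < δ) (ha : 0 ≤ a) (has : a < s) (haβ : a ≤ β)
    (ha1 : β - 1 < a) :
    ∫⁻ r, (if |r| < δ then dispKer β s δ r else 0)
      ≤ ENNReal.ofReal (2 / ((s - a) * (a - β + 1)) * δ ^ (s + 1 - β)) := by
  set c := ENNReal.ofReal (δ ^ (s - a) / (s - a))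
  have hg : Measurable ((Iio δ).indicator fun r : ℝ => c * ENNReal.ofReal (r ^ (a - β))) :=
    Measurable.indicator (by fun_prop) measurableSet_Iio
  calc ∫⁻ r, (if |r| < δ then dispKer β s δ r else 0)
      ≤ ∫⁻ r, (Iio δ).indicator (fun r : ℝ => c * ENNReal.ofReal (r ^ (a - β))) |r| := by
        refine lintegral_mono_ae ?_
        filter_upwards [Measure.ae_ne volume (0 : ℝ)] with r hr
        simp only [indicator, mem_Iio]
        split_ifs
        · exact dispKer_le hδ ha has haβ hr
        · exact le_rfl
    _ = 2 * (c * ∫⁻ r in Ioo 0 δ, ENNReal.ofReal (r ^ (a - β))) := by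
        rw [lintegral_comp_abs hg, setLIntegral_indicator measurableSet_Iio,
          lintegral_const_mul _ (by fun_prop), inter_comm, Ioi_inter_Iio]
    _ ≤ _ := by
        rw [lintegral_Ioo_rpow (by linarith) hδ, ← ENNReal.ofReal_mul (by
            have : 0 < s - a := by linarith
            positivity),
          show (2 : ℝ≥0∞) = ENNReal.ofReal 2 by simp, ← ENNReal.ofReal_mul (by norm_num)]
        refine ENNReal.ofReal_le_ofReal (le_of_eq ?_)
        have h1 : s - a ≠ 0 := by linarith
        have h2 : a - β + 1 ≠ 0 := by linarith
        rw [show s + 1 - β = (s - a) + (a - β + 1) by ring, Real.rpow_add hδ (s - a)]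
        generalize δ ^ (s - a) = u
        generalize δ ^ (a - β + 1) = v
        field_simp

lemma lintegral_dispKer_far {β s δ : ℝ} (hδ : 0 < δ) (hs : 0 < s) (hβ : 1 ≤ β) :
    ∫⁻ r, (if |r| < δ then 0 else dispKer β s δ r) ^ 2
      ≤ ENNReal.ofReal (2 / (s ^ 2 * (2 * β - 1)) * δ ^ (2 * s + 1 - 2 * β)) := by
  set c := ENNReal.ofReal (δ ^ s / s)
  have hg : Measurable ((Ici δ).indicator fun r : ℝ => c ^ 2 * ENNReal.ofReal (r ^ (-(2 * β)))) :=
    Measurable.indicator (by fun_prop) measurableSet_Ici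
  calc ∫⁻ r, (if |r| < δ then 0 else dispKer β s δ r) ^ 2
      ≤ ∫⁻ r, (Ici δ).indicator (fun r : ℝ => c ^ 2 * ENNReal.ofReal (r ^ (-(2 * β)))) |r| := by
        refine lintegral_mono fun r => ?_
        simp only [indicator, mem_Ici]
        by_cases h : |r| < δ
        · simp [h]
        · have hr : 0 < |r| := hδ.trans_le (not_lt.1 h)
          simp only [h, if_false, not_lt.1 h, if_true]
          have := dispKer_le (β := β) (s := s) hδ le_rfl hs (by linarith) (abs_pos.1 hr)
          simp only [sub_zero, zero_sub] at this
          calc _ ≤ (c * ENNReal.ofReal (|r| ^ (-β))) ^ 2 := by gcongr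
            _ = _ := by
              rw [mul_pow, ← ENNReal.ofReal_pow (by positivity) (n := 2) (p := |r| ^ (-β)),
                sq (|r| ^ (-β)), ← Real.rpow_add hr]
              ring_nf
    _ = 2 * (c ^ 2 * ∫⁻ r in Ioi δ, ENNReal.ofReal (r ^ (-(2 * β)))) := by
        have : Ici δ ∩ Ioi 0 = Ici δ := inter_eq_left.2 fun r hr => hδ.trans_le hr
        rw [lintegral_comp_abs hg, setLIntegral_indicator measurableSet_Ici,
          lintegral_const_mul _ (by fun_prop), this, setLIntegral_congr Ioi_ae_eq_Ici]
    _ ≤ _ := by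
        rw [lintegral_Ioi_rpow (by linarith) hδ, ← ENNReal.ofReal_pow (by positivity),
          ← ENNReal.ofReal_mul (by positivity),
          show (2 : ℝ≥0∞) = ENNReal.ofReal 2 by simp, ← ENNReal.ofReal_mul (by norm_num)]
        refine ENNReal.ofReal_le_ofReal (le_of_eq ?_)
        have h2 : 2 * β - 1 ≠ 0 := by linarith
        rw [show 2 * s + 1 - 2 * β = s + s + (-(2 * β) + 1) by ring, Real.rpow_add hδ (s + s),
          Real.rpow_add hδ s, show -(-(2 * β) + 1) = 2 * β - 1 by ring]
        generalize δ ^ s = u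
        generalize δ ^ (-(2 * β) + 1) = v
        field_simp

/-- The space-time phase `e^{i(x·ξ - t|ξ|²)}`. -/
def phase {n : ℕ} (t : ℝ) (x ξ : Rn n) : ℂ :=
  Complex.exp (Complex.I * (dotC x ξ - (t : ℂ) * ((‖ξ‖ : ℝ) : ℂ) ^ 2))

lemma dotC_eq_inner {n : ℕ} (x ξ : Rn n) : dotC x ξ = ((inner ℝ x ξ : ℝ) : ℂ) := by
  simp [dotC, PiLp.inner_apply, mul_comm]

lemma phase_eq {n : ℕ} (t : ℝ) (x ξ : Rn n) :
    phase t x ξ = Complex.exp (((inner ℝ x ξ - t * ‖ξ‖ ^ 2 : ℝ) : ℂ) * Complex.I) := by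
  rw [phase, dotC_eq_inner]; push_cast; ring_nf

lemma norm_phase {n : ℕ} (t : ℝ) (x ξ : Rn n) : ‖phase t x ξ‖ = 1 := by
  rw [phase_eq, Complex.norm_exp_ofReal_mul_I]

lemma continuous_phase {n : ℕ} : Continuous fun z : ℝ × Rn n × Rn n => phase z.1 z.2.1 z.2.2 := by
  simp_rw [phase_eq]
  fun_prop

lemma norm_integral_gaussian_phase_le {n : ℕ} {τ : ℝ} (hτ : 0 < τ) (t t' : ℝ) (x x' : Rn n) :
    ‖∫ ξ, ((Real.exp (-τ * ‖ξ‖ ^ 2) : ℝ) : ℂ) * (phase t x ξ * conj (phase t' x' ξ))‖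
      ≤ π ^ ((n : ℝ) / 2) * ‖(τ + ((t - t' : ℝ) : ℂ) * Complex.I : ℂ)‖ ^ (-((n : ℝ) / 2)) := by
  set b : ℂ := τ + ((t - t' : ℝ) : ℂ) * Complex.I with hb
  have hbre : b.re = τ := by simp [hb]
  have hb0 : 0 < b.re := hbre ▸ hτ
  have hbne : b ≠ 0 := fun h => by simp [h] at hb0
  have hint := GaussianFourier.integral_cexp_neg_mul_sq_norm_add hb0 Complex.I (x - x')
  have heq : ∀ ξ : Rn n, ((Real.exp (-τ * ‖ξ‖ ^ 2) : ℝ) : ℂ) * (phase t x ξ * conj (phase t' x' ξ))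
      = Complex.exp (-b * ‖ξ‖ ^ 2 + Complex.I * (inner ℝ (x - x') ξ : ℝ)) := by
    intro ξ
    rw [phase_eq, phase_eq, ← Complex.exp_conj, map_mul, Complex.conj_I, Complex.conj_ofReal,
      Complex.ofReal_exp, ← Complex.exp_add, ← Complex.exp_add, inner_sub_left, hb]
    push_cast
    ring_nf
  simp_rw [heq]
  rw [hint, norm_mul]
  have h1 : ‖((π : ℂ) / b) ^ ((Module.finrank ℝ (Rn n) : ℂ) / 2)‖
      = π ^ ((n : ℝ) / 2) * ‖b‖ ^ (-((n : ℝ) / 2)) := by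
    rw [finrank_euclideanSpace_fin, show ((n : ℂ) / 2) = (((n : ℝ) / 2 : ℝ) : ℂ) by push_cast; rfl,
      Complex.norm_cpow_real, norm_div, Complex.norm_real, Real.norm_of_nonneg pi_pos.le,
      Real.div_rpow pi_pos.le (norm_nonneg _), Real.rpow_neg (norm_nonneg _), div_eq_mul_inv]
  have h2 : ‖Complex.exp (Complex.I ^ 2 * (‖x - x'‖ : ℂ) ^ 2 / (4 * b))‖ ≤ 1 := by
    rw [Complex.norm_exp, Real.exp_le_one_iff]
    have : Complex.I ^ 2 * (‖x - x'‖ : ℂ) ^ 2 / (4 * b)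
        = ((-(‖x - x'‖ ^ 2 / 4) : ℝ) : ℂ) * b⁻¹ := by
      rw [Complex.I_sq]; push_cast; field_simp
    rw [this, Complex.re_ofReal_mul, Complex.inv_re]
    have : 0 ≤ b.re / Complex.normSq b := div_nonneg hb0.le (Complex.normSq_nonneg _)
    have h3 : 0 ≤ ‖x - x'‖ ^ 2 / 4 := by positivity
    nlinarith
  rw [h1]
  exact mul_le_of_le_one_right (by positivity) h2

/-- The high-frequency part `∫₀^δ τ^{s-1} e^{-τ|ξ|²} dτ` of `Γ(s)|ξ|^{-2s}`. -/
def highMult {n : ℕ} (s δ : ℝ) (ξ : Rn n) : ℝ≥0∞ :=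
  ∫⁻ τ in Ioo 0 δ, ENNReal.ofReal (τ ^ (s - 1)) * ENNReal.ofReal (Real.exp (-τ * ‖ξ‖ ^ 2))

/-- The low-frequency part `∫_δ^∞ τ^{s-1} e^{-τ|ξ|²} dτ` of `Γ(s)|ξ|^{-2s}`. -/
def lowMult {n : ℕ} (s δ : ℝ) (ξ : Rn n) : ℝ≥0∞ :=
  ∫⁻ τ in Ici δ, ENNReal.ofReal (τ ^ (s - 1)) * ENNReal.ofReal (Real.exp (-τ * ‖ξ‖ ^ 2))

lemma measurable_highMult {n : ℕ} (s δ : ℝ) : Measurable (highMult (n := n) s δ) := by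
  refine Measurable.lintegral_prod_right' (f := fun z : Rn n × ℝ =>
    ENNReal.ofReal (z.2 ^ (s - 1)) * ENNReal.ofReal (Real.exp (-z.2 * ‖z.1‖ ^ 2))) ?_
  fun_prop

lemma highMult_add_lowMult {n : ℕ} {s δ : ℝ} (hs : 0 < s) (hδ : 0 < δ) {ξ : Rn n} (hξ : ξ ≠ 0) :
    highMult s δ ξ + lowMult s δ ξ = ENNReal.ofReal (Real.Gamma s * ‖ξ‖ ^ (-(2 * s))) := by
  have hξ' : 0 < ‖ξ‖ := norm_pos_iff.2 hξ
  have hG := Real.integral_rpow_mul_exp_neg_mul_Ioi hs (pow_pos hξ' 2)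
  have hpos : 0 < (1 / ‖ξ‖ ^ 2) ^ s * Real.Gamma s :=
    mul_pos (by positivity) (Real.Gamma_pos_of_pos hs)
  have hint : IntegrableOn (fun t : ℝ => t ^ (s - 1) * Real.exp (-(‖ξ‖ ^ 2 * t))) (Ioi 0) := by
    by_contra h
    rw [integral_undef h] at hG
    exact hpos.ne hG
  have hdis : Disjoint (Ioo 0 δ) (Ici δ) :=
    Set.disjoint_left.2 fun x hx hx' => absurd hx.2 (not_lt.2 hx')
  rw [highMult, lowMult, ← lintegral_union measurableSet_Ici hdis, Ioo_union_Ici_eq_Ioi hδ]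
  have : ∀ τ ∈ Ioi (0 : ℝ), ENNReal.ofReal (τ ^ (s - 1)) * ENNReal.ofReal (Real.exp (-τ * ‖ξ‖ ^ 2))
      = ENNReal.ofReal (τ ^ (s - 1) * Real.exp (-(‖ξ‖ ^ 2 * τ))) := fun τ hτ => by
    rw [← ENNReal.ofReal_mul (Real.rpow_nonneg (le_of_lt hτ) _)]
    ring_nf
  rw [setLIntegral_congr_fun measurableSet_Ioi this, ← ofReal_integral_eq_lintegral_ofReal hint, hG]
  · rw [mul_comm, Real.rpow_neg hξ'.le, Real.rpow_mul hξ'.le, Real.rpow_two, one_div,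
      Real.inv_rpow (by positivity)]
  · exact (ae_restrict_iff' measurableSet_Ioi).2 (.of_forall fun τ hτ =>
      mul_nonneg (Real.rpow_nonneg (le_of_lt hτ) _) (Real.exp_nonneg _))

lemma lintegral_lowMult {n : ℕ} {s δ : ℝ} (hδ : 0 < δ) (hsn : s < (n : ℝ) / 2) :
    ∫⁻ ξ : Rn n, lowMult s δ ξ
      = ENNReal.ofReal (π ^ ((n : ℝ) / 2) * (δ ^ (s - (n : ℝ) / 2) / ((n : ℝ) / 2 - s))) := by
  simp only [lowMult]
  rw [lintegral_lintegral_swap (by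
    refine Measurable.aemeasurable ?_
    simp only [Function.uncurry_def]
    fun_prop)]
  have h1 : ∀ τ ∈ Ici δ, ∫⁻ ξ : Rn n, ENNReal.ofReal (τ ^ (s - 1)) *
      ENNReal.ofReal (Real.exp (-τ * ‖ξ‖ ^ 2))
      = ENNReal.ofReal (π ^ ((n : ℝ) / 2)) * ENNReal.ofReal (τ ^ (s - 1 - (n : ℝ) / 2)) := by
    intro τ hτ
    have hτ0 : 0 < τ := hδ.trans_le hτ
    have hI := GaussianFourier.integral_rexp_neg_mul_sq_norm (V := Rn n) hτ0
    have hi : Integrable fun ξ : Rn n => Real.exp (-τ * ‖ξ‖ ^ 2) := by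
      by_contra h
      rw [integral_undef h] at hI
      exact absurd hI (by positivity)
    rw [lintegral_const_mul _ (by fun_prop), ← ofReal_integral_eq_lintegral_ofReal hi
      (.of_forall fun _ => Real.exp_nonneg _), hI, finrank_euclideanSpace_fin,
      ← ENNReal.ofReal_mul (by positivity), ← ENNReal.ofReal_mul (by positivity),
      Real.div_rpow pi_pos.le hτ0.le, Real.rpow_sub hτ0 (s - 1)]
    ring_nf
  rw [setLIntegral_congr_fun measurableSet_Ici h1, lintegral_const_mul _ (by fun_prop),
    setLIntegral_congr Ioi_ae_eq_Ici.symm, lintegral_Ioi_rpow (by linarith) hδ,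
    ← ENNReal.ofReal_mul (by positivity)]
  ring_nf

/-- A frequency cutoff splitting `|ξ|^{-2s}` at height `δ^{-1/2}`. -/
lemma exists_cutoff {n : ℕ} {s δ : ℝ} (hs : 0 < s) (hδ : 0 < δ) (hsn : s < (n : ℝ) / 2) :
    ∃ ρ : Rn n → ℝ, Measurable ρ ∧ (∀ ξ, 0 ≤ ρ ξ) ∧ (∀ ξ, ρ ξ ≤ 1) ∧
      (∀ ξ, ENNReal.ofReal (ρ ξ ^ 2 * ‖ξ‖ ^ (-(2 * s)))
        ≤ ENNReal.ofReal (1 / Real.Gamma s) * highMult s δ ξ) ∧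
      ∫⁻ ξ, ENNReal.ofReal ((1 - ρ ξ) ^ 2 * ‖ξ‖ ^ (-(2 * s)))
        ≤ ENNReal.ofReal (π ^ ((n : ℝ) / 2) / (Real.Gamma s * ((n : ℝ) / 2 - s)) *
          δ ^ (s - (n : ℝ) / 2)) := by
  have hΓ := Real.Gamma_pos_of_pos hs
  set ρ : Rn n → ℝ := fun ξ => (highMult s δ ξ).toReal / (Real.Gamma s * ‖ξ‖ ^ (-(2 * s))) with hρ
  have h0pow : (0 : ℝ) ^ (-(2 * s)) = 0 := Real.zero_rpow (by linarith)
  have hsum : ∀ ξ : Rn n, ξ ≠ 0 → (highMult s δ ξ).toReal + (lowMult s δ ξ).toReal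
      = Real.Gamma s * ‖ξ‖ ^ (-(2 * s)) ∧ highMult s δ ξ ≠ ∞ ∧ lowMult s δ ξ ≠ ∞ := by
    intro ξ hξ
    have h := highMult_add_lowMult hs hδ hξ
    have ht : highMult s δ ξ + lowMult s δ ξ ≠ ∞ := h ▸ ENNReal.ofReal_ne_top
    obtain ⟨h1, h2⟩ := ENNReal.add_ne_top.1 ht
    refine ⟨?_, h1, h2⟩
    rw [← ENNReal.toReal_add h1 h2, h, ENNReal.toReal_ofReal (by positivity)]
  have hρ0 : ∀ ξ, 0 ≤ ρ ξ := fun ξ => by positivity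
  have hρ1 : ∀ ξ, ρ ξ ≤ 1 := by
    intro ξ
    rcases eq_or_ne ξ 0 with rfl | hξ
    · simp [hρ, h0pow]
    · have hξ' : 0 < ‖ξ‖ := norm_pos_iff.2 hξ
      rw [hρ, div_le_one (by positivity), ← (hsum ξ hξ).1]
      linarith [ENNReal.toReal_nonneg (a := lowMult s δ ξ)]
  refine ⟨ρ, ?_, hρ0, hρ1, ?_, ?_⟩
  · exact (measurable_highMult s δ).ennreal_toReal.div (by fun_prop)
  · intro ξ
    rcases eq_or_ne ξ 0 with rfl | hξ
    · simp [h0pow]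
    · have hξ' : 0 < ‖ξ‖ := norm_pos_iff.2 hξ
      have hw : 0 < ‖ξ‖ ^ (-(2 * s)) := by positivity
      rw [← ENNReal.ofReal_toReal (hsum ξ hξ).2.1, ← ENNReal.ofReal_mul (by positivity)]
      refine ENNReal.ofReal_le_ofReal ?_
      calc ρ ξ ^ 2 * ‖ξ‖ ^ (-(2 * s)) ≤ ρ ξ * ‖ξ‖ ^ (-(2 * s)) := by
            gcongr; nlinarith [hρ0 ξ, hρ1 ξ]
        _ = _ := by rw [hρ]; field_simp
  · have hlow : ∀ ξ : Rn n, ENNReal.ofReal ((1 - ρ ξ) ^ 2 * ‖ξ‖ ^ (-(2 * s)))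
        ≤ ENNReal.ofReal (1 / Real.Gamma s) * lowMult s δ ξ := by
      intro ξ
      rcases eq_or_ne ξ 0 with rfl | hξ
      · simp [h0pow]
      · have hξ' : 0 < ‖ξ‖ := norm_pos_iff.2 hξ
        have hw : 0 < ‖ξ‖ ^ (-(2 * s)) := by positivity
        rw [← ENNReal.ofReal_toReal (hsum ξ hξ).2.2, ← ENNReal.ofReal_mul (by positivity)]
        refine ENNReal.ofReal_le_ofReal ?_
        have h1 : 1 - ρ ξ = (lowMult s δ ξ).toReal / (Real.Gamma s * ‖ξ‖ ^ (-(2 * s))) := by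
          rw [hρ, _root_.eq_div_iff (by positivity), sub_mul, one_mul]
          simp only
          rw [div_mul_cancel₀ _ (by positivity), ← (hsum ξ hξ).1]
          ring
        calc (1 - ρ ξ) ^ 2 * ‖ξ‖ ^ (-(2 * s)) ≤ (1 - ρ ξ) * ‖ξ‖ ^ (-(2 * s)) := by
              gcongr; nlinarith [hρ0 ξ, hρ1 ξ]
          _ = _ := by rw [h1]; field_simp
    refine (lintegral_mono hlow).trans ?_
    rw [lintegral_const_mul' _ _ ENNReal.ofReal_ne_top, lintegral_lowMult hδ hsn,
      ← ENNReal.ofReal_mul (by positivity)]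
    refine ENNReal.ofReal_le_ofReal (le_of_eq ?_)
    have : (n : ℝ) / 2 - s ≠ 0 := by linarith
    field_simp

lemma measurable_phase {n : ℕ} :
    Measurable fun z : ℝ × Rn n × Rn n => phase z.1 z.2.1 z.2.2 :=
  continuous_phase.measurable

lemma measurable_phase_comp {n : ℕ} {α : Type*} [MeasurableSpace α] {t : α → ℝ}
    {x ξ : α → Rn n} (ht : Measurable t) (hx : Measurable x) (hξ : Measurable ξ) :
    Measurable fun a => phase (t a) (x a) (ξ a) :=
  Measurable.comp (g := fun z : ℝ × Rn n × Rn n => phase z.1 z.2.1 z.2.2)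
    (f := fun a => (t a, x a, ξ a)) measurable_phase (ht.prodMk (hx.prodMk hξ))

/-- Gaussian-weighted `TT*` identity, bounding the weighted `L²` norms of the
`V_j = ∫ e(t,·) conj (w_j t) dt` by the density kernel of the `w_j`. -/
lemma lintegral_gaussian_enorm_sq_le {n : ℕ} {ι : Type*} [Fintype ι] (μ : Measure ℝ)
    [IsFiniteMeasure μ] (y : ℝ → Rn n) (hy : Measurable y) (w : ι → ℝ → ℂ)
    (hw : ∀ j, Measurable (w j)) (C : ℝ) (hb : ∀ j t, ‖w j t‖ ≤ C) {τ : ℝ} (hτ : 0 < τ) :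
    ∑ j, ∫⁻ ξ, ENNReal.ofReal (Real.exp (-τ * ‖ξ‖ ^ 2)) *
        ‖∫ t, phase t (y t) ξ * conj (w j t) ∂μ‖ₑ ^ 2
      ≤ ∫⁻ z : ℝ × ℝ, ‖∑ j, conj (w j z.1) * w j z.2‖ₑ * ENNReal.ofReal (π ^ ((n : ℝ) / 2) *
          ‖(τ + ((z.1 - z.2 : ℝ) : ℂ) * Complex.I : ℂ)‖ ^ (-((n : ℝ) / 2))) ∂(μ.prod μ) := by
  have hconj : Measurable (conj : ℂ → ℂ) := Complex.continuous_conj.measurable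
  have hph : Measurable fun z : ℝ × Rn n => phase z.1 (y z.1) z.2 :=
    measurable_phase_comp measurable_fst (hy.comp measurable_fst) measurable_snd
  set V : ι → Rn n → ℂ := fun j ξ => ∫ t, phase t (y t) ξ * conj (w j t) ∂μ with hV
  set K : ℝ × ℝ → ℂ := fun z => ∑ j, conj (w j z.1) * w j z.2 with hK
  have hKm : Measurable K := Finset.measurable_sum _ fun j _ =>
    (hconj.comp ((hw j).comp measurable_fst)).mul ((hw j).comp measurable_snd)
  have hKb : ∀ z, ‖K z‖ ≤ ∑ _j : ι, C * C := fun z => by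
    refine (norm_sum_le _ _).trans (Finset.sum_le_sum fun j _ => ?_)
    rw [norm_mul, RCLike.norm_conj]
    exact mul_le_mul (hb j _) (hb j _) (norm_nonneg _) ((norm_nonneg _).trans (hb j z.1))
  have hg : Integrable fun ξ : Rn n => Real.exp (-τ * ‖ξ‖ ^ 2) := by
    have hI := GaussianFourier.integral_rexp_neg_mul_sq_norm (V := Rn n) hτ
    by_contra h
    rw [integral_undef h] at hI
    exact absurd hI (by positivity)
  have hVm : ∀ j, Measurable (V j) := fun j => by
    have : Measurable fun z : Rn n × ℝ => phase z.2 (y z.2) z.1 * conj (w j z.2) :=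
      (measurable_phase_comp measurable_snd (hy.comp measurable_snd) measurable_fst).mul
        (hconj.comp ((hw j).comp measurable_snd))
    exact this.stronglyMeasurable.integral_prod_right'.measurable
  have hVb : ∀ j ξ, ‖V j ξ‖ ≤ C * μ.real univ := fun j ξ =>
    norm_integral_le_of_norm_le_const (.of_forall fun t => by
      rw [norm_mul, norm_phase, one_mul, RCLike.norm_conj]; exact hb j t)
  -- the squared norms as double integrals
  have hVsq : ∀ ξ, ((∑ j, ‖V j ξ‖ ^ 2 : ℝ) : ℂ)
      = ∫ z, K z * (phase z.1 (y z.1) ξ * conj (phase z.2 (y z.2) ξ)) ∂(μ.prod μ) := by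
    intro ξ
    have h1 : ∀ j, Integrable (fun t => phase t (y t) ξ * conj (w j t)) μ := fun j =>
      Integrable.of_bound (((measurable_phase_comp measurable_id hy measurable_const).mul
        (hconj.comp (hw j))).aestronglyMeasurable) C (.of_forall fun t => by
          rw [norm_mul, norm_phase, one_mul, RCLike.norm_conj]; exact hb j t)
    have h2 : ∀ j, Integrable (fun t => conj (phase t (y t) ξ) * w j t) μ := fun j => by
      have := (h1 j)
      rw [← (RCLike.conjLIE (K := ℂ)).integrable_comp_iff] at this
      refine this.congr (.of_forall fun t => ?_)
      simp
    have h3 : ∀ j, ((‖V j ξ‖ ^ 2 : ℝ) : ℂ) = ∫ z, (phase z.1 (y z.1) ξ * conj (w j z.1)) *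
        (conj (phase z.2 (y z.2) ξ) * w j z.2) ∂(μ.prod μ) := by
      intro j
      rw [integral_prod_mul (fun t => phase t (y t) ξ * conj (w j t))
        (fun t => conj (phase t (y t) ξ) * w j t), Complex.ofReal_pow, ← Complex.mul_conj', hV]
      simp only
      rw [← integral_conj]
      simp
    rw [Complex.ofReal_sum]
    simp_rw [h3]
    rw [← integral_finsetSum _ fun j _ => (h1 j).mul_prod (h2 j)]
    refine integral_congr_ae (.of_forall fun z => ?_)
    simp only [hK, Finset.sum_mul]
    exact Finset.sum_congr rfl fun j _ => by ring
  have hreal : Integrable fun ξ : Rn n => Real.exp (-τ * ‖ξ‖ ^ 2) * ∑ j, ‖V j ξ‖ ^ 2 := by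
    refine hg.mul_bdd (c := ∑ _j : ι, (C * μ.real univ) ^ 2)
      (Finset.measurable_sum _ fun j _ => (hVm j).norm.pow_const 2).aestronglyMeasurable
      (.of_forall fun ξ => ?_)
    rw [Real.norm_of_nonneg (by positivity)]
    exact Finset.sum_le_sum fun j _ => pow_le_pow_left₀ (norm_nonneg _) (hVb j ξ) 2
  have hswap : ((∫ ξ : Rn n, Real.exp (-τ * ‖ξ‖ ^ 2) * ∑ j, ‖V j ξ‖ ^ 2 : ℝ) : ℂ)
      = ∫ z : ℝ × ℝ, (K z * ∫ ξ : Rn n, ((Real.exp (-τ * ‖ξ‖ ^ 2) : ℝ) : ℂ) *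
          (phase z.1 (y z.1) ξ * conj (phase z.2 (y z.2) ξ))) ∂(μ.prod μ) := by
    rw [← integral_complex_ofReal]
    simp_rw [Complex.ofReal_mul, hVsq, ← integral_const_mul]
    rw [integral_integral_swap]
    · refine integral_congr_ae (.of_forall fun z => ?_)
      refine integral_congr_ae (.of_forall fun ξ => ?_)
      simp only
      ring
    · have hgi : Integrable (fun p : Rn n × (ℝ × ℝ) => ((Real.exp (-τ * ‖p.1‖ ^ 2) : ℝ) : ℂ))
          (volume.prod (μ.prod μ)) := (hg.ofReal (𝕜 := ℂ)).comp_fst (μ.prod μ)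
      refine hgi.mul_bdd (c := ∑ _j : ι, C * C) ?_ (.of_forall fun p => ?_)
      · refine ((hKm.comp measurable_snd).mul ((measurable_phase_comp
          (measurable_fst.comp measurable_snd) (hy.comp (measurable_fst.comp measurable_snd))
          measurable_fst).mul (hconj.comp (measurable_phase_comp
          (measurable_snd.comp measurable_snd) (hy.comp (measurable_snd.comp measurable_snd))
          measurable_fst)))).aestronglyMeasurable
      · rw [norm_mul, norm_mul, RCLike.norm_conj, norm_phase, norm_phase, mul_one, mul_one]
        exact hKb _
  have hLHS : ∑ j, ∫⁻ ξ, ENNReal.ofReal (Real.exp (-τ * ‖ξ‖ ^ 2)) * ‖V j ξ‖ₑ ^ 2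
      = ENNReal.ofReal (∫ ξ : Rn n, Real.exp (-τ * ‖ξ‖ ^ 2) * ∑ j, ‖V j ξ‖ ^ 2) := by
    have hm : ∀ j ∈ Finset.univ, Measurable fun ξ : Rn n =>
        ENNReal.ofReal (Real.exp (-τ * ‖ξ‖ ^ 2)) * ‖V j ξ‖ₑ ^ 2 := fun j _ => by
      have := hVm j
      fun_prop
    rw [ofReal_integral_eq_lintegral_ofReal hreal (.of_forall fun ξ => by positivity),
      ← lintegral_finsetSum _ hm]
    refine lintegral_congr fun ξ => ?_
    rw [ENNReal.ofReal_mul (Real.exp_nonneg _), ENNReal.ofReal_sum_of_nonneg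
      (fun _ _ => by positivity), Finset.mul_sum]
    simp_rw [ENNReal.ofReal_pow (norm_nonneg _), ofReal_norm]
  rw [hLHS]
  calc ENNReal.ofReal (∫ ξ : Rn n, Real.exp (-τ * ‖ξ‖ ^ 2) * ∑ j, ‖V j ξ‖ ^ 2)
      ≤ ‖((∫ ξ : Rn n, Real.exp (-τ * ‖ξ‖ ^ 2) * ∑ j, ‖V j ξ‖ ^ 2 : ℝ) : ℂ)‖ₑ := by
        rw [← ofReal_norm, Complex.norm_real]
        exact ENNReal.ofReal_le_ofReal (le_abs_self _)
    _ ≤ _ := by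
        rw [hswap]
        refine (enorm_integral_le_lintegral_enorm _).trans (lintegral_mono fun z => ?_)
        simp only
        rw [enorm_mul]
        gcongr
        rw [← ofReal_norm]
        exact ENNReal.ofReal_le_ofReal (norm_integral_gaussian_phase_le hτ _ _ _ _)

lemma measurable_integral_phase_conj {n : ℕ} {μ : Measure ℝ} [IsFiniteMeasure μ] {y : ℝ → Rn n}
    (hy : Measurable y) {w : ℝ → ℂ} (hw : Measurable w) :
    Measurable fun ξ => ∫ t, phase t (y t) ξ * conj (w t) ∂μ := by
  have h : Measurable fun z : Rn n × ℝ => phase z.2 (y z.2) z.1 * conj (w z.2) :=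
    (measurable_phase_comp measurable_snd (hy.comp measurable_snd) measurable_fst).mul
      (Complex.continuous_conj.measurable.comp (hw.comp measurable_snd))
  exact h.stronglyMeasurable.integral_prod_right'.measurable

/-- Averaging the Gaussian `TT*` bound over `τ` against `τ^{s-1} dτ`. -/
lemma lintegral_highMult_enorm_sq_le {n : ℕ} {ι : Type*} [Fintype ι] (μ : Measure ℝ)
    [IsFiniteMeasure μ] (y : ℝ → Rn n) (hy : Measurable y) (w : ι → ℝ → ℂ)
    (hw : ∀ j, Measurable (w j)) (C : ℝ) (hb : ∀ j t, ‖w j t‖ ≤ C) (s δ : ℝ) :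
    ∑ j, ∫⁻ ξ, highMult s δ ξ * ‖∫ t, phase t (y t) ξ * conj (w j t) ∂μ‖ₑ ^ 2
      ≤ ∫⁻ z : ℝ × ℝ, ‖∑ j, conj (w j z.1) * w j z.2‖ₑ *
          (ENNReal.ofReal (π ^ ((n : ℝ) / 2)) * dispKer ((n : ℝ) / 2) s δ (z.1 - z.2))
          ∂(μ.prod μ) := by
  have hVm : ∀ j, Measurable fun ξ => ∫ t, phase t (y t) ξ * conj (w j t) ∂μ := fun j =>
    measurable_integral_phase_conj hy (hw j)
  let V : ι → Rn n → ℂ := fun j ξ => ∫ t, phase t (y t) ξ * conj (w j t) ∂μ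
  have hKm : Measurable fun z : ℝ × ℝ => ‖∑ j, conj (w j z.1) * w j z.2‖ₑ :=
    (Finset.measurable_sum _ fun j _ =>
      (Complex.continuous_conj.measurable.comp ((hw j).comp measurable_fst)).mul
        ((hw j).comp measurable_snd)).enorm
  have hleft : ∀ j, ∫⁻ ξ, highMult s δ ξ * ‖V j ξ‖ₑ ^ 2
      = ∫⁻ τ in Ioo 0 δ, ENNReal.ofReal (τ ^ (s - 1)) *
          ∫⁻ ξ, ENNReal.ofReal (Real.exp (-τ * ‖ξ‖ ^ 2)) * ‖V j ξ‖ₑ ^ 2 := by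
    intro j
    have hVj : Measurable fun z : Rn n × ℝ => ‖V j z.1‖ₑ ^ 2 :=
      ((hVm j).comp measurable_fst).enorm.pow_const 2
    have hVj' : Measurable fun ξ => ‖V j ξ‖ₑ ^ 2 := (hVm j).enorm.pow_const 2
    calc ∫⁻ ξ, highMult s δ ξ * ‖V j ξ‖ₑ ^ 2
        = ∫⁻ ξ, ∫⁻ τ in Ioo 0 δ, ENNReal.ofReal (τ ^ (s - 1)) *
            ENNReal.ofReal (Real.exp (-τ * ‖ξ‖ ^ 2)) * ‖V j ξ‖ₑ ^ 2 := by
          refine lintegral_congr fun ξ => ?_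
          rw [highMult, lintegral_mul_const _ (by fun_prop)]
      _ = ∫⁻ τ in Ioo 0 δ, ∫⁻ ξ, ENNReal.ofReal (τ ^ (s - 1)) *
            ENNReal.ofReal (Real.exp (-τ * ‖ξ‖ ^ 2)) * ‖V j ξ‖ₑ ^ 2 := by
          rw [lintegral_lintegral_swap]
          refine Measurable.aemeasurable ?_
          refine Measurable.mul ?_ hVj
          fun_prop
      _ = _ := by
          refine lintegral_congr fun τ => ?_
          simp only [mul_assoc]
          rw [lintegral_const_mul _ (by fun_prop)]
  change ∑ j, ∫⁻ ξ, highMult s δ ξ * ‖V j ξ‖ₑ ^ 2 ≤ _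
  simp_rw [hleft]
  have hGm : ∀ j ∈ Finset.univ, Measurable fun τ : ℝ => ENNReal.ofReal (τ ^ (s - 1)) *
      ∫⁻ ξ, ENNReal.ofReal (Real.exp (-τ * ‖ξ‖ ^ 2)) * ‖V j ξ‖ₑ ^ 2 := by
    intro j _
    refine Measurable.mul (by fun_prop) ?_
    refine Measurable.lintegral_prod_right' (f := fun z : ℝ × Rn n =>
      ENNReal.ofReal (Real.exp (-z.1 * ‖z.2‖ ^ 2)) * ‖V j z.2‖ₑ ^ 2) ?_
    have hVj : Measurable fun z : ℝ × Rn n => ‖V j z.2‖ₑ ^ 2 :=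
      ((hVm j).comp measurable_snd).enorm.pow_const 2
    refine Measurable.mul ?_ hVj
    fun_prop
  rw [← lintegral_finsetSum _ hGm]
  calc ∫⁻ τ in Ioo 0 δ, ∑ j, ENNReal.ofReal (τ ^ (s - 1)) *
        ∫⁻ ξ, ENNReal.ofReal (Real.exp (-τ * ‖ξ‖ ^ 2)) * ‖V j ξ‖ₑ ^ 2
      ≤ ∫⁻ τ in Ioo 0 δ, ∫⁻ z : ℝ × ℝ, ENNReal.ofReal (τ ^ (s - 1)) *
          (‖∑ j, conj (w j z.1) * w j z.2‖ₑ * ENNReal.ofReal (π ^ ((n : ℝ) / 2) *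
          ‖(τ + ((z.1 - z.2 : ℝ) : ℂ) * Complex.I : ℂ)‖ ^ (-((n : ℝ) / 2)))) ∂(μ.prod μ) := by
        refine setLIntegral_mono' measurableSet_Ioo fun τ hτ => ?_
        rw [← Finset.mul_sum, lintegral_const_mul]
        · gcongr
          exact lintegral_gaussian_enorm_sq_le μ y hy w hw C hb hτ.1
        · refine hKm.mul ?_
          fun_prop
    _ = ∫⁻ z : ℝ × ℝ, (∫⁻ τ in Ioo 0 δ, ENNReal.ofReal (τ ^ (s - 1)) *
          (‖∑ j, conj (w j z.1) * w j z.2‖ₑ * ENNReal.ofReal (π ^ ((n : ℝ) / 2) *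
          ‖(τ + ((z.1 - z.2 : ℝ) : ℂ) * Complex.I : ℂ)‖ ^ (-((n : ℝ) / 2))))) ∂(μ.prod μ) := by
        rw [lintegral_lintegral_swap]
        refine Measurable.aemeasurable ?_
        have hK : Measurable fun p : ℝ × (ℝ × ℝ) =>
            ‖∑ j, conj (w j p.2.1) * w j p.2.2‖ₑ := hKm.comp measurable_snd
        refine Measurable.mul (f := fun p : ℝ × (ℝ × ℝ) => ENNReal.ofReal (p.1 ^ (s - 1)))
          (by fun_prop) (hK.mul ?_)
        fun_prop
    _ = _ := by
        refine lintegral_congr fun z => ?_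
        rw [dispKer, ← lintegral_const_mul _ (by fun_prop), ← lintegral_const_mul _ (by fun_prop)]
        refine setLIntegral_congr_fun measurableSet_Ioo fun τ hτ => ?_
        rw [ENNReal.ofReal_mul (by positivity),
          ENNReal.ofReal_mul (Real.rpow_nonneg hτ.1.le _)]
        ring

/-- The contribution of the cut-off frequencies `ρ F_j` along the curve `y`, bounded through the
near and far parts of the dispersive kernel. -/
lemma sum_lintegral_high_le {n : ℕ} {ι : Type*} [Fintype ι] (μ : Measure ℝ) [IsFiniteMeasure μ]
    (hμ : μ ≤ volume) (y : ℝ → Rn n) (hy : Measurable y) (F : ι → Rn n → ℂ)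
    (hFm : ∀ j, Measurable (F j)) (hF : ∀ j, Integrable (F j)) (s δ : ℝ) (B : ℝ≥0∞)
    (hB : ∀ φ : Rn n → ℂ, Measurable φ → ∑ j, ‖∫ ξ, φ ξ * F j ξ‖ₑ ^ 2
      ≤ B * ∫⁻ ξ, ‖φ ξ‖ₑ ^ 2 * ENNReal.ofReal (‖ξ‖ ^ (-(2 * s))))
    (ρ : Rn n → ℝ) (hρm : Measurable ρ) (hρ0 : ∀ ξ, 0 ≤ ρ ξ) (hρ1 : ∀ ξ, ρ ξ ≤ 1)
    (hρ : ∀ ξ, ENNReal.ofReal (ρ ξ ^ 2 * ‖ξ‖ ^ (-(2 * s)))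
      ≤ ENNReal.ofReal (1 / Real.Gamma s) * highMult s δ ξ)
    {c : ℝ≥0∞} (hc : c = B * ENNReal.ofReal (1 / Real.Gamma s) *
      ENNReal.ofReal (π ^ ((n : ℝ) / 2))) :
    ∑ j, ∫⁻ t, ‖∫ ξ, phase t (y t) ξ * ((ρ ξ : ℂ) * F j ξ)‖ₑ ^ 2 ∂μ ≤
      (Fintype.card ι : ℝ≥0∞) *
        (c * ∫⁻ r, (if |r| < δ then dispKer ((n : ℝ) / 2) s δ r else 0)) +
      (Fintype.card ι : ℝ≥0∞) ^ (1 / 2 : ℝ) * (μ univ *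
        (c ^ 2 * ∫⁻ r, (if |r| < δ then 0 else dispKer ((n : ℝ) / 2) s δ r) ^ 2)) ^ (1 / 2 : ℝ) := by
  have hρC : Measurable fun ξ => (ρ ξ : ℂ) := Complex.measurable_ofReal.comp hρm
  have hρn : ∀ ξ, ‖(ρ ξ : ℂ)‖ ≤ 1 := fun ξ => by
    rw [Complex.norm_real, Real.norm_of_nonneg (hρ0 ξ)]; exact hρ1 ξ
  have hρF : ∀ j, Integrable fun ξ => (ρ ξ : ℂ) * F j ξ := fun j =>
    (hF j).bdd_mul hρC.aestronglyMeasurable (.of_forall hρn)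
  let w : ι → ℝ → ℂ := fun j t => ∫ ξ, phase t (y t) ξ * ((ρ ξ : ℂ) * F j ξ)
  have hw : ∀ j, Measurable (w j) := fun j => by
    have h : Measurable fun z : ℝ × Rn n => phase z.1 (y z.1) z.2 * ((ρ z.2 : ℂ) * F j z.2) :=
      (measurable_phase_comp measurable_fst (hy.comp measurable_fst) measurable_snd).mul
        ((hρC.comp measurable_snd).mul ((hFm j).comp measurable_snd))
    exact h.stronglyMeasurable.integral_prod_right'.measurable
  have hb : ∀ j t, ‖w j t‖ ≤ ∑ i, ∫ ξ, ‖F i ξ‖ := fun j t => by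
    refine (norm_integral_le_of_norm_le (hF j).norm (.of_forall fun ξ => ?_)).trans
      (Finset.single_le_sum (f := fun i => ∫ ξ, ‖F i ξ‖)
        (fun i _ => integral_nonneg fun _ => norm_nonneg _) (Finset.mem_univ j))
    rw [norm_mul, norm_phase, one_mul, norm_mul]
    exact mul_le_of_le_one_left (norm_nonneg _) (hρn ξ)
  have hVm : ∀ j, Measurable fun ξ => ∫ t, phase t (y t) ξ * conj (w j t) ∂μ := fun j =>
    measurable_integral_phase_conj hy (hw j)
  let V : ι → Rn n → ℂ := fun j ξ => ∫ t, phase t (y t) ξ * conj (w j t) ∂μ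
  have hdual : ∀ j k, ∫ t, w k t * conj (w j t) ∂μ = ∫ ξ, ((ρ ξ : ℂ) * V j ξ) * F k ξ := by
    intro j k
    have hint : Integrable (fun p : ℝ × Rn n =>
        (phase p.1 (y p.1) p.2 * conj (w j p.1)) * ((ρ p.2 : ℂ) * F k p.2)) (μ.prod volume) := by
      refine ((hρF k).comp_snd μ).bdd_mul (c := ∑ i, ∫ ξ, ‖F i ξ‖)
        ((measurable_phase_comp measurable_fst (hy.comp measurable_fst) measurable_snd).mul
          (Complex.continuous_conj.measurable.comp
            ((hw j).comp measurable_fst))).aestronglyMeasurable (.of_forall fun p => ?_)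
      rw [norm_mul, norm_phase, one_mul, RCLike.norm_conj]
      exact hb j p.1
    calc ∫ t, w k t * conj (w j t) ∂μ
        = ∫ t, (∫ ξ, (phase t (y t) ξ * conj (w j t)) * ((ρ ξ : ℂ) * F k ξ)) ∂μ := by
          refine integral_congr_ae (.of_forall fun t => ?_)
          change (∫ ξ, phase t (y t) ξ * ((ρ ξ : ℂ) * F k ξ)) * conj (w j t) = _
          rw [← integral_mul_const]
          refine integral_congr_ae (.of_forall fun ξ => ?_)
          simp only
          ring
      _ = ∫ ξ, (∫ t, (phase t (y t) ξ * conj (w j t)) * ((ρ ξ : ℂ) * F k ξ) ∂μ) :=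
          integral_integral_swap hint
      _ = _ := by
          refine integral_congr_ae (.of_forall fun ξ => ?_)
          change _ = ((ρ ξ : ℂ) * ∫ t, phase t (y t) ξ * conj (w j t) ∂μ) * F k ξ
          simp only
          rw [integral_mul_const]
          ring
  have hker : ∑ j, ∑ k, ‖∫ t, w k t * conj (w j t) ∂μ‖ₑ ^ 2
      ≤ ∫⁻ z, ‖∑ j, conj (w j z.1) * w j z.2‖ₑ *
        (c * dispKer ((n : ℝ) / 2) s δ (z.1 - z.2)) ∂(μ.prod μ) := by
    calc ∑ j, ∑ k, ‖∫ t, w k t * conj (w j t) ∂μ‖ₑ ^ 2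
        ≤ ∑ j, B * (ENNReal.ofReal (1 / Real.Gamma s) *
            ∫⁻ ξ, highMult s δ ξ * ‖V j ξ‖ₑ ^ 2) := by
          refine Finset.sum_le_sum fun j _ => ?_
          simp_rw [hdual j]
          refine (hB (fun ξ => (ρ ξ : ℂ) * V j ξ) (hρC.mul (hVm j))).trans ?_
          gcongr
          have hm : Measurable fun ξ => highMult s δ ξ * ‖V j ξ‖ₑ ^ 2 :=
            (measurable_highMult s δ).mul ((hVm j).enorm.pow_const 2)
          rw [← lintegral_const_mul _ hm]
          refine lintegral_mono fun ξ => ?_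
          have h1 : ‖(ρ ξ : ℂ) * V j ξ‖ₑ ^ 2 * ENNReal.ofReal (‖ξ‖ ^ (-(2 * s)))
              = ENNReal.ofReal (ρ ξ ^ 2 * ‖ξ‖ ^ (-(2 * s))) * ‖V j ξ‖ₑ ^ 2 := by
            rw [enorm_mul, ENNReal.ofReal_mul (by positivity), ENNReal.ofReal_pow (hρ0 ξ),
              ← ofReal_norm (ρ ξ : ℂ), Complex.norm_real, Real.norm_of_nonneg (hρ0 ξ)]
            ring
          simp only
          rw [h1, ← mul_assoc]
          gcongr
          exact hρ ξ
      _ = (B * ENNReal.ofReal (1 / Real.Gamma s)) *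
            ∑ j, ∫⁻ ξ, highMult s δ ξ * ‖V j ξ‖ₑ ^ 2 := by
          simp_rw [← mul_assoc]
          rw [Finset.mul_sum]
      _ ≤ (B * ENNReal.ofReal (1 / Real.Gamma s)) * ∫⁻ z : ℝ × ℝ,
            ‖∑ j, conj (w j z.1) * w j z.2‖ₑ *
            (ENNReal.ofReal (π ^ ((n : ℝ) / 2)) * dispKer ((n : ℝ) / 2) s δ (z.1 - z.2))
            ∂(μ.prod μ) := by
          gcongr
          exact lintegral_highMult_enorm_sq_le μ y hy w hw _ hb s δ
      _ = _ := by
          have hm : Measurable fun z : ℝ × ℝ => ‖∑ j, conj (w j z.1) * w j z.2‖ₑ *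
              (ENNReal.ofReal (π ^ ((n : ℝ) / 2)) * dispKer ((n : ℝ) / 2) s δ (z.1 - z.2)) :=
            (Finset.measurable_sum _ fun j _ =>
              (Complex.continuous_conj.measurable.comp ((hw j).comp measurable_fst)).mul
                ((hw j).comp measurable_snd)).enorm.mul
              (((measurable_dispKer _ s δ).comp (measurable_fst.sub measurable_snd)).const_mul _)
          rw [← lintegral_const_mul _ hm, hc]
          refine lintegral_congr fun z => ?_
          ring
  have hD := measurable_dispKer ((n : ℝ) / 2) s δ
  have hset : MeasurableSet {r : ℝ | |r| < δ} := measurableSet_lt (by fun_prop) measurable_const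
  have hn : Measurable fun r : ℝ => if |r| < δ then dispKer ((n : ℝ) / 2) s δ r else 0 :=
    Measurable.ite hset hD measurable_const
  have hf : Measurable fun r : ℝ => if |r| < δ then 0 else dispKer ((n : ℝ) / 2) s δ r :=
    Measurable.ite hset measurable_const hD
  refine (trace_le_of_kernel μ hμ w hw _ hb _ _ (hn.const_mul c) (hf.const_mul c)
    (hker.trans_eq (lintegral_congr fun z => ?_))).trans_eq ?_
  · rw [← mul_add]
    congr 2
    split_ifs <;> simp
  · rw [lintegral_const_mul _ hn]
    simp_rw [mul_pow]
    rw [lintegral_const_mul _ (hf.pow_const 2)]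

/-- The single-scale bound: along a measurable curve, over a set of finite measure, a finite
system satisfying Bessel's inequality with weight `|ξ|^{-2s}`. -/
lemma exists_curve_bound {n : ℕ} (hn : 2 ≤ n) {q s : ℝ} (hq : 1 < q)
    (hs : s = (n : ℝ) / 2 - 1 / q) {b : ℝ} (hb : 0 < b) :
    ∃ C : ℝ, 0 < C ∧ ∀ (ι : Type) [Fintype ι] [Nonempty ι] (E : Set ℝ), MeasurableSet E →
      volume E ≠ 0 → volume E ≠ ∞ → ∀ (y : ℝ → Rn n), Measurable y →
      ∀ (F : ι → Rn n → ℂ), (∀ j, Measurable (F j)) → (∀ j, Integrable (F j)) →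
      (∀ φ : Rn n → ℂ, Measurable φ → ∑ j, ‖∫ ξ, φ ξ * F j ξ‖ₑ ^ 2
        ≤ ENNReal.ofReal b * ∫⁻ ξ, ‖φ ξ‖ₑ ^ 2 * ENNReal.ofReal (‖ξ‖ ^ (-(2 * s)))) →
      ∑ j, ∫⁻ t in E, ‖∫ ξ, phase t (y t) ξ * F j ξ‖ₑ ^ 2
        ≤ ENNReal.ofReal C * ((Fintype.card ι : ℝ≥0∞) ^ (1 / q) * volume E ^ (1 - 1 / q)) := by
  have hn' : (2 : ℝ) ≤ n := by exact_mod_cast hn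
  have hq0 : 0 < 1 / q := by positivity
  have hq1 : 1 / q < 1 := by rw [div_lt_one (by linarith)]; exact hq
  set β : ℝ := (n : ℝ) / 2 with hβ
  have hβ1 : 1 ≤ β := by rw [hβ]; linarith
  have hs0 : 0 < s := by rw [hs]; linarith
  have hΓ : 0 < Real.Gamma s := Real.Gamma_pos_of_pos hs0
  set a : ℝ := β - (1 + 1 / q) / 2 with ha
  have ha0 : 0 ≤ a := by rw [ha]; linarith
  have has : a < s := by rw [ha, hs]; linarith
  have haβ : a ≤ β := by rw [ha]; linarith
  have haβ1 : β - 1 < a := by rw [ha]; linarith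
  have hsβ : s < β := by rw [hs]; linarith
  set C₀ : ℝ := π ^ β / (Real.Gamma s * (β - s))
  set C₁ : ℝ := 2 / ((s - a) * (a - β + 1))
  set C₂ : ℝ := 2 / (s ^ 2 * (2 * β - 1))
  have hC₀p : 0 < C₀ := div_pos (by positivity) (mul_pos hΓ (by linarith))
  have hC₁p : 0 < C₁ := div_pos (by positivity) (mul_pos (by linarith) (by linarith))
  have hC₂p : 0 < C₂ := div_pos (by positivity) (mul_pos (by positivity) (by linarith))
  set c : ℝ := b * (1 / Real.Gamma s) * π ^ β with hc
  have hcp : 0 < c := by positivity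
  refine ⟨2 * (b * C₀) + 2 * (c * C₁ + c * C₂ ^ (1 / 2 : ℝ)), by positivity, ?_⟩
  intro ι _ _ E hE hE0 hEt y hy F hFm hF hB
  set N : ℝ := (Fintype.card ι : ℝ) with hN
  have hNp : 0 < N := by rw [hN]; exact_mod_cast Fintype.card_pos
  set e : ℝ := (volume E).toReal with he
  have hep : 0 < e := ENNReal.toReal_pos hE0 hEt
  have hEe : volume E = ENNReal.ofReal e := (ENNReal.ofReal_toReal hEt).symm
  have hNe : (Fintype.card ι : ℝ≥0∞) = ENNReal.ofReal N := by rw [hN, ENNReal.ofReal_natCast]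
  set δ : ℝ := e / N with hδ
  have hδp : 0 < δ := div_pos hep hNp
  set M : ℝ := N ^ (1 / q) * e ^ (1 - 1 / q) with hM
  have hMp : 0 < M := by positivity
  have hδpow : ∀ p : ℝ, δ ^ p = e ^ p * N ^ (-p) := fun p => by
    rw [hδ, Real.div_rpow hep.le hNp.le, Real.rpow_neg hNp.le, div_eq_mul_inv]
  have hlowM : e * δ ^ (s - β) = M := by
    rw [hδpow, hM, show s - β = -(1 / q) by rw [hs]; ring, neg_neg, sub_eq_add_neg,
      Real.rpow_add hep, Real.rpow_one]
    ring
  have hnearM : N * δ ^ (s + 1 - β) = M := by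
    rw [hδpow, hM, show s + 1 - β = 1 - 1 / q by rw [hs]; ring,
      show -(1 - 1 / q) = -1 + 1 / q by ring, Real.rpow_add hNp, Real.rpow_neg_one]
    field_simp
  have hfarM : N ^ (1 / 2 : ℝ) * (e * δ ^ (2 * s + 1 - 2 * β)) ^ (1 / 2 : ℝ) = M := by
    rw [← Real.mul_rpow hNp.le (by positivity), hδpow, hM,
      show 2 * s + 1 - 2 * β = 1 - 2 * (1 / q) by rw [hs]; ring,
      show N * (e * (e ^ (1 - 2 * (1 / q)) * N ^ (-(1 - 2 * (1 / q)))))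
        = N ^ (2 * (1 / q)) * e ^ (2 - 2 * (1 / q)) by
        rw [show 2 * (1 / q) = 1 + -(1 - 2 * (1 / q)) by ring, Real.rpow_add hNp, Real.rpow_one,
          show 2 - (1 + -(1 - 2 * (1 / q))) = 1 + (1 - 2 * (1 / q)) by ring,
          Real.rpow_add hep, Real.rpow_one]
        ring_nf,
      Real.mul_rpow (by positivity) (by positivity), ← Real.rpow_mul hNp.le,
      ← Real.rpow_mul hep.le]
    congr 2 <;> ring
  obtain ⟨ρ, hρm, hρ0, hρ1, hρh, hρl⟩ := exists_cutoff (n := n) hs0 hδp hsβ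
  have hρC : Measurable fun ξ => (ρ ξ : ℂ) := Complex.measurable_ofReal.comp hρm
  have hρn : ∀ ξ, ‖(ρ ξ : ℂ)‖ ≤ 1 := fun ξ => by
    rw [Complex.norm_real, Real.norm_of_nonneg (hρ0 ξ)]; exact hρ1 ξ
  have hρn' : ∀ ξ, ‖(1 - ρ ξ : ℂ)‖ = 1 - ρ ξ := fun ξ => by
    rw [← Complex.ofReal_one, ← Complex.ofReal_sub, Complex.norm_real,
      Real.norm_of_nonneg (by linarith [hρ1 ξ])]
  have hpm : ∀ t, Measurable fun ξ => phase t (y t) ξ := fun t =>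
    measurable_phase_comp measurable_const measurable_const measurable_id
  have hint : ∀ j t (g : Rn n → ℂ), Measurable g → (∀ ξ, ‖g ξ‖ ≤ 1) →
      Integrable fun ξ => phase t (y t) ξ * (g ξ * F j ξ) := by
    intro j t g hg hg1
    refine Integrable.bdd_mul (c := 1) ?_ (hpm t).aestronglyMeasurable
      (.of_forall fun ξ => (norm_phase _ _ _).le)
    exact (hF j).bdd_mul hg.aestronglyMeasurable (.of_forall hg1)
  set lo : ι → ℝ → ℂ := fun j t => ∫ ξ, phase t (y t) ξ * ((1 - ρ ξ : ℂ) * F j ξ) with hlo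
  set hi : ι → ℝ → ℂ := fun j t => ∫ ξ, phase t (y t) ξ * ((ρ ξ : ℂ) * F j ξ) with hhi
  have hmeas : ∀ (g : Rn n → ℂ) (j : ι), Measurable g →
      Measurable fun t => ∫ ξ, phase t (y t) ξ * (g ξ * F j ξ) := by
    intro g j hg
    have h : Measurable fun z : ℝ × Rn n => phase z.1 (y z.1) z.2 * (g z.2 * F j z.2) :=
      (measurable_phase_comp measurable_fst (hy.comp measurable_fst) measurable_snd).mul
        ((hg.comp measurable_snd).mul ((hFm j).comp measurable_snd))
    exact h.stronglyMeasurable.integral_prod_right'.measurable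
  have hlom : ∀ j, Measurable (lo j) := fun j => hmeas _ j (measurable_const.sub hρC)
  have hhim : ∀ j, Measurable (hi j) := fun j => hmeas _ j hρC
  have hsplit : ∀ j t, ‖∫ ξ, phase t (y t) ξ * F j ξ‖ₑ ^ 2
      ≤ 2 * ‖lo j t‖ₑ ^ 2 + 2 * ‖hi j t‖ₑ ^ 2 := by
    intro j t
    have h1 : ∫ ξ, phase t (y t) ξ * F j ξ = lo j t + hi j t := by
      rw [hlo, hhi]
      simp only
      rw [← integral_add (hint j t (fun ξ => 1 - ρ ξ) (measurable_const.sub hρC) fun ξ => by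
        rw [hρn']; linarith [hρ0 ξ]) (hint j t _ hρC hρn)]
      refine integral_congr_ae (.of_forall fun ξ => ?_)
      simp only
      ring
    rw [h1, ← ofReal_norm, ← ofReal_norm, ← ofReal_norm, ← ENNReal.ofReal_pow (norm_nonneg _),
      ← ENNReal.ofReal_pow (norm_nonneg _), ← ENNReal.ofReal_pow (norm_nonneg _),
      ← ENNReal.ofReal_ofNat 2, ← ENNReal.ofReal_mul (by norm_num),
      ← ENNReal.ofReal_mul (by norm_num), ← ENNReal.ofReal_add (by positivity) (by positivity)]
    refine ENNReal.ofReal_le_ofReal ?_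
    nlinarith [norm_add_le (lo j t) (hi j t), norm_nonneg (lo j t + hi j t),
      sq_nonneg (‖lo j t‖ - ‖hi j t‖)]
  have hlow : ∑ j, ∫⁻ t in E, ‖lo j t‖ₑ ^ 2 ≤ ENNReal.ofReal (b * C₀ * M) := by
    rw [← lintegral_finsetSum _ fun j _ => (hlom j).enorm.pow_const 2]
    calc ∫⁻ t in E, ∑ j, ‖lo j t‖ₑ ^ 2
        ≤ ∫⁻ t in E, ENNReal.ofReal b * ENNReal.ofReal (C₀ * δ ^ (s - β)) := by
          refine lintegral_mono fun t => ?_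
          have hφ : ∀ j, lo j t = ∫ ξ, (phase t (y t) ξ * (1 - ρ ξ : ℂ)) * F j ξ := fun j => by
            simp only [hlo, mul_assoc]
          simp_rw [hφ]
          refine (hB (fun ξ => phase t (y t) ξ * (1 - ρ ξ : ℂ))
            ((hpm t).mul (measurable_const.sub hρC))).trans ?_
          gcongr
          refine le_trans (lintegral_mono fun ξ => ?_) hρl
          rw [enorm_mul, ← ofReal_norm, ← ofReal_norm, norm_phase, hρn',
            ENNReal.ofReal_one, one_mul, ENNReal.ofReal_mul (by positivity),
            ENNReal.ofReal_pow (by linarith [hρ1 ξ])]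
      _ = _ := by
          rw [lintegral_const, Measure.restrict_apply_univ, hEe,
            ← ENNReal.ofReal_mul (by positivity), ← ENNReal.ofReal_mul (by positivity), ← hlowM]
          ring_nf
  have hhigh : ∑ j, ∫⁻ t in E, ‖hi j t‖ₑ ^ 2
      ≤ ENNReal.ofReal ((c * C₁ + c * C₂ ^ (1 / 2 : ℝ)) * M) := by
    have : IsFiniteMeasure (volume.restrict E) := ⟨by
      rw [Measure.restrict_apply_univ]; exact hEt.lt_top⟩
    have hcE : ENNReal.ofReal c = ENNReal.ofReal b * ENNReal.ofReal (1 / Real.Gamma s) *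
        ENNReal.ofReal (π ^ ((n : ℝ) / 2)) := by
      rw [← ENNReal.ofReal_mul hb.le, ← ENNReal.ofReal_mul (by positivity)]
    refine (sum_lintegral_high_le (volume.restrict E) Measure.restrict_le_self y hy F hFm hF s δ
      (ENNReal.ofReal b) hB ρ hρm hρ0 hρ1 hρh hcE).trans ?_
    rw [add_mul, ENNReal.ofReal_add (by positivity) (by positivity)]
    refine add_le_add ?_ ?_
    · calc (Fintype.card ι : ℝ≥0∞) * (ENNReal.ofReal c *
            ∫⁻ r, (if |r| < δ then dispKer β s δ r else 0))
          ≤ ENNReal.ofReal N * (ENNReal.ofReal c * ENNReal.ofReal (C₁ * δ ^ (s + 1 - β))) := by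
            rw [hNe]
            gcongr
            exact lintegral_dispKer_near hδp ha0 has haβ haβ1
        _ = _ := by
            rw [← ENNReal.ofReal_mul hcp.le, ← ENNReal.ofReal_mul hNp.le, ← hnearM]
            ring_nf
    · calc (Fintype.card ι : ℝ≥0∞) ^ (1 / 2 : ℝ) * ((volume.restrict E) univ *
            (ENNReal.ofReal c ^ 2 *
              ∫⁻ r, (if |r| < δ then 0 else dispKer β s δ r) ^ 2)) ^ (1 / 2 : ℝ)
          ≤ ENNReal.ofReal N ^ (1 / 2 : ℝ) * (ENNReal.ofReal e * (ENNReal.ofReal c ^ 2 *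
              ENNReal.ofReal (C₂ * δ ^ (2 * s + 1 - 2 * β)))) ^ (1 / 2 : ℝ) := by
            rw [hNe, Measure.restrict_apply_univ, hEe]
            gcongr
            exact lintegral_dispKer_far hδp hs0 hβ1
        _ = _ := by
            rw [← ENNReal.ofReal_pow hcp.le, ← ENNReal.ofReal_mul (by positivity),
              ← ENNReal.ofReal_mul hep.le, ENNReal.ofReal_rpow_of_pos hNp,
              ENNReal.ofReal_rpow_of_pos (by positivity), ← ENNReal.ofReal_mul (by positivity),
              ← hfarM,
              show e * (c ^ 2 * (C₂ * δ ^ (2 * s + 1 - 2 * β)))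
                = c ^ 2 * (C₂ * (e * δ ^ (2 * s + 1 - 2 * β))) by ring,
              Real.mul_rpow (x := c ^ 2) (by positivity) (by positivity),
              Real.mul_rpow (x := C₂) (by positivity) (by positivity),
              ← Real.sqrt_eq_rpow (c ^ 2), Real.sqrt_sq hcp.le]
            ring_nf
  have hMe : (Fintype.card ι : ℝ≥0∞) ^ (1 / q) * volume E ^ (1 - 1 / q) = ENNReal.ofReal M := by
    rw [hNe, hEe, ENNReal.ofReal_rpow_of_pos hNp, ENNReal.ofReal_rpow_of_pos hep,
      ← ENNReal.ofReal_mul (by positivity)]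
  rw [hMe, ← ENNReal.ofReal_mul (by positivity)]
  calc ∑ j, ∫⁻ t in E, ‖∫ ξ, phase t (y t) ξ * F j ξ‖ₑ ^ 2
      ≤ ∑ j, (2 * (∫⁻ t in E, ‖lo j t‖ₑ ^ 2) + 2 * ∫⁻ t in E, ‖hi j t‖ₑ ^ 2) := by
        refine Finset.sum_le_sum fun j _ => ?_
        rw [← lintegral_const_mul _ ((hlom j).enorm.pow_const 2),
          ← lintegral_const_mul _ ((hhim j).enorm.pow_const 2),
          ← lintegral_add_left (((hlom j).enorm.pow_const 2).const_mul 2)]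
        exact lintegral_mono fun t => hsplit j t
    _ = 2 * (∑ j, ∫⁻ t in E, ‖lo j t‖ₑ ^ 2) + 2 * ∑ j, ∫⁻ t in E, ‖hi j t‖ₑ ^ 2 := by
        rw [Finset.sum_add_distrib, Finset.mul_sum, Finset.mul_sum]
    _ ≤ 2 * ENNReal.ofReal (b * C₀ * M)
          + 2 * ENNReal.ofReal ((c * C₁ + c * C₂ ^ (1 / 2 : ℝ)) * M) := by gcongr
    _ = _ := by
        rw [← ENNReal.ofReal_ofNat 2, ← ENNReal.ofReal_mul (by norm_num),
          ← ENNReal.ofReal_mul (by norm_num), ← ENNReal.ofReal_add (by positivity) (by positivity)]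
        ring_nf

lemma measurable_FT {n : ℕ} (f : Rn n → ℂ) : Measurable (FT f) := by
  by_cases hf : Integrable f
  · refine Continuous.measurable (continuous_of_dominated (bound := fun x => ‖f x‖) (fun ξ => ?_)
      (fun ξ => .of_forall fun x => ?_) hf.norm (.of_forall fun x => ?_))
    · refine AEStronglyMeasurable.mul (Continuous.aestronglyMeasurable ?_) hf.1
      simp_rw [dotC_eq_inner]
      fun_prop
    · rw [norm_mul, dotC_eq_inner, show -(Complex.I * ((inner ℝ x ξ : ℝ) : ℂ))
        = ((-inner ℝ x ξ : ℝ) : ℂ) * Complex.I by push_cast; ring,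
        Complex.norm_exp_ofReal_mul_I, one_mul]
    · simp_rw [dotC_eq_inner]
      fun_prop
  · have h0 : FT f = fun _ => 0 := by
      funext ξ
      refine integral_undef fun h => hf ?_
      have h1 : Continuous fun x : Rn n => Complex.exp (Complex.I * dotC x ξ) := by
        simp_rw [dotC_eq_inner]
        fun_prop
      refine (h.bdd_mul (c := 1) h1.aestronglyMeasurable (.of_forall fun x => ?_)).congr
        (.of_forall fun x => ?_)
      · rw [dotC_eq_inner, mul_comm, Complex.norm_exp_ofReal_mul_I]
      · simp only
        rw [← mul_assoc, ← Complex.exp_add, add_neg_cancel, Complex.exp_zero, one_mul]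
    rw [h0]
    exact measurable_const

/-- Bessel's inequality for systems orthonormal in `Ḣ^s`, tested against `φ |ξ|^{-s} ∈ L²`. -/
lemma OrthonormalHs.sum_enorm_integral_sq_le {n : ℕ} [Nontrivial (Rn n)] {s : ℝ}
    {f : ℕ → Rn n → ℂ}
    (hf : OrthonormalHs s f) (J : Finset ℕ) (φ : Rn n → ℂ) (hφ : Measurable φ) :
    ∑ j ∈ J, ‖∫ ξ, φ ξ * FT (f j) ξ‖ₑ ^ 2 ≤ ENNReal.ofReal ((2 * π) ^ (n : ℝ)) *
      ∫⁻ ξ, ‖φ ξ‖ₑ ^ 2 * ENNReal.ofReal (‖ξ‖ ^ (-(2 * s))) := by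
  have hb : 0 < (2 * π : ℝ) ^ (n : ℝ) := by positivity
  by_cases htop : ∫⁻ ξ, ‖φ ξ‖ₑ ^ 2 * ENNReal.ofReal (‖ξ‖ ^ (-(2 * s))) = ∞
  · rw [htop, ENNReal.mul_top (by simpa using hb)]
    exact le_top
  set κ : ℝ := (2 * π : ℝ) ^ (-(n : ℝ) / 2) with hκ
  have hκp : 0 < κ := by positivity
  have hκ2 : κ ^ 2 = (2 * π : ℝ) ^ (-(n : ℝ)) := by
    rw [hκ, ← Real.rpow_natCast, ← Real.rpow_mul (by positivity)]
    congr 1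
    push_cast
    ring
  have hrp : ∀ (a : ℝ) (ξ : Rn n), ‖ξ‖ ^ (2 * a) = (‖ξ‖ ^ a) ^ 2 := fun a ξ => by
    rw [← Real.rpow_natCast, ← Real.rpow_mul (norm_nonneg _)]
    congr 1
    push_cast
    ring
  let g : ℕ → Rn n → ℂ := fun j ξ => ((κ * ‖ξ‖ ^ s : ℝ) : ℂ) * FT (f j) ξ
  let h : Rn n → ℂ := fun ξ => ((‖ξ‖ ^ (-s) : ℝ) : ℂ) * conj (φ ξ)
  have hgm : ∀ j, Measurable (g j) := fun j =>
    (Complex.measurable_ofReal.comp (by fun_prop)).mul (measurable_FT _)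
  have hhm : Measurable h :=
    (Complex.measurable_ofReal.comp (by fun_prop)).mul
      (Complex.continuous_conj.measurable.comp hφ)
  have hgg : ∀ j k ξ, conj (g j ξ) * g k ξ = ((κ ^ 2 : ℝ) : ℂ) * (((‖ξ‖ ^ (2 * s) : ℝ) : ℂ) *
      (FT (f k) ξ * conj (FT (f j) ξ))) := by
    intro j k ξ
    simp only [g, map_mul, Complex.conj_ofReal, hrp]
    push_cast
    ring
  have hg2 : ∀ j, MemLp (g j) 2 := by
    intro j
    rw [memLp_two_iff_integrable_sq_norm (hgm j).aestronglyMeasurable]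
    have hint : Integrable fun ξ : Rn n =>
        ((‖ξ‖ ^ (2 * s) : ℝ) : ℂ) * (FT (f j) ξ * conj (FT (f j) ξ)) := by
      by_contra hcon
      have := hf j j
      rw [integral_undef hcon] at this
      simp at this
    refine (hint.norm.const_mul (κ ^ 2)).congr (.of_forall fun ξ => ?_)
    simp only [g, norm_mul, Complex.norm_real, RCLike.norm_conj, hrp]
    rw [norm_pow, mul_pow, mul_pow, Real.norm_of_nonneg hκp.le]
    ring
  have hh2' : ∫⁻ ξ, ‖h ξ‖ₑ ^ 2 = ∫⁻ ξ, ‖φ ξ‖ₑ ^ 2 * ENNReal.ofReal (‖ξ‖ ^ (-(2 * s))) := by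
    refine lintegral_congr fun ξ => ?_
    simp only [h]
    rw [enorm_mul, ← ofReal_norm, ← ofReal_norm, RCLike.norm_conj, Complex.norm_real,
      ofReal_norm (φ ξ), Real.norm_of_nonneg (by positivity), mul_pow,
      ← ENNReal.ofReal_pow (by positivity), ← hrp, mul_comm]
    ring_nf
  have hnorm : ∀ u : Rn n → ℂ, eLpNorm u 2 volume ^ 2 = ∫⁻ ξ, ‖u ξ‖ₑ ^ 2 := fun u => by
    have := eLpNorm_nnreal_pow_eq_lintegral (f := u) (p := 2) (μ := volume) (by norm_num)
    simpa using this
  have hh2 : MemLp h 2 := by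
    refine ⟨hhm.aestronglyMeasurable,
      ((ENNReal.pow_lt_top_iff (n := 2)).1 ?_).resolve_right (by norm_num)⟩
    rw [hnorm, hh2']
    exact lt_top_iff_ne_top.2 htop
  have horth : Orthonormal ℂ fun j => (hg2 j).toLp (g j) := by
    rw [orthonormal_iff_ite]
    intro j k
    rw [L2.inner_def]
    have h1 : ∫ ξ, inner ℂ ((hg2 j).toLp (g j) ξ) ((hg2 k).toLp (g k) ξ)
        = ∫ ξ, conj (g j ξ) * g k ξ := by
      refine integral_congr_ae ?_
      filter_upwards [(hg2 j).coeFn_toLp, (hg2 k).coeFn_toLp] with ξ h1 h2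
      rw [h1, h2, RCLike.inner_apply, mul_comm]
    rw [h1]
    simp_rw [hgg]
    rw [integral_const_mul, hκ2]
    have := hf k j
    rw [Complex.real_smul] at this
    rw [this]
    simp [eq_comm]
  have hbes := horth.sum_inner_products_le (hh2.toLp h) (s := J)
  have hin : ∀ j, ‖∫ ξ, φ ξ * FT (f j) ξ‖ ^ 2
      = (2 * π : ℝ) ^ (n : ℝ) * ‖inner ℂ ((hg2 j).toLp (g j)) (hh2.toLp h)‖ ^ 2 := by
    intro j
    have h1 : inner ℂ ((hg2 j).toLp (g j)) (hh2.toLp h)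
        = (κ : ℂ) * conj (∫ ξ, φ ξ * FT (f j) ξ) := by
      rw [L2.inner_def, ← integral_conj, ← integral_const_mul]
      refine integral_congr_ae ?_
      have h0 : ∀ᵐ ξ : Rn n, ξ ≠ 0 := by simp [ae_iff]
      filter_upwards [(hg2 j).coeFn_toLp, hh2.coeFn_toLp, h0] with ξ h1 h2 h3
      rw [h1, h2, RCLike.inner_apply]
      simp only [g, h, map_mul, Complex.conj_ofReal]
      have h4 : ‖ξ‖ ^ (-s) * ‖ξ‖ ^ s = 1 := by
        rw [← Real.rpow_add (norm_pos_iff.2 h3), neg_add_cancel, Real.rpow_zero]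
      have h5 : ((‖ξ‖ ^ (-s) : ℝ) : ℂ) * ((‖ξ‖ ^ s : ℝ) : ℂ) = 1 := by
        rw [← Complex.ofReal_mul, h4, Complex.ofReal_one]
      push_cast at h5 ⊢
      linear_combination (κ : ℂ) * conj (φ ξ) * conj (FT (f j) ξ) * h5
    rw [h1, norm_mul, RCLike.norm_conj, mul_pow, Complex.norm_real,
      Real.norm_of_nonneg hκp.le, hκ2, ← mul_assoc, ← Real.rpow_add (by positivity),
      add_neg_cancel, Real.rpow_zero, one_mul]
  have hx : ENNReal.ofReal (‖hh2.toLp h‖ ^ 2) = ∫⁻ ξ, ‖h ξ‖ₑ ^ 2 := by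
    rw [← hnorm, ENNReal.ofReal_pow (norm_nonneg _), ofReal_norm, Lp.enorm_toLp]
  calc ∑ j ∈ J, ‖∫ ξ, φ ξ * FT (f j) ξ‖ₑ ^ 2
      = ENNReal.ofReal (∑ j ∈ J, ‖∫ ξ, φ ξ * FT (f j) ξ‖ ^ 2) := by
        rw [ENNReal.ofReal_sum_of_nonneg fun _ _ => by positivity]
        simp_rw [ENNReal.ofReal_pow (norm_nonneg _), ofReal_norm]
    _ ≤ ENNReal.ofReal ((2 * π) ^ (n : ℝ) * ‖hh2.toLp h‖ ^ 2) := by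
        simp_rw [hin]
        rw [← Finset.mul_sum]
        gcongr
    _ = _ := by rw [ENNReal.ofReal_mul hb.le, hx, hh2']

lemma natCast_rpow_le_sum {p : ℝ} (hp1 : p ≤ 1) {m : ℕ} (hm : 0 < m) :
    (m : ℝ≥0∞) ^ p ≤ ∑ k ∈ Finset.range m, ((k : ℝ≥0∞) + 1) ^ p * ((k : ℝ≥0∞) + 1)⁻¹ := by
  have hw : ∀ x : ℝ≥0∞, x ≠ 0 → x ≠ ∞ → x ^ p * x⁻¹ = (x ^ (1 - p))⁻¹ := fun x h0 ht => by
    rw [← ENNReal.rpow_neg, ← ENNReal.rpow_neg_one, ← ENNReal.rpow_add _ _ h0 ht]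
    ring_nf
  have hm0 : (m : ℝ≥0∞) ≠ 0 := by exact_mod_cast hm.ne'
  calc (m : ℝ≥0∞) ^ p = ∑ _k ∈ Finset.range m, (m : ℝ≥0∞) ^ p * (m : ℝ≥0∞)⁻¹ := by
        rw [Finset.sum_const, Finset.card_range, nsmul_eq_mul, mul_left_comm,
          ENNReal.mul_inv_cancel hm0 (by simp), mul_one]
    _ ≤ _ := by
        refine Finset.sum_le_sum fun k hk => ?_
        rw [hw _ hm0 (by simp), hw _ (by simp) (by finiteness)]
        refine ENNReal.inv_le_inv.2 (ENNReal.rpow_le_rpow ?_ (by linarith))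
        exact_mod_cast Finset.mem_range.1 hk

/-- Abel summation in Lorentz form: a restricted-type bound on the partial sums of `S` yields a
bound of `∑ |λ_j| S_j` by the `ℓ^{1/p,1}` norm. -/
lemma tsum_mul_le_seqLor {p : ℝ} (hp1 : p ≤ 1) (lam : ℕ → ℝ)
    (S : ℕ → ℝ≥0∞) (A : ℝ≥0∞) (hS : ∀ J : Finset ℕ, J.Nonempty →
      ∑ j ∈ J, S j ≤ A * (J.card : ℝ≥0∞) ^ p) :
    ∑' j, ENNReal.ofReal |lam j| * S j ≤ A * seqLor p 1 lam := by
  let c : ℕ → ℝ≥0∞ := fun k => ((k : ℝ≥0∞) + 1) ^ p * ((k : ℝ≥0∞) + 1)⁻¹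
  let T : ℕ → Set ℝ := fun k => {σ : ℝ | 0 < σ ∧ ENNReal.ofReal σ ≤ seqRearr lam k}
  have hT : ∀ k, MeasurableSet (T k) := fun k =>
    (measurableSet_lt measurable_const measurable_id).inter
      (measurableSet_le ENNReal.measurable_ofReal measurable_const)
  have hTvol : ∀ k, volume (T k) ≤ seqRearr lam k := by
    intro k
    by_cases htop : seqRearr lam k = ∞
    · rw [htop]; exact le_top
    have hsub : T k ⊆ Ioc 0 (seqRearr lam k).toReal := fun σ hσ =>
      ⟨hσ.1, (ENNReal.ofReal_le_iff_le_toReal htop).1 hσ.2⟩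
    refine (measure_mono hsub).trans ?_
    rw [Real.volume_Ioc, sub_zero, ENNReal.ofReal_toReal htop]
  have hlor : seqLor p 1 lam = ∑' k, c k * seqRearr lam k := by
    rw [seqLor, div_one, ENNReal.rpow_one]
    refine tsum_congr fun k => ?_
    simp only [c, ENNReal.rpow_one]
    ring
  have hpt : ∀ σ : ℝ, 0 < σ → ∑' j, (Iio |lam j|).indicator (fun _ => S j) σ
      ≤ A * ∑' k, (T k).indicator (fun _ => c k) σ := by
    intro σ hσ
    rw [ENNReal.tsum_eq_iSup_sum]
    refine iSup_le fun J => ?_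
    set J' := J.filter fun j => σ < |lam j| with hJ'
    have h1 : ∑ j ∈ J, (Iio |lam j|).indicator (fun _ => S j) σ = ∑ j ∈ J', S j := by
      rw [hJ', Finset.sum_filter]
      exact Finset.sum_congr rfl fun j _ => by simp [indicator]
    rw [h1]
    rcases J'.eq_empty_or_nonempty with he | hne
    · rw [he]; simp
    refine (hS J' hne).trans ?_
    gcongr
    refine (natCast_rpow_le_sum hp1 (Finset.card_pos.2 hne)).trans
      (le_trans (Finset.sum_le_sum fun k hk => ?_) (ENNReal.sum_le_tsum _))
    have hmem : σ ∈ T k := by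
      refine ⟨hσ, le_sInf fun r hr => ?_⟩
      by_contra! hlt
      have h3 : (J'.card : ℝ≥0∞) ≤ k := by
        calc (J'.card : ℝ≥0∞) = Measure.count (J' : Set ℕ) := by
              rw [Measure.count_apply_finset]
          _ ≤ Measure.count {i : ℕ | r < ENNReal.ofReal |lam i|} := by
              refine measure_mono fun i hi => ?_
              have hi' : σ < |lam i| := (Finset.mem_filter.1 (Finset.mem_coe.1 hi)).2
              exact hlt.trans_le (ENNReal.ofReal_le_ofReal hi'.le)
          _ ≤ k := hr
      have h4 : J'.card ≤ k := by exact_mod_cast h3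
      exact absurd (Finset.mem_range.1 hk) (by omega)
    rw [indicator_of_mem hmem]
  calc ∑' j, ENNReal.ofReal |lam j| * S j
      = ∑' j, ∫⁻ σ in Ioi (0 : ℝ), (Iio |lam j|).indicator (fun _ => S j) σ := by
        refine tsum_congr fun j => ?_
        rw [lintegral_indicator_const measurableSet_Iio, Measure.restrict_apply measurableSet_Iio,
          inter_comm, Ioi_inter_Iio, Real.volume_Ioo, sub_zero, mul_comm]
    _ = ∫⁻ σ in Ioi (0 : ℝ), ∑' j, (Iio |lam j|).indicator (fun _ => S j) σ := by
        rw [lintegral_tsum fun j => (measurable_const.indicator measurableSet_Iio).aemeasurable]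
    _ ≤ ∫⁻ σ in Ioi (0 : ℝ), A * ∑' k, (T k).indicator (fun _ => c k) σ :=
        setLIntegral_mono' measurableSet_Ioi fun σ hσ => hpt σ hσ
    _ ≤ ∫⁻ σ, A * ∑' k, (T k).indicator (fun _ => c k) σ := setLIntegral_le_lintegral _ _
    _ = A * ∑' k, c k * volume (T k) := by
        rw [lintegral_const_mul _ (Measurable.tsum fun k =>
            measurable_const.indicator (hT k)),
          lintegral_tsum fun k => (measurable_const.indicator (hT k)).aemeasurable]
        congr 2
        funext k
        rw [lintegral_indicator_const (hT k)]
    _ ≤ A * seqLor p 1 lam := by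
        rw [hlor]
        gcongr with k
        exact hTvol k

lemma schrodinger_eq {n : ℕ} (f : Rn n → ℂ) (t : ℝ) (x : Rn n) :
    schrodinger f t x = ((2 * π : ℝ) ^ (-(n : ℝ)) : ℝ) • ∫ ξ, phase t x ξ * FT f ξ := by
  simp only [schrodinger, prop, one_mul, phase]

lemma schrodinger_of_not_integrable {n : ℕ} {f : Rn n → ℂ} (hf : ¬ Integrable (FT f)) (t : ℝ)
    (x : Rn n) : schrodinger f t x = 0 := by
  rw [schrodinger_eq, integral_undef, smul_zero]
  intro h
  have hm : Measurable fun ξ => (phase t x ξ)⁻¹ :=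
    (measurable_phase_comp measurable_const measurable_const measurable_id).inv
  refine hf ((h.bdd_mul (c := 1) hm.aestronglyMeasurable (.of_forall fun ξ => ?_)).congr
    (.of_forall fun ξ => ?_))
  · rw [norm_inv, norm_phase, inv_one]
  · have h0 : phase t x ξ ≠ 0 := norm_ne_zero_iff.1 (by rw [norm_phase]; exact one_ne_zero)
    exact inv_mul_cancel_left₀ h0 _

lemma continuous_schrodinger {n : ℕ} (f : Rn n → ℂ) :
    Continuous fun z : ℝ × Rn n => schrodinger f z.1 z.2 := by
  by_cases hf : Integrable (FT f)
  · simp_rw [schrodinger_eq]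
    have h : Continuous fun z : ℝ × Rn n => ∫ ξ, phase z.1 z.2 ξ * FT f ξ := by
      refine continuous_of_dominated (bound := fun ξ => ‖FT f ξ‖) (fun z => ?_)
        (fun z => .of_forall fun ξ => ?_) hf.norm (.of_forall fun ξ => ?_)
      · exact ((measurable_phase_comp measurable_const measurable_const measurable_id).mul
          (measurable_FT f)).aestronglyMeasurable
      · rw [norm_mul, norm_phase, one_mul]
      · exact (continuous_phase.comp (by fun_prop : Continuous fun z : ℝ × Rn n =>
          (z.1, z.2, ξ))).mul continuous_const
    exact h.const_smul ((2 * π : ℝ) ^ (-(n : ℝ)))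
  · simp_rw [schrodinger_of_not_integrable hf]
    exact continuous_const

/-- A weak-type bound for the maximal function `sup_x D(t, x)` follows from strong bounds along
measurable curves `t ↦ y(t)` over sets of finite measure. -/
lemma mul_measure_rpow_le_of_curve_bound {X : Type*} [TopologicalSpace X]
    [TopologicalSpace.SeparableSpace X] [Nonempty X] [MeasurableSpace X] {D : ℝ → X → ℝ≥0∞}
    (hm : ∀ x, Measurable fun t => D t x) (hl : ∀ t, LowerSemicontinuous (D t))
    {p : ℝ} (hp : 0 < p) (K : ℝ≥0∞)
    (hK : ∀ E : Set ℝ, MeasurableSet E → volume E ≠ 0 → volume E ≠ ∞ → ∀ y : ℝ → X, Measurable y →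
      ∫⁻ t in E, D t (y t) ≤ K * volume E ^ (1 - p)) (a : ℝ≥0∞) (ha : a ≠ ∞) :
    a * volume {t | ∃ x, a < D t x} ^ p ≤ K := by
  classical
  set d := TopologicalSpace.denseSeq X
  have hd : ∀ t, (∃ x, a < D t x) ↔ ∃ k, a < D t (d k) := by
    refine fun t => ⟨fun h => ?_, fun ⟨k, hk⟩ => ⟨_, hk⟩⟩
    exact (TopologicalSpace.denseRange_denseSeq X).exists_mem_open ((hl t).isOpen_preimage a) h
  simp_rw [hd]
  set G : Set ℝ := {t | ∃ k, a < D t (d k)} with hG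
  have hset : ∀ k, MeasurableSet {t | a < D t (d k)} := fun k =>
    measurableSet_lt measurable_const (hm _)
  have hGm : MeasurableSet G := by
    rw [hG, ofPred_exists]
    exact MeasurableSet.iUnion hset
  have hex : ∀ t, ∃ k, a < D t (d k) ∨ t ∉ G := fun t => by
    by_cases h : t ∈ G
    · exact h.imp fun k => Or.inl
    · exact ⟨0, Or.inr h⟩
  set y : ℝ → X := fun t => d (Nat.find (hex t))
  have hy : Measurable y := (measurable_from_nat (f := d)).comp
    (measurable_find hex fun k => (hset k).union hGm.compl)
  have hyG : ∀ t ∈ G, a < D t (y t) := fun t ht =>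
    (Nat.find_spec (hex t)).resolve_right (not_not.2 ht)
  have hE : ∀ m : ℕ, a * volume (G ∩ Icc (-(m : ℝ)) m) ^ p ≤ K := fun m => by
    set E := G ∩ Icc (-(m : ℝ)) m
    have hEm : MeasurableSet E := hGm.inter measurableSet_Icc
    have hEt : volume E ≠ ∞ := measure_ne_top_of_subset inter_subset_right (by simp)
    by_cases hE0 : volume E = 0
    · rw [hE0, ENNReal.zero_rpow_of_pos hp, mul_zero]
      exact zero_le
    have h1 : a * volume E ≤ K * volume E ^ (1 - p) := by
      rw [← setLIntegral_const]
      exact (setLIntegral_mono' hEm fun t ht => (hyG t ht.1).le).trans (hK E hEm hE0 hEt y hy)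
    have h0 : volume E ^ (1 - p) ≠ 0 := by simp [ENNReal.rpow_eq_zero_iff, hE0, hEt]
    have ht : volume E ^ (1 - p) ≠ ∞ := by simp [ENNReal.rpow_eq_top_iff, hE0, hEt]
    rw [← ENNReal.mul_le_mul_iff_left h0 ht, mul_assoc, ← ENNReal.rpow_add _ _ hE0 hEt,
      add_sub_cancel, ENNReal.rpow_one]
    exact h1
  have hmono : Monotone fun m : ℕ => G ∩ Icc (-(m : ℝ)) m := fun m m' h => by
    refine inter_subset_inter_right _ (Icc_subset_Icc ?_ ?_)
    · exact neg_le_neg (Nat.cast_le.2 h)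
    · exact Nat.cast_le.2 h
  have hU : ⋃ m : ℕ, G ∩ Icc (-(m : ℝ)) m = G := by
    rw [← inter_iUnion, inter_eq_left]
    intro t _
    obtain ⟨m, hm⟩ := exists_nat_ge |t|
    exact mem_iUnion.2 ⟨m, abs_le.1 hm⟩
  have hlim := tendsto_measure_iUnion_atTop (μ := volume) hmono
  rw [hU] at hlim
  exact le_of_tendsto' (ENNReal.Tendsto.const_mul
    ((ENNReal.continuous_rpow_const (y := p)).tendsto _ |>.comp hlim) (Or.inr ha)) hE

/-- The density bound along a measurable curve, over a set of finite measure. -/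
lemma exists_lintegral_density_le (n : ℕ) (hn : 2 ≤ n) (q s : ℝ) (hq : 1 < q)
    (hs : s = (n : ℝ) / 2 - 1 / q) :
    ∃ C : ℝ, 0 < C ∧ ∀ (f : ℕ → Rn n → ℂ) (lam : ℕ → ℝ), OrthonormalHs s f →
      ∀ E : Set ℝ, MeasurableSet E → volume E ≠ 0 → volume E ≠ ∞ →
      ∀ y : ℝ → Rn n, Measurable y →
      ∫⁻ t in E, ∑' j, ENNReal.ofReal |lam j| * ‖schrodinger (f j) t (y t)‖ₑ ^ 2
        ≤ ENNReal.ofReal C * seqLor (1 / q) 1 lam * volume E ^ (1 - 1 / q) := by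
  classical
  have : Nonempty (Fin n) := ⟨⟨0, by omega⟩⟩
  have : Nontrivial (Rn n) := inferInstance
  obtain ⟨C, hC, hcurve⟩ := exists_curve_bound hn hq hs
    (b := (2 * π : ℝ) ^ (n : ℝ)) (by positivity)
  set κ : ℝ := (2 * π : ℝ) ^ (-(n : ℝ)) with hκ
  have hκp : 0 < κ := by positivity
  refine ⟨κ ^ 2 * C, by positivity, fun f lam hf E hE hE0 hEt y hy => ?_⟩
  have hum : ∀ j, Measurable fun t => ‖schrodinger (f j) t (y t)‖ₑ ^ 2 := fun j =>
    (((continuous_schrodinger (f j)).measurable.comp (measurable_id.prodMk hy)).enorm).pow_const 2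
  have hq0 : 0 ≤ 1 / q := by positivity
  rw [lintegral_tsum fun j => ((hum j).const_mul _).aemeasurable]
  simp_rw [fun j => lintegral_const_mul (μ := volume.restrict E) (ENNReal.ofReal |lam j|) (hum j)]
  rw [mul_right_comm]
  refine tsum_mul_le_seqLor ((div_le_one (by linarith)).2 hq.le) lam _ _ fun J _ => ?_
  set J' := J.filter fun j => Integrable (FT (f j)) with hJ'
  have hsum : ∑ j ∈ J, ∫⁻ t in E, ‖schrodinger (f j) t (y t)‖ₑ ^ 2
      = ∑ j ∈ J', ∫⁻ t in E, ‖schrodinger (f j) t (y t)‖ₑ ^ 2 := by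
    refine (Finset.sum_filter_of_ne fun j _ hj => ?_).symm
    by_contra h
    exact hj (by simp [schrodinger_of_not_integrable h])
  rw [hsum]
  rcases J'.eq_empty_or_nonempty with h0 | h0
  · simp [h0]
  have : Nonempty J' := h0.to_subtype
  have key := hcurve J' E hE hE0 hEt y hy (fun j => FT (f j)) (fun j => measurable_FT _)
    (fun j => (Finset.mem_filter.1 j.2).2) fun φ hφ => by
      rw [Finset.sum_coe_sort J' fun j => ‖∫ ξ, φ ξ * FT (f j) ξ‖ₑ ^ 2]
      exact hf.sum_enorm_integral_sq_le J' φ hφ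
  rw [Finset.sum_coe_sort J' fun j => ∫⁻ t in E, ‖∫ ξ, phase t (y t) ξ * FT (f j) ξ‖ₑ ^ 2,
    Fintype.card_coe] at key
  have hterm : ∀ j, ∫⁻ t in E, ‖schrodinger (f j) t (y t)‖ₑ ^ 2
      = ENNReal.ofReal (κ ^ 2) * ∫⁻ t in E, ‖∫ ξ, phase t (y t) ξ * FT (f j) ξ‖ₑ ^ 2 := fun j => by
    rw [← lintegral_const_mul' _ _ ENNReal.ofReal_ne_top]
    refine lintegral_congr fun t => ?_
    rw [schrodinger_eq, ← hκ, enorm_smul, mul_pow, Real.enorm_of_nonneg hκp.le,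
      ENNReal.ofReal_pow hκp.le]
  simp_rw [hterm, ← Finset.mul_sum]
  have hcard : (J'.card : ℝ≥0∞) ^ (1 / q) ≤ (J.card : ℝ≥0∞) ^ (1 / q) := by
    gcongr
    exact Finset.filter_subset _ _
  calc _ ≤ ENNReal.ofReal (κ ^ 2) * (ENNReal.ofReal C *
        ((J.card : ℝ≥0∞) ^ (1 / q) * volume E ^ (1 - 1 / q))) := by
        gcongr
        exact key.trans (by gcongr)
    _ = _ := by
        rw [ENNReal.ofReal_mul (by positivity)]
        ring

end OS

/-- (Bez–Kinoshita–Shiraki.)  Boundary case `p = ∞`, critical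
exponent: for `n ≥ 2`, `1 < q < ∞` and `s = n/2 - 1/q`, the restricted weak-type
estimate `‖Σ λ_j |e^{itΔ}f_j|²‖_{L^{q,∞}(ℝ, L^∞(ℝⁿ))} ≲ ‖λ‖_{ℓ^{q,1}}` holds over
systems orthonormal in `Ḣ^s(ℝⁿ)`. -/
theorem boundary_p_infty_weak (n : ℕ) (hn : 2 ≤ n) (q s : ℝ) (hq : 1 < q)
    (hs : s = (n : ℝ) / 2 - 1 / q) :
    ∃ C : ℝ, 0 < C ∧ ∀ (f : ℕ → Rn n → ℂ) (lam : ℕ → ℝ),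
      OrthonormalHs s f → seqLor (1 / q) 1 lam ≠ ∞ →
      mixedWeakLp (ENNReal.ofReal q) ∞ (density lam f)
        ≤ ENNReal.ofReal C * seqLor (1 / q) 1 lam := by

  obtain ⟨C, hC, hcurve⟩ := exists_lintegral_density_le n hn q s hq hs
  refine ⟨C, hC, fun f lam hf _ => ?_⟩
  have hq0 : 0 < q := by linarith
  rw [mixedWeakLp, lor, if_neg ENNReal.ofReal_ne_top, if_pos rfl, ENNReal.toReal_ofReal hq0.le]
  refine iSup₂_le fun a _ => ?_
  have hc := fun j => continuous_schrodinger (f j)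
  refine le_trans ?_ (mul_measure_rpow_le_of_curve_bound
    (D := fun t x => ∑' j, ENNReal.ofReal |lam j| * ‖schrodinger (f j) t x‖ₑ ^ 2)
    (fun x => Measurable.tsum fun j => ?_) (fun t => ?_) (one_div_pos.2 hq0)
    (ENNReal.ofReal C * seqLor (1 / q) 1 lam)
    (hcurve f lam hf) (ENNReal.ofReal a) ENNReal.ofReal_ne_top)
  · gcongr
    rename_i t
    intro ht
    by_contra! h
    refine ht.not_ge ?_
    rw [eLpNorm_exponent_top, eLpNormEssSup]
    refine essSup_le_of_ae_le _ (.of_forall fun x => le_trans ?_ (h x))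
    refine (enorm_tsum_le_tsum_enorm).trans (ENNReal.tsum_le_tsum fun j => le_of_eq ?_)
    rw [enorm_mul, enorm_pow, enorm_norm, Real.enorm_eq_ofReal_abs]
  · have : Measurable fun t => schrodinger (f j) t x :=
      ((hc j).comp (by fun_prop : Continuous fun t : ℝ => (t, x))).measurable
    exact (this.enorm.pow_const 2).const_mul _
  · refine lowerSemicontinuous_tsum fun j => Continuous.lowerSemicontinuous ?_
    have : Continuous fun x => schrodinger (f j) t x := by
      have h1 := (hc j).comp (by fun_prop : Continuous fun x : Rn n => (t, x))
      simpa only [Function.comp_def] using h1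
    have h2 : Continuous fun x => ‖schrodinger (f j) t x‖ₑ ^ 2 :=
      (ENNReal.continuous_pow 2).comp this.enorm
    exact (ENNReal.continuous_const_mul ENNReal.ofReal_ne_top).comp h2
end
end

section
/- Let n ≥ 3, suppose (1/p, 1/q) lies on the closed segment [O, A], let s be given by 2s = n − (2/q + n/p), and let r > 1. Then there is no finite constant C such that ‖ Σ_j λ_j |e^{itΔ}f_j|² ‖_{L^{q,∞}(ℝ, L^{p,∞}(ℝⁿ))} ≤ C ‖{λ_j}‖_{ℓ^{q,r}} holds for all families {f_j} of functions orthonormal in Ḣ^s(ℝⁿ) and all sequences {λ_j} ∈ ℓ^{q,r}. -/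
noncomputable section

open MeasureTheory ENNReal Real Set

open OS
namespace OS

open scoped FourierTransform SchwartzMap

theorem FT_fourierInv {n : ℕ} (G : 𝓢(Rn n, ℂ)) (ξ : Rn n) :
    FT (⇑(𝓕⁻ G : 𝓢(Rn n, ℂ))) ξ = G ((2 * π)⁻¹ • ξ) := by
  have h : 𝓕 (⇑(𝓕⁻ G : 𝓢(Rn n, ℂ))) ((2 * π)⁻¹ • ξ) = G ((2 * π)⁻¹ • ξ) := by
    rw [← SchwartzMap.fourier_coe, FourierTransform.fourier_fourierInv_eq]
  rw [← h, Real.fourier_eq', FT]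
  congr 1 with x
  rw [smul_eq_mul]
  congr 2
  have : (inner ℝ x ((2 * π)⁻¹ • ξ) : ℝ) = (2 * π)⁻¹ * ∑ i, x i * ξ i := by
    rw [inner_smul_right, PiLp.inner_apply]
    simp [mul_comm]
  rw [this, dotC]
  have hpi : (π : ℂ) ≠ 0 := by exact_mod_cast Real.pi_ne_zero
  push_cast
  field_simp

theorem smul_integral_comp_inv_two_pi {n : ℕ} (F : Rn n → ℂ) :
    ((2 * π : ℝ) ^ (-(n : ℝ)) : ℝ) • ∫ ξ : Rn n, F ((2 * π)⁻¹ • ξ) = ∫ η : Rn n, F η := by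
  rw [Measure.integral_comp_inv_smul_of_nonneg _ _ (by positivity), smul_smul,
    finrank_euclideanSpace_fin, Real.rpow_neg (by positivity), Real.rpow_natCast,
    inv_mul_cancel₀ (by positivity), one_smul]

theorem norm_eq_two_pi_mul {n : ℕ} (ξ : Rn n) : ‖ξ‖ = 2 * π * ‖(2 * π)⁻¹ • ξ‖ := by
  rw [norm_smul, Real.norm_of_nonneg (by positivity), mul_inv_cancel_left₀ (by positivity)]

theorem schrodinger_fourierInv {n : ℕ} (G : 𝓢(Rn n, ℂ)) (t : ℝ) (x : Rn n) :
    schrodinger (⇑(𝓕⁻ G : 𝓢(Rn n, ℂ))) t x = ∫ η : Rn n,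
      Complex.exp (Complex.I *
        ((2 * π * (∑ i, x i * η i) - t * (2 * π * ‖η‖) ^ 2 : ℝ) : ℂ)) * G η := by
  rw [schrodinger, prop]
  refine Eq.trans ?_ (smul_integral_comp_inv_two_pi _)
  congr 2 with ξ
  rw [one_mul, FT_fourierInv, ← norm_eq_two_pi_mul, dotC]
  congr 3
  have : ∑ i, x i * ξ i = 2 * π * ∑ i, x i * ((2 * π)⁻¹ • ξ) i := by
    rw [Finset.mul_sum]
    refine Finset.sum_congr rfl fun i _ => ?_
    have := Real.pi_ne_zero
    simp only [PiLp.smul_apply, smul_eq_mul]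
    field_simp
  rw [this]
  push_cast
  ring

theorem orthonormalHs_fourierInv {n : ℕ} (s : ℝ) (G : ℕ → 𝓢(Rn n, ℂ))
    (h : ∀ j k, ∫ η : Rn n, (((2 * π * ‖η‖) ^ (2 * s) : ℝ) : ℂ) *
      (G j η * (starRingEnd ℂ) (G k η)) = if j = k then 1 else 0) :
    OrthonormalHs s fun j => ⇑(𝓕⁻ (G j) : 𝓢(Rn n, ℂ)) := by
  intro j k
  rw [← h]
  refine Eq.trans ?_ (smul_integral_comp_inv_two_pi _)
  congr 2 with ξ
  rw [FT_fourierInv, FT_fourierInv, ← norm_eq_two_pi_mul]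

/-- A smooth bump supported in `[-1, 1]` whose square has integer translates summing to one. -/
def cutoff (x : ℝ) : ℝ :=
  sin (π / 2 * smoothTransition (1 + x)) * cos (π / 2 * smoothTransition x)

theorem contDiff_cutoff : ContDiff ℝ ((⊤ : ℕ∞) : WithTop ℕ∞) cutoff := by
  unfold cutoff
  refine ContDiff.mul ?_ ?_
  · exact Real.contDiff_sin.comp (contDiff_const.mul
      (Real.smoothTransition.contDiff.comp (contDiff_const.add contDiff_id)))
  · exact Real.contDiff_cos.comp (contDiff_const.mul Real.smoothTransition.contDiff)

theorem cutoff_eq_zero {x : ℝ} (hx : 1 ≤ |x|) : cutoff x = 0 := by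
  rcases le_abs.1 hx with h | h
  · simp [cutoff, smoothTransition.one_of_one_le h]
  · simp [cutoff, smoothTransition.zero_of_nonpos (by linarith : 1 + x ≤ 0)]

theorem cutoff_nonneg (x : ℝ) : 0 ≤ cutoff x := by
  have h (y : ℝ) : 0 ≤ π / 2 * smoothTransition y ∧ π / 2 * smoothTransition y ≤ π / 2 :=
    ⟨mul_nonneg (by positivity) (smoothTransition.nonneg y),
      mul_le_of_le_one_right (by positivity) (smoothTransition.le_one y)⟩
  exact mul_nonneg (sin_nonneg_of_nonneg_of_le_pi (h _).1 ((h _).2.trans (by linarith [pi_pos])))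
    (cos_nonneg_of_neg_pi_div_two_le_of_le (by linarith [(h x).1, pi_pos]) (h _).2)

theorem cutoff_le_one (x : ℝ) : cutoff x ≤ 1 :=
  (abs_le.1 (by
    rw [cutoff, abs_mul]
    exact mul_le_one₀ (abs_sin_le_one _) (abs_nonneg _) (abs_cos_le_one _))).2

theorem cutoff_sq_add_cutoff_sub_one_sq {x : ℝ} (hx : x ∈ Icc (0 : ℝ) 1) :
    cutoff x ^ 2 + cutoff (x - 1) ^ 2 = 1 := by
  have h1 : smoothTransition (1 + x) = 1 := smoothTransition.one_of_one_le (by linarith [hx.1])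
  have h2 : smoothTransition (x - 1) = 0 := smoothTransition.zero_of_nonpos (by linarith [hx.2])
  simp [cutoff, h1, h2]

theorem integral_cutoff_sq_mul_exp (k : ℤ) :
    ∫ x : ℝ, (cutoff x ^ 2 : ℝ) * Complex.exp (2 * π * Complex.I * k * x)
      = if k = 0 then 1 else 0 := by
  set F : ℝ → ℂ := fun x => (cutoff x ^ 2 : ℝ) * Complex.exp (2 * π * Complex.I * k * x) with hF
  have hFc : Continuous F := by
    have := contDiff_cutoff.continuous
    fun_prop
  have hI (u v : ℝ) : IntervalIntegrable F volume u v := hFc.intervalIntegrable _ _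
  have hI' (u v : ℝ) : IntervalIntegrable (fun x => F (x - 1)) volume u v :=
    (hFc.comp (continuous_sub_right 1)).intervalIntegrable _ _
  have hsupp : Function.support F ⊆ Ioc (-1) 1 := by
    intro x hx
    by_contra hx'
    apply hx
    have : 1 ≤ |x| := by
      by_contra! hlt
      exact hx' ⟨(abs_lt.1 hlt).1, (abs_lt.1 hlt).2.le⟩
    simp [hF, cutoff_eq_zero this]
  have hshift : ∫ x in (-1 : ℝ)..0, F x = ∫ x in (0 : ℝ)..1, F (x - 1) := by
    rw [intervalIntegral.integral_comp_sub_right]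
    norm_num
  rw [← intervalIntegral.integral_eq_integral_of_support_subset hsupp,
    ← intervalIntegral.integral_add_adjacent_intervals (hI (-1) 0) (hI 0 1), hshift,
    ← intervalIntegral.integral_add (hI' 0 1) (hI 0 1)]
  have : ∀ x ∈ uIcc (0 : ℝ) 1, F (x - 1) + F x = Complex.exp (2 * π * Complex.I * k * x) := by
    intro x hx
    rw [uIcc_of_le zero_le_one] at hx
    have hper : Complex.exp (2 * π * Complex.I * k * ((x - 1 : ℝ) : ℂ))
        = Complex.exp (2 * π * Complex.I * k * x) := by
      rw [Complex.exp_eq_exp_iff_exists_int]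
      exact ⟨-k, by push_cast; ring⟩
    simp only [hF]
    rw [hper, ← add_mul, ← Complex.ofReal_add, add_comm, cutoff_sq_add_cutoff_sub_one_sq hx]
    simp
  rw [intervalIntegral.integral_congr this]
  split_ifs with hk
  · simp [hk]
  · have hne : 2 * π * Complex.I * k ≠ 0 := by
      simp [Real.pi_ne_zero, hk]
    rw [integral_exp_mul_complex hne]
    have : Complex.exp (2 * π * Complex.I * k * ((1 : ℝ) : ℂ)) = 1 := by
      rw [Complex.exp_eq_one_iff]
      exact ⟨k, by push_cast; ring⟩
    rw [this]
    simp

theorem integral_cutoff_sub_sq_mul_exp (k : ℤ) (c : ℝ) :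
    ∫ x : ℝ, (cutoff (x - c) ^ 2 : ℝ) * Complex.exp (2 * π * Complex.I * k * x)
      = if k = 0 then 1 else 0 := by
  have h := integral_add_right_eq_self (μ := volume) (fun x : ℝ =>
    ((cutoff (x - c) ^ 2 : ℝ) : ℂ) * Complex.exp (2 * π * Complex.I * k * x)) c
  rw [← h]
  have : ∀ x : ℝ, ((cutoff (x + c - c) ^ 2 : ℝ) : ℂ) *
      Complex.exp (2 * π * Complex.I * k * ((x + c : ℝ) : ℂ))
      = Complex.exp (2 * π * Complex.I * k * c) *
        ((cutoff x ^ 2 : ℝ) * Complex.exp (2 * π * Complex.I * k * x)) := by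
    intro x
    rw [add_sub_cancel_right, mul_left_comm, ← Complex.exp_add]
    congr 2
    push_cast
    ring
  simp_rw [this]
  rw [integral_const_mul, integral_cutoff_sq_mul_exp]
  split_ifs with hk <;> simp [hk]

theorem hasCompactSupport_cutoff : HasCompactSupport cutoff :=
  HasCompactSupport.of_support_subset_isCompact (isCompact_Icc (a := (-1 : ℝ)) (b := 1))
    fun x hx => by
    by_contra h
    refine hx (cutoff_eq_zero ?_)
    by_contra! hlt
    exact h ⟨(abs_lt.1 hlt).1.le, (abs_lt.1 hlt).2.le⟩

theorem integral_cutoff_sub_sq (c : ℝ) : ∫ x : ℝ, cutoff (x - c) ^ 2 = 1 := by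
  have h := integral_cutoff_sub_sq_mul_exp 0 c
  simp only [Int.cast_zero, mul_zero, zero_mul, Complex.exp_zero, mul_one, if_true] at h
  rw [integral_complex_ofReal] at h
  exact_mod_cast h

theorem one_le_integral_cutoff (c : ℝ) : 1 ≤ ∫ x : ℝ, cutoff (x - c) := by
  rw [integral_sub_right_eq_self cutoff c, ← integral_cutoff_sub_sq 0]
  simp only [sub_zero]
  have hc := contDiff_cutoff.continuous
  refine integral_mono ?_ (hc.integrable_of_hasCompactSupport hasCompactSupport_cutoff) fun x => ?_
  · simp_rw [sq]
    exact (hc.mul hc).integrable_of_hasCompactSupport hasCompactSupport_cutoff.mul_right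
  · exact pow_le_of_le_one (cutoff_nonneg x) (cutoff_le_one x) two_ne_zero

/-- The product bump `∏ᵢ χ(ηᵢ - Cᵢ)` centred at `C`. -/
def boxCutoff {n : ℕ} (C : Fin n → ℝ) (η : Rn n) : ℝ := ∏ i, cutoff (η i - C i)

theorem boxCutoff_nonneg {n : ℕ} (C : Fin n → ℝ) (η : Rn n) : 0 ≤ boxCutoff C η :=
  Finset.prod_nonneg fun _ _ => cutoff_nonneg _

theorem abs_sub_lt_one_of_boxCutoff_ne_zero {n : ℕ} {C : Fin n → ℝ} {η : Rn n}
    (h : boxCutoff C η ≠ 0) (i : Fin n) : |η i - C i| < 1 := by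
  by_contra! hi
  exact h (Finset.prod_eq_zero (Finset.mem_univ i) (cutoff_eq_zero hi))

theorem contDiff_boxCutoff {n : ℕ} (C : Fin n → ℝ) :
    ContDiff ℝ ((⊤ : ℕ∞) : WithTop ℕ∞) (boxCutoff C) := by
  unfold boxCutoff
  refine contDiff_prod fun i _ => contDiff_cutoff.comp ?_
  fun_prop

theorem hasCompactSupport_boxCutoff {n : ℕ} (C : Fin n → ℝ) :
    HasCompactSupport (boxCutoff C) := by
  refine HasCompactSupport.of_support_subset_isCompact
    (isCompact_closedBall (0 : Rn n) (Real.sqrt (∑ i, (|C i| + 1) ^ 2))) fun η hη => ?_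
  rw [mem_closedBall_zero_iff, EuclideanSpace.norm_eq]
  refine Real.sqrt_le_sqrt (Finset.sum_le_sum fun i _ => ?_)
  have h := abs_sub_lt_one_of_boxCutoff_ne_zero hη i
  have h2 := abs_sub_abs_le_abs_sub (η i) (C i)
  rw [Real.norm_eq_abs]
  gcongr
  linarith

theorem integral_prod_coord {n : ℕ} {𝕜 : Type*} [RCLike 𝕜] (f : Fin n → ℝ → 𝕜) :
    ∫ η : Rn n, ∏ i, f i (η i) = ∏ i, ∫ y, f i y := by
  rw [← integral_fintype_prod_volume_eq_prod,
    ← (PiLp.volume_preserving_toLp (Fin n)).integral_comp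
      (MeasurableEquiv.toLp 2 (Fin n → ℝ)).measurableEmbedding]

theorem one_le_integral_boxCutoff {n : ℕ} (C : Fin n → ℝ) : 1 ≤ ∫ η : Rn n, boxCutoff C η := by
  have := integral_prod_coord (n := n) (𝕜 := ℝ) fun i y => cutoff (y - C i)
  simp only [boxCutoff]
  rw [this]
  refine Finset.prod_induction _ (fun y => 1 ≤ y)
    (fun _ _ h h' => one_le_mul_of_one_le_of_one_le h h') le_rfl fun i _ => one_le_integral_cutoff _

theorem integral_boxCutoff_sq_mul_exp {n : ℕ} (C v : Fin n → ℝ) (i₀ : Fin n) (hv : v i₀ = 1)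
    (k : ℤ) :
    ∫ η : Rn n, ((boxCutoff C η ^ 2 : ℝ) : ℂ) *
      Complex.exp (Complex.I * ((2 * π * (k * ∑ i, v i * η i) : ℝ) : ℂ))
      = if k = 0 then 1 else 0 := by
  have h := integral_prod_coord (n := n) (𝕜 := ℂ) fun i y =>
    ((cutoff (y - C i) ^ 2 : ℝ) : ℂ) * Complex.exp (Complex.I * ((2 * π * (k * (v i * y)) : ℝ) : ℂ))
  have hprod (η : Rn n) : ((boxCutoff C η ^ 2 : ℝ) : ℂ) *
      Complex.exp (Complex.I * ((2 * π * (k * ∑ i, v i * η i) : ℝ) : ℂ))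
      = ∏ i, (((cutoff (η i - C i) ^ 2 : ℝ) : ℂ) *
        Complex.exp (Complex.I * ((2 * π * (k * (v i * η i)) : ℝ) : ℂ))) := by
    rw [Finset.prod_mul_distrib, ← Complex.exp_sum, boxCutoff, ← Finset.prod_pow]
    push_cast
    rw [← Finset.mul_sum, ← Finset.mul_sum, ← Finset.mul_sum]
  simp_rw [hprod]
  rw [h]
  split_ifs with hk
  · refine Finset.prod_eq_one fun i _ => ?_
    simp only [hk, Int.cast_zero, zero_mul, mul_zero, Complex.ofReal_zero, Complex.exp_zero,
      mul_one]
    rw [integral_complex_ofReal, integral_cutoff_sub_sq, Complex.ofReal_one]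
  · refine Finset.prod_eq_zero (Finset.mem_univ i₀) ?_
    have := integral_cutoff_sub_sq_mul_exp k (C i₀)
    rw [if_neg hk] at this
    rw [← this]
    congr 1 with y
    rw [hv]
    congr 2
    push_cast
    ring

/-- The frequency profile `(2π|η|)^{-s} ∏ᵢ χ(ηᵢ - Cᵢ) e^{2πi o v·η}` of a wave packet. -/
def packet {n : ℕ} (s : ℝ) (C v : Fin n → ℝ) (o : ℝ) (η : Rn n) : ℂ :=
  (((2 * π * ‖η‖) ^ (-s) * boxCutoff C η : ℝ) : ℂ) *
    Complex.exp (Complex.I * ((2 * π * (o * ∑ i, v i * η i) : ℝ) : ℂ))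

theorem norm_pos_of_boxCutoff_ne_zero {n : ℕ} {C : Fin n → ℝ} (i₀ : Fin n) (hC : 1 ≤ C i₀)
    {η : Rn n} (h : boxCutoff C η ≠ 0) : 0 < ‖η‖ := by
  rw [norm_pos_iff]
  rintro rfl
  have := abs_sub_lt_one_of_boxCutoff_ne_zero h i₀
  rw [PiLp.zero_apply, zero_sub, abs_neg, abs_of_nonneg (by linarith)] at this
  linarith

theorem contDiff_weighted_boxCutoff {n : ℕ} (s : ℝ) {C : Fin n → ℝ} (i₀ : Fin n) (hC : 2 ≤ C i₀) :
    ContDiff ℝ ((⊤ : ℕ∞) : WithTop ℕ∞)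
      fun η : Rn n => (2 * π * ‖η‖) ^ (-s) * boxCutoff C η := by
  rw [contDiff_iff_contDiffAt]
  intro η
  by_cases hη : η = 0
  · subst hη
    refine (contDiffAt_const (c := (0 : ℝ))).congr_of_eventuallyEq ?_
    filter_upwards [Metric.ball_mem_nhds (0 : Rn n) one_pos] with y hy
    rw [mem_ball_zero_iff] at hy
    have : boxCutoff C y = 0 := by
      by_contra h
      have h1 := abs_lt.1 (abs_sub_lt_one_of_boxCutoff_ne_zero h i₀)
      have h2 := (abs_le.1 (PiLp.norm_apply_le y i₀)).2
      linarith [h1.1]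
    rw [this, mul_zero]
  · refine ContDiffAt.mul ?_ (contDiff_boxCutoff C).contDiffAt
    refine ContDiffAt.rpow_const_of_ne ?_ ?_
    · exact contDiffAt_const.mul (contDiffAt_norm ℝ hη)
    · have := norm_pos_iff.2 hη
      positivity

theorem contDiff_packet {n : ℕ} (s : ℝ) {C : Fin n → ℝ} (v : Fin n → ℝ) (o : ℝ) (i₀ : Fin n)
    (hC : 2 ≤ C i₀) : ContDiff ℝ ((⊤ : ℕ∞) : WithTop ℕ∞) (packet s C v o) := by
  unfold packet
  refine ContDiff.mul (Complex.ofRealCLM.contDiff.comp (contDiff_weighted_boxCutoff s i₀ hC)) ?_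
  refine ContDiff.cexp (contDiff_const.mul (Complex.ofRealCLM.contDiff.comp ?_))
  refine contDiff_const.mul (contDiff_const.mul ?_)
  fun_prop

theorem hasCompactSupport_packet {n : ℕ} (s : ℝ) (C v : Fin n → ℝ) (o : ℝ) :
    HasCompactSupport (packet s C v o) := by
  refine (hasCompactSupport_boxCutoff C).mono fun η hη h => hη ?_
  simp [packet, h]

/-- The wave packet profile as a Schwartz function. -/
def packetSchwartz {n : ℕ} (s : ℝ) {C : Fin n → ℝ} (v : Fin n → ℝ) (o : ℝ) (i₀ : Fin n)
    (hC : 2 ≤ C i₀) : 𝓢(Rn n, ℂ) :=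
  (hasCompactSupport_packet s C v o).toSchwartzMap (contDiff_packet s v o i₀ hC)

theorem packetSchwartz_apply {n : ℕ} (s : ℝ) {C : Fin n → ℝ} (v : Fin n → ℝ) (o : ℝ) (i₀ : Fin n)
    (hC : 2 ≤ C i₀) (η : Rn n) : packetSchwartz s v o i₀ hC η = packet s C v o η := rfl

theorem integral_packet_mul_conj {n : ℕ} (s : ℝ) {C v : Fin n → ℝ} {i₀ : Fin n} (hC : 2 ≤ C i₀)
    (hv : v i₀ = 1) {o o' : ℝ} {k : ℤ} (hk : o - o' = k) :
    ∫ η : Rn n, (((2 * π * ‖η‖) ^ (2 * s) : ℝ) : ℂ) *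
      (packet s C v o η * (starRingEnd ℂ) (packet s C v o' η)) = if k = 0 then 1 else 0 := by
  rw [← integral_boxCutoff_sq_mul_exp C v i₀ hv k]
  congr 1 with η
  by_cases h : boxCutoff C η = 0
  · simp [packet, h]
  have hη := norm_pos_of_boxCutoff_ne_zero i₀ (by linarith) h
  have hpow : (2 * π * ‖η‖) ^ (2 * s) * ((2 * π * ‖η‖) ^ (-s) * (2 * π * ‖η‖) ^ (-s)) = 1 := by
    rw [← Real.rpow_add (by positivity), ← Real.rpow_add (by positivity)]
    ring_nf
    exact Real.rpow_zero _
  have hexp : Complex.exp (Complex.I * ((2 * π * (k * ∑ i, v i * η i) : ℝ) : ℂ))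
      = Complex.exp (Complex.I * ((2 * π * (o * ∑ i, v i * η i) : ℝ) : ℂ)) *
        (starRingEnd ℂ) (Complex.exp (Complex.I * ((2 * π * (o' * ∑ i, v i * η i) : ℝ) : ℂ))) := by
    rw [← Complex.exp_conj, ← Complex.exp_add, map_mul, Complex.conj_I, Complex.conj_ofReal, ← hk]
    congr 1
    push_cast
    ring
  rw [hexp, packet, packet, map_mul, Complex.conj_ofReal]
  rw [show ((boxCutoff C η ^ 2 : ℝ) : ℂ) = (((2 * π * ‖η‖) ^ (2 * s) *
    ((2 * π * ‖η‖) ^ (-s) * (2 * π * ‖η‖) ^ (-s)) * boxCutoff C η ^ 2 : ℝ) : ℂ) by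
      rw [hpow, one_mul]]
  push_cast
  ring

theorem packet_mul_conj_eq_zero {n : ℕ} (s : ℝ) {C C' : Fin n → ℝ} (v v' : Fin n → ℝ) (o o' : ℝ)
    {i : Fin n} (hi : 2 ≤ |C i - C' i|) (η : Rn n) :
    packet s C v o η * (starRingEnd ℂ) (packet s C' v' o' η) = 0 := by
  by_cases h : boxCutoff C η = 0
  · simp [packet, h]
  by_cases h' : boxCutoff C' η = 0
  · simp [packet, h']
  have h1 := abs_lt.1 (abs_sub_lt_one_of_boxCutoff_ne_zero h i)
  have h2 := abs_lt.1 (abs_sub_lt_one_of_boxCutoff_ne_zero h' i)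
  rcases le_abs.1 hi with h3 | h3 <;> linarith [h1.1, h1.2, h2.1, h2.2]

theorem half_integral_le_norm_integral_exp_mul {α : Type*} [MeasurableSpace α] {μ : Measure α}
    {g θ : α → ℝ} (hg : Integrable g μ) (hg0 : ∀ x, 0 ≤ g x) (hθ : Measurable θ) (θ₀ : ℝ)
    (h : ∀ x, g x ≠ 0 → |θ x - θ₀| ≤ 1) :
    (∫ x, g x ∂μ) / 2 ≤ ‖∫ x, Complex.exp (Complex.I * (θ x : ℂ)) * (g x : ℂ) ∂μ‖ := by
  have hrot : ‖∫ x, Complex.exp (Complex.I * (θ x : ℂ)) * (g x : ℂ) ∂μ‖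
      = ‖∫ x, Complex.exp (((θ x - θ₀ : ℝ) : ℂ) * Complex.I) * (g x : ℂ) ∂μ‖ := by
    have hn : ‖Complex.exp (((-θ₀ : ℝ) : ℂ) * Complex.I)‖ = 1 := Complex.norm_exp_ofReal_mul_I _
    rw [← one_mul ‖∫ x, Complex.exp (Complex.I * (θ x : ℂ)) * (g x : ℂ) ∂μ‖, ← hn, ← norm_mul,
      ← integral_const_mul]
    congr 2 with x
    rw [← mul_assoc, ← Complex.exp_add]
    congr 2
    push_cast
    ring
  have hint : Integrable
      (fun x => Complex.exp (((θ x - θ₀ : ℝ) : ℂ) * Complex.I) * (g x : ℂ)) μ := by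
    refine Integrable.bdd_mul (c := 1) hg.ofReal ?_ ?_
    · exact Measurable.aestronglyMeasurable (by fun_prop)
    · exact Filter.Eventually.of_forall fun x => (Complex.norm_exp_ofReal_mul_I _).le
  rw [hrot, ← integral_div]
  refine le_trans ?_ (Complex.re_le_norm _)
  have hre := integral_re hint
  simp only [RCLike.re_to_complex] at hre
  rw [← hre]
  refine integral_mono (hg.div_const 2) hint.re fun x => ?_
  have hval : (Complex.exp (((θ x - θ₀ : ℝ) : ℂ) * Complex.I) * (g x : ℂ)).re
      = cos (θ x - θ₀) * g x := by
    rw [Complex.re_mul_ofReal, Complex.exp_ofReal_mul_I_re]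
  simp only [hval]
  by_cases hx : g x = 0
  · simp [hx]
  have hc := Real.one_sub_sq_div_two_le_cos (x := θ x - θ₀)
  have hsq : (θ x - θ₀) ^ 2 ≤ 1 := (sq_le_one_iff_abs_le_one _).2 (h x hx)
  nlinarith [hg0 x]

theorem le_norm_schrodinger_packet {n : ℕ} {s : ℝ} (hs : 0 ≤ s) {C v : Fin n → ℝ} {o : ℝ}
    {i₀ : Fin n} (hC : 2 ≤ C i₀) (hCv : ∀ i, C i = C i₀ * v i) (hv : ∀ i, |v i| ≤ 2)
    {B : ℝ} (hB : ∀ η : Rn n, boxCutoff C η ≠ 0 → ‖η‖ ≤ B) {t : ℝ} {x : Rn n} (ht : 0 ≤ t)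
    (ht' : 2 * π * t * n ≤ 1 / 21) (hx : n * ‖x‖ ≤ 1 / 21)
    (ho : 2 * n * |o - 4 * π * t * C i₀| ≤ 1 / 21) :
    (2 * π * B) ^ (-s) / 2 ≤
      ‖schrodinger (⇑(𝓕⁻ (packetSchwartz s v o i₀ hC) : 𝓢(Rn n, ℂ))) t x‖ := by
  set g : Rn n → ℝ := fun η => (2 * π * ‖η‖) ^ (-s) * boxCutoff C η with hg
  set θ : Rn n → ℝ := fun η => 2 * π * (∑ i, x i * η i) - t * (2 * π * ‖η‖) ^ 2 +
    2 * π * (o * ∑ i, v i * η i) with hθ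
  have hgi : Integrable g :=
    (contDiff_weighted_boxCutoff s i₀ hC).continuous.integrable_of_hasCompactSupport
      (hasCompactSupport_boxCutoff C).mul_left
  have hg0 (η) : 0 ≤ g η := mul_nonneg (by positivity) (boxCutoff_nonneg C η)
  have hS : schrodinger (⇑(𝓕⁻ (packetSchwartz s v o i₀ hC) : 𝓢(Rn n, ℂ))) t x
      = ∫ η, Complex.exp (Complex.I * (θ η : ℂ)) * (g η : ℂ) := by
    rw [schrodinger_fourierInv]
    congr 1 with η
    simp only [packetSchwartz_apply, packet, hθ, hg]
    rw [mul_left_comm, ← Complex.exp_add, mul_comm]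
    congr 2
    push_cast
    ring
  rw [hS]
  refine le_trans ?_ (half_integral_le_norm_integral_exp_mul hgi hg0 ?_
    (2 * π * (∑ i, x i * C i) - t * (4 * π ^ 2 * ∑ i, C i ^ 2) + 2 * π * (o * ∑ i, v i * C i)) ?_)
  · gcongr
    have h1 : (2 * π * B) ^ (-s) * 1 ≤ (2 * π * B) ^ (-s) * ∫ η : Rn n, boxCutoff C η := by
      by_cases hB0 : 0 ≤ B
      · have := one_le_integral_boxCutoff C
        gcongr
      · exfalso
        have hz : ∀ η : Rn n, boxCutoff C η = 0 := fun η => by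
          by_contra h
          exact hB0 ((norm_nonneg η).trans (hB η h))
        have := one_le_integral_boxCutoff C
        simp only [hz, integral_zero] at this
        linarith
    rw [mul_one, ← integral_const_mul] at h1
    refine h1.trans (integral_mono ?_ hgi fun η => ?_)
    · exact ((contDiff_boxCutoff C).continuous.integrable_of_hasCompactSupport
        (hasCompactSupport_boxCutoff C)).const_mul _
    · by_cases h : boxCutoff C η = 0
      · simp [hg, h]
      · simp only [hg]
        have h0 := norm_pos_of_boxCutoff_ne_zero i₀ (by linarith) h
        refine mul_le_mul_of_nonneg_right ?_ (boxCutoff_nonneg C η)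
        refine Real.rpow_le_rpow_of_nonpos (by positivity) ?_ (by linarith)
        have := hB η h
        gcongr
  · refine Continuous.measurable ?_
    fun_prop
  · intro η hη
    have hb : boxCutoff C η ≠ 0 := right_ne_zero_of_mul hη
    have hζ (i : Fin n) : |η i - C i| ≤ 1 := (abs_sub_lt_one_of_boxCutoff_ne_zero hb i).le
    have hid : θ η - (2 * π * (∑ i, x i * C i) - t * (4 * π ^ 2 * ∑ i, C i ^ 2) +
        2 * π * (o * ∑ i, v i * C i))
        = 2 * π * ((∑ i, x i * (η i - C i)) - 2 * π * t * (∑ i, (η i - C i) ^ 2)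
          + (o - 4 * π * t * C i₀) * ∑ i, v i * (η i - C i)) := by
      have e1 : ‖η‖ ^ 2 = ∑ i, η i ^ 2 := EuclideanSpace.real_norm_sq_eq η
      have e2 : C i₀ * ∑ i, v i * (η i - C i) = ∑ i, C i * (η i - C i) := by
        rw [Finset.mul_sum]
        exact Finset.sum_congr rfl fun i _ => by rw [← mul_assoc, ← hCv]
      have e3 : ∑ i, (η i - C i) ^ 2
          = ∑ i, η i ^ 2 - ∑ i, C i ^ 2 - 2 * ∑ i, C i * (η i - C i) := by
        rw [Finset.mul_sum, ← Finset.sum_sub_distrib, ← Finset.sum_sub_distrib]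
        exact Finset.sum_congr rfl fun i _ => by ring
      have e4 (w : Fin n → ℝ) : ∑ i, w i * (η i - C i) = ∑ i, w i * η i - ∑ i, w i * C i := by
        rw [← Finset.sum_sub_distrib]
        exact Finset.sum_congr rfl fun i _ => by ring
      have e5 := e4 v
      have e6 := e4 fun i => x i
      simp only [hθ]
      rw [mul_pow (2 * π), e1, e6, e3, ← e2, e5]
      ring
    have b1 : |∑ i, x i * (η i - C i)| ≤ 1 / 21 := by
      refine le_trans (Finset.abs_sum_le_sum_abs _ _) (le_trans ?_ hx)
      refine (Finset.sum_le_card_nsmul _ _ ‖x‖ fun i _ => ?_).trans (by simp)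
      rw [abs_mul]
      exact (mul_le_of_le_one_right (abs_nonneg _) (hζ i)).trans (PiLp.norm_apply_le x i)
    have b2 : |2 * π * t * (∑ i, (η i - C i) ^ 2)| ≤ 1 / 21 := by
      rw [abs_of_nonneg (by positivity)]
      refine le_trans (mul_le_mul_of_nonneg_left ?_ (by positivity)) ht'
      refine (Finset.sum_le_card_nsmul _ _ 1 fun i _ => ?_).trans (by simp)
      exact (sq_le_one_iff_abs_le_one _).2 (hζ i)
    have b3 : |(o - 4 * π * t * C i₀) * ∑ i, v i * (η i - C i)| ≤ 1 / 21 := by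
      rw [abs_mul]
      refine le_trans (mul_le_mul_of_nonneg_left (b := |∑ i, v i * (η i - C i)|) (c := 2 * n) ?_
        (abs_nonneg _)) (by linarith)
      refine (Finset.abs_sum_le_sum_abs _ _).trans ?_
      refine (Finset.sum_le_card_nsmul _ _ 2 fun i _ => ?_).trans (by simp [mul_comm])
      rw [abs_mul]
      nlinarith [hv i, hζ i, abs_nonneg (v i), abs_nonneg (η i - C i)]
    rw [hid, abs_mul, abs_of_pos (by positivity)]
    have b4 : |(∑ i, x i * (η i - C i)) - 2 * π * t * (∑ i, (η i - C i) ^ 2)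
          + (o - 4 * π * t * C i₀) * ∑ i, v i * (η i - C i)| ≤ 1 / 7 := by
      rw [abs_le] at *
      constructor <;> linarith [b1.1, b1.2, b2.1, b2.2, b3.1, b3.2]
    have := Real.pi_lt_d2
    have := Real.pi_pos
    nlinarith

theorem exists_mul_le_lor {α : Type*} [MeasurableSpace α] (μ : Measure α) {S : Set α}
    (h0 : μ S ≠ 0) (htop : μ S ≠ ∞) (p : ℝ≥0∞) :
    ∃ c : ℝ, 0 < c ∧ ∀ (G : α → ℝ≥0∞) (m : ℝ), 0 < m → (∀ x ∈ S, ENNReal.ofReal m ≤ G x) →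
      ENNReal.ofReal (c * m) ≤ lor μ p ∞ G := by
  by_cases hp : p = ∞
  · refine ⟨1, one_pos, fun G m _ hG => ?_⟩
    rw [lor, if_pos hp, one_mul]
    by_contra! hlt
    have hae := ae_lt_of_essSup_lt hlt
    refine h0 (measure_mono_null (fun x hx => ?_) (ae_iff.1 hae))
    exact not_lt.2 (hG x hx)
  · have hfin : μ S ^ (1 / p.toReal) ≠ ∞ := ENNReal.rpow_ne_top_of_nonneg (by positivity) htop
    have hpos : 0 < μ S ^ (1 / p.toReal) :=
      ENNReal.rpow_pos (pos_iff_ne_zero.2 h0) htop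
    refine ⟨(μ S ^ (1 / p.toReal)).toReal / 2,
      half_pos (ENNReal.toReal_pos hpos.ne' hfin), fun G m hm hG => ?_⟩
    rw [lor, if_neg hp, if_pos rfl]
    refine le_trans ?_ (le_iSup₂ (f := fun (s : ℝ) (_ : 0 < s) => ENNReal.ofReal s *
      μ {x | ENNReal.ofReal s < G x} ^ (1 / p.toReal)) (m / 2) (half_pos hm))
    rw [div_mul_eq_mul_div, mul_div_assoc, mul_comm, ENNReal.ofReal_mul (by positivity),
      ENNReal.ofReal_toReal hfin]
    refine mul_le_mul_right (ENNReal.rpow_le_rpow (measure_mono fun x hx => ?_) (by positivity)) _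
    exact ((ENNReal.ofReal_lt_ofReal_iff hm).2 (half_lt_self hm)).trans_le (hG x hx)

theorem seqRearr_le {lam : ℕ → ℝ} {j : ℕ} {σ : ℝ} (F : Finset ℕ)
    (hF : ∀ i, σ < |lam i| → i ∈ F) (hcard : F.card ≤ j) : seqRearr lam j ≤ ENNReal.ofReal σ := by
  refine sInf_le ?_
  refine (measure_mono (t := (F : Set ℕ)) fun i hi => ?_).trans ?_
  · exact hF i (lt_of_not_ge fun h => not_lt.2 (ENNReal.ofReal_le_ofReal h) hi)
  · rw [Measure.count_apply_finset]
    exact_mod_cast hcard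

theorem seqLor_le {b r : ℝ} (hr : 0 < r) {lam : ℕ → ℝ} {A : ℝ} (hA : 0 ≤ A) {N : ℕ}
    (h : ∀ j < N, ((j : ℝ≥0∞) + 1) ^ b * seqRearr lam j ≤ ENNReal.ofReal A)
    (h0 : ∀ j, N ≤ j → seqRearr lam j = 0) :
    seqLor b r lam ≤ ENNReal.ofReal (A * (1 + Real.log N) ^ (1 / r)) := by
  have hlog : 0 ≤ 1 + Real.log (N : ℝ) := by linarith [Real.log_natCast_nonneg N]
  have hsum : ∑' j : ℕ, (((j : ℝ≥0∞) + 1) ^ b * seqRearr lam j) ^ r * ((j : ℝ≥0∞) + 1)⁻¹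
      ≤ ENNReal.ofReal (A ^ r * (1 + Real.log N)) := by
    rw [tsum_eq_sum (s := Finset.range N) fun j hj => by
      rw [h0 j (by simpa using hj), mul_zero, ENNReal.zero_rpow_of_pos hr, zero_mul]]
    have hterm : ∀ j ∈ Finset.range N,
        (((j : ℝ≥0∞) + 1) ^ b * seqRearr lam j) ^ r * ((j : ℝ≥0∞) + 1)⁻¹
          ≤ ENNReal.ofReal (A ^ r * ((j : ℝ) + 1)⁻¹) := fun j hj => by
      rw [ENNReal.ofReal_mul (by positivity), ← ENNReal.ofReal_rpow_of_nonneg hA hr.le,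
        ENNReal.ofReal_inv_of_pos (by positivity), ENNReal.ofReal_add (by positivity) zero_le_one,
        ENNReal.ofReal_natCast, ENNReal.ofReal_one]
      gcongr
      exact h j (by simpa using hj)
    refine (Finset.sum_le_sum hterm).trans ?_
    rw [← ENNReal.ofReal_sum_of_nonneg fun j _ => by positivity, ← Finset.mul_sum]
    refine ENNReal.ofReal_le_ofReal (mul_le_mul_of_nonneg_left ?_ (by positivity))
    have := harmonic_le_one_add_log N
    rw [harmonic] at this
    push_cast at this
    exact this
  rw [seqLor]
  refine (ENNReal.rpow_le_rpow hsum (by positivity)).trans ?_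
  rw [ENNReal.ofReal_rpow_of_nonneg (by positivity) (by positivity),
    Real.mul_rpow (by positivity) hlog, ← Real.rpow_mul hA, mul_one_div_cancel hr.ne',
    Real.rpow_one]

theorem card_biUnion_range_le {B : ℕ → Finset ℕ} {M D : ℕ} (hD : 2 ≤ D)
    (hcard : ∀ k, (B k).card ≤ M * D ^ k) (k : ℕ) :
    ((Finset.range k).biUnion B).card ≤ M * D ^ k := by
  refine Finset.card_biUnion_le.trans ((Finset.sum_le_sum fun i _ => hcard i).trans ?_)
  rw [← Finset.mul_sum]
  refine Nat.mul_le_mul_left _ ?_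
  exact (Nat.geomSum_lt hD fun i hi => Finset.mem_range.1 hi).le

theorem seqLor_blocks_le {b r : ℝ} (hb : 0 ≤ b) (hr : 0 < r) {B : ℕ → Finset ℕ} {M D K : ℕ}
    (hM : 1 ≤ M) (hD : 2 ≤ D) (hcard : ∀ k, (B k).card ≤ M * D ^ k) {lam : ℕ → ℝ}
    (hlam : ∀ i, lam i = 0 ∨ ∃ k < K, i ∈ B k ∧ lam i = (D : ℝ) ^ (-(k * b))) :
    seqLor b r lam ≤ ENNReal.ofReal
      (((M : ℝ) * D) ^ b * (1 + Real.log ((M * D ^ K : ℕ) : ℝ)) ^ (1 / r)) := by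
  have hD1 : (1 : ℝ) < D := by exact_mod_cast hD
  have hM1 : (1 : ℝ) ≤ M := by exact_mod_cast hM
  have hprod {j : ℕ} {σ : ℝ} (hσ : 0 ≤ σ) (hle : ((j : ℝ) + 1) ^ b * σ ≤ ((M : ℝ) * D) ^ b)
      (hre : seqRearr lam j ≤ ENNReal.ofReal σ) :
      ((j : ℝ≥0∞) + 1) ^ b * seqRearr lam j ≤ ENNReal.ofReal (((M : ℝ) * D) ^ b) := by
    refine le_trans ?_ (ENNReal.ofReal_le_ofReal hle)
    rw [ENNReal.ofReal_mul (by positivity), ← ENNReal.ofReal_rpow_of_nonneg (by positivity) hb,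
      ENNReal.ofReal_add (by positivity) zero_le_one, ENNReal.ofReal_natCast, ENNReal.ofReal_one]
    gcongr
  refine seqLor_le hr (by positivity) (fun j hj => ?_) fun j hj => ?_
  · by_cases hjM : j < M
    · refine hprod zero_le_one ?_ (seqRearr_le ∅ (fun i hi => ?_) (by simp))
      · rw [mul_one]
        refine Real.rpow_le_rpow (by positivity) ?_ hb
        have : (j : ℝ) + 1 ≤ M := by exact_mod_cast hjM
        nlinarith
      · exfalso
        rcases hlam i with h | ⟨k, -, -, h⟩
        · rw [h, abs_zero] at hi
          linarith
        · rw [h, abs_of_nonneg (by positivity)] at hi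
          exact not_lt.2 (Real.rpow_le_one_of_one_le_of_nonpos hD1.le
            (neg_nonpos.2 (by positivity))) hi
    · push Not at hjM
      set k := Nat.log D (j / M) with hk
      have hdiv : j / M ≠ 0 := (Nat.div_pos hjM hM).ne'
      have h1 : M * D ^ k ≤ j :=
        (Nat.mul_le_mul_left M (Nat.pow_log_le_self D hdiv)).trans (Nat.mul_div_le j M)
      have h2 : j < M * D ^ (k + 1) := by
        have := Nat.lt_pow_succ_log_self hD (j / M)
        rwa [Nat.div_lt_iff_lt_mul hM, mul_comm] at this
      refine hprod (σ := (D : ℝ) ^ (-(k * b))) (by positivity) ?_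
        (seqRearr_le ((Finset.range k).biUnion B) (fun i hi => ?_)
          ((card_biUnion_range_le hD hcard k).trans h1))
      · have h3 : (j : ℝ) + 1 ≤ M * D * D ^ k := by
          have : j + 1 ≤ M * D * D ^ k := by rw [mul_assoc, ← pow_succ']; exact h2
          exact_mod_cast this
        calc ((j : ℝ) + 1) ^ b * (D : ℝ) ^ (-(k * b))
            ≤ ((M : ℝ) * D * D ^ k) ^ b * (D : ℝ) ^ (-(k * b)) := by gcongr
          _ = ((M : ℝ) * D) ^ b := by
            rw [Real.mul_rpow (by positivity) (by positivity), mul_assoc, ← Real.rpow_natCast,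
              ← Real.rpow_mul (by positivity), ← Real.rpow_add (by positivity), add_neg_cancel,
              Real.rpow_zero, mul_one]
      · rcases hlam i with h | ⟨k', -, hmem, h⟩
        · rw [h, abs_zero] at hi
          exact absurd hi (not_lt.2 (by positivity))
        · rw [h, abs_of_nonneg (by positivity), Real.rpow_lt_rpow_left_iff hD1] at hi
          refine Finset.mem_biUnion.2 ⟨k', Finset.mem_range.2 ?_, hmem⟩
          by_contra! hle
          have : (k : ℝ) * b ≤ k' * b := by gcongr
          linarith
  · refine le_antisymm ((seqRearr_le ((Finset.range K).biUnion B) (σ := 0) (fun i hi => ?_)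
      ((card_biUnion_range_le hD hcard K).trans hj)).trans (by simp)) (zero_le)
    rcases hlam i with h | ⟨k', hk', hmem, -⟩
    · rw [h, abs_zero] at hi
      exact absurd hi (lt_irrefl _)
    · exact Finset.mem_biUnion.2 ⟨k', Finset.mem_range.2 hk', hmem⟩

theorem tsum_sum_ite_mul (B : ℕ → Finset ℕ) (K : ℕ) (w y : ℕ → ℝ) :
    ∑' j, (∑ k ∈ Finset.range K, if j ∈ B k then w k else 0) * y j
      = ∑ k ∈ Finset.range K, w k * ∑ j ∈ B k, y j := by
  rw [tsum_eq_sum (s := (Finset.range K).biUnion B) fun j hj => by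
    rw [Finset.sum_eq_zero fun k hk => if_neg fun h => hj (Finset.mem_biUnion.2 ⟨k, hk, h⟩),
      zero_mul]]
  simp_rw [Finset.sum_mul]
  rw [Finset.sum_comm]
  refine Finset.sum_congr rfl fun k hk => ?_
  simp_rw [ite_mul, zero_mul]
  rw [Finset.sum_ite_mem, Finset.inter_eq_right.2 (Finset.subset_biUnion_of_mem B hk),
    Finset.mul_sum]

theorem not_forall_mul_le_mul_rpow {c E r : ℝ} (hc : 0 < c) (hr : 1 < r)
    (h : ∀ K : ℕ, 1 ≤ K → c * K ≤ E * (K : ℝ) ^ (1 / r)) : False := by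
  have hexp : 0 < 1 - 1 / r := by
    rw [sub_pos, div_lt_one (by linarith)]
    exact hr
  have htend := (tendsto_rpow_atTop hexp).comp tendsto_natCast_atTop_atTop
  obtain ⟨K, hK, hK1⟩ := ((htend.eventually_gt_atTop (E / c)).and
    (Filter.eventually_ge_atTop 1)).exists
  have hKpos : (0 : ℝ) < K := by exact_mod_cast hK1
  have h1 := h K hK1
  have h2 : (K : ℝ) = (K : ℝ) ^ (1 - 1 / r) * (K : ℝ) ^ (1 / r) := by
    rw [← Real.rpow_add hKpos, sub_add_cancel, Real.rpow_one]
  have h3 : 0 < (K : ℝ) ^ (1 / r) := by positivity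
  simp only [Function.comp] at hK
  rw [div_lt_iff₀ hc] at hK
  rw [mul_comm, ← div_le_iff₀ h3, mul_div_right_comm] at h1
  have h4 : (K : ℝ) / (K : ℝ) ^ (1 / r) = (K : ℝ) ^ (1 - 1 / r) := by
    rw [div_eq_iff h3.ne', ← h2]
  rw [h4] at h1
  linarith

/-- The frequency lattice point `3(c + 1)`. -/
def latticeCenter {n : ℕ} (c : Fin n → ℕ) (i : Fin n) : ℝ := 3 * ((c i : ℝ) + 1)

theorem two_le_latticeCenter {n : ℕ} (c : Fin n → ℕ) (i : Fin n) : 2 ≤ latticeCenter c i := by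
  have : (0 : ℝ) ≤ c i := Nat.cast_nonneg _
  rw [latticeCenter]
  linarith

theorem two_le_abs_latticeCenter_sub {n : ℕ} {c c' : Fin n → ℕ} {i : Fin n} (h : c i ≠ c' i) :
    2 ≤ |latticeCenter c i - latticeCenter c' i| := by
  have h1 : (1 : ℝ) ≤ |(c i : ℝ) - c' i| := by
    have : (1 : ℤ) ≤ |(c i : ℤ) - c' i| := Int.one_le_abs (sub_ne_zero.2 (by exact_mod_cast h))
    exact_mod_cast this
  rw [latticeCenter, latticeCenter, ← mul_sub, add_sub_add_right_eq_sub, abs_mul,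
    abs_of_pos (by norm_num : (0 : ℝ) < 3)]
  linarith

/-- The wave packet indexed by a frequency `c` and a time slot `l`. The slot is shifted by the
residue of `c i₁` modulo `M`, so that the offsets are spaced by `1 / M`. -/
def latticePacket {n : ℕ} (s : ℝ) (M : ℕ) (i₀ i₁ : Fin n) (a : (Fin n → ℕ) × ℕ) : 𝓢(Rn n, ℂ) :=
  packetSchwartz s (fun i => latticeCenter a.1 i / latticeCenter a.1 i₀)
    (a.2 + ((a.1 i₁ % M : ℕ) : ℝ) / M) i₀ (two_le_latticeCenter a.1 i₀)

theorem integral_latticePacket_mul_conj {n : ℕ} (s : ℝ) (M : ℕ) (i₀ i₁ : Fin n)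
    (a a' : (Fin n → ℕ) × ℕ) :
    ∫ η : Rn n, (((2 * π * ‖η‖) ^ (2 * s) : ℝ) : ℂ) *
      (latticePacket s M i₀ i₁ a η * (starRingEnd ℂ) (latticePacket s M i₀ i₁ a' η))
      = if a = a' then 1 else 0 := by
  obtain ⟨c, l⟩ := a
  obtain ⟨c', l'⟩ := a'
  simp only [latticePacket, packetSchwartz_apply]
  by_cases hc : c = c'
  · subst hc
    rw [integral_packet_mul_conj s (two_le_latticeCenter c i₀) (k := (l : ℤ) - l')
      (div_self (by linarith [two_le_latticeCenter c i₀]))]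
    · simp [sub_eq_zero]
    · push_cast
      ring
  · obtain ⟨i, hi⟩ := Function.ne_iff.1 hc
    simp only [packet_mul_conj_eq_zero s _ _ _ _ (two_le_abs_latticeCenter_sub hi), mul_zero,
      integral_zero]
    simp [hc]

/-- The packets with frequency of size about `M 2^k` and time slot below `2^k`. -/
def latticeBlock (n M k : ℕ) : Finset ((Fin n → ℕ) × ℕ) :=
  (Fintype.piFinset fun _ => Finset.Ico (M * 2 ^ k) (M * 2 ^ (k + 1))) ×ˢ Finset.range (2 ^ k)

theorem card_latticeBlock (n M k : ℕ) :
    (latticeBlock n M k).card = M ^ n * (2 ^ (n + 1)) ^ k := by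
  have : M * 2 ^ (k + 1) - M * 2 ^ k = M * 2 ^ k := by
    rw [pow_succ, ← mul_assoc, mul_two, Nat.add_sub_cancel]
  rw [latticeBlock, Finset.card_product, Fintype.card_piFinset_const, Nat.card_Ico, this,
    Finset.card_range, mul_pow, mul_assoc, ← pow_mul, ← pow_add, ← pow_mul]
  ring_nf

theorem eq_of_mem_latticeBlock {n M k k' : ℕ} (i₀ : Fin n) {a : (Fin n → ℕ) × ℕ}
    (h : a ∈ latticeBlock n M k) (h' : a ∈ latticeBlock n M k') : k = k' := by
  have key : ∀ {k k' : ℕ}, a ∈ latticeBlock n M k → a ∈ latticeBlock n M k' → k ≤ k' := by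
    intro k k' h h'
    simp only [latticeBlock, Finset.mem_product, Fintype.mem_piFinset, Finset.mem_Ico] at h h'
    have h1 : 2 ^ k < 2 ^ (k' + 1) :=
      lt_of_mul_lt_mul_left ((h.1 i₀).1.trans_lt (h'.1 i₀).2) (Nat.zero_le M)
    exact Nat.lt_succ_iff.1 ((Nat.pow_lt_pow_iff_right one_lt_two).1 h1)
  exact le_antisymm (key h h') (key h' h)

/-- The bound `7 n M 2^k` on the frequencies of the packets in `latticeBlock n M k`. -/
theorem norm_le_of_mem_latticeBlock {n M k : ℕ} (hM : 1 ≤ M) {a : (Fin n → ℕ) × ℕ}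
    (ha : a ∈ latticeBlock n M k) {η : Rn n} (hη : boxCutoff (latticeCenter a.1) η ≠ 0) :
    ‖η‖ ≤ 7 * n * M * 2 ^ k := by
  simp only [latticeBlock, Finset.mem_product, Fintype.mem_piFinset, Finset.mem_Ico] at ha
  have hM' : (1 : ℝ) ≤ M := by exact_mod_cast hM
  have h2 : (1 : ℝ) ≤ 2 ^ k := one_le_pow₀ one_le_two
  have hcoord (i : Fin n) : ‖η i‖ ≤ 7 * M * 2 ^ k := by
    have h3 : ((a.1 i : ℕ) : ℝ) + 1 ≤ M * (2 * 2 ^ k) := by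
      rw [← pow_succ']
      exact_mod_cast (ha.1 i).2
    have h4 := abs_sub_lt_one_of_boxCutoff_ne_zero hη i
    have h5 := abs_sub_abs_le_abs_sub (η i) (latticeCenter a.1 i)
    rw [abs_of_nonneg (a := latticeCenter a.1 i) (by linarith [two_le_latticeCenter a.1 i])] at h5
    rw [latticeCenter] at h4 h5
    rw [Real.norm_eq_abs]
    nlinarith
  rw [← (EuclideanSpace.basisFun (Fin n) ℝ).sum_repr η]
  refine (norm_sum_le _ _).trans (le_of_le_of_eq
    (Finset.sum_le_card_nsmul _ _ (7 * (M : ℝ) * 2 ^ k) fun i _ => ?_) ?_)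
  · rw [norm_smul]
    simpa using hcoord i
  · simp only [Finset.card_univ, Fintype.card_fin, nsmul_eq_mul]
    ring

theorem le_norm_schrodinger_latticePacket {n : ℕ} {s : ℝ} (hs : 0 ≤ s) {M k : ℕ}
    (hM : 1 ≤ M) (hM' : 42 * n ≤ M) (i₀ i₁ : Fin n) {a : (Fin n → ℕ) × ℕ}
    (ha : a ∈ latticeBlock n M k) {t : ℝ} {x : Rn n} (ht : 0 ≤ t) (ht' : 24 * π * M * t < 1)
    (hx : n * ‖x‖ ≤ 1 / 21)
    (ho : |(a.2 + ((a.1 i₁ % M : ℕ) : ℝ) / M) - 4 * π * t * latticeCenter a.1 i₀| ≤ 1 / M) :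
    (2 * π * (7 * n * M * 2 ^ k)) ^ (-s) / 2 ≤
      ‖schrodinger (⇑(𝓕⁻ (latticePacket s M i₀ i₁ a) : 𝓢(Rn n, ℂ))) t x‖ := by
  have hMpos : (0 : ℝ) < M := by exact_mod_cast hM
  have hMn : 42 * (n : ℝ) ≤ M := by exact_mod_cast hM'
  have hpos (i) : 0 < latticeCenter a.1 i := by linarith [two_le_latticeCenter a.1 i]
  refine le_norm_schrodinger_packet hs (two_le_latticeCenter a.1 i₀)
    (fun i => (mul_div_cancel₀ _ (hpos i₀).ne').symm) (fun i => ?_)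
    (fun η hη => norm_le_of_mem_latticeBlock hM ha hη) ht ?_ hx ?_
  · simp only [latticeBlock, Finset.mem_product, Fintype.mem_piFinset, Finset.mem_Ico] at ha
    have h1 : a.1 i + 1 ≤ 2 * a.1 i₀ := by
      have := (ha.1 i).2
      have := (ha.1 i₀).1
      rw [pow_succ] at *
      linarith
    have h2 : (a.1 i : ℝ) + 1 ≤ 2 * a.1 i₀ := by exact_mod_cast h1
    rw [abs_of_pos (div_pos (hpos i) (hpos i₀)), div_le_iff₀ (hpos i₀), latticeCenter,
      latticeCenter]
    linarith
  · have : 2 * π * t * (42 * n) ≤ 2 * π * t * M := by gcongr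
    linarith
  · refine (mul_le_mul_of_nonneg_left ho (by positivity)).trans ?_
    rw [mul_one_div, div_le_iff₀ hMpos]
    linarith

/-- Each of the `2^{kn}` coarse frequencies contributes a packet focusing at time `t`. -/
theorem le_sum_latticeBlock {n : ℕ} {s : ℝ} (hs : 0 ≤ s) {M : ℕ} (hM : 1 ≤ M)
    (hM' : 42 * n ≤ M) {i₀ i₁ : Fin n} (hi : i₀ ≠ i₁) (k : ℕ) {t : ℝ} {x : Rn n} (ht : 0 ≤ t)
    (ht' : 24 * π * M * t < 1) (hx : n * ‖x‖ ≤ 1 / 21) :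
    (2 ^ k) ^ n * ((2 * π * (7 * n * M * 2 ^ k)) ^ (-s) / 2) ^ 2 ≤
      ∑ a ∈ latticeBlock n M k,
        ‖schrodinger (⇑(𝓕⁻ (latticePacket s M i₀ i₁ a) : 𝓢(Rn n, ℂ))) t x‖ ^ 2 := by
  have hMpos : (0 : ℝ) < M := by exact_mod_cast hM
  let N (κ : Fin n → ℕ) : ℕ := ⌊M * (4 * π * t * (3 * ((M * κ i₀ : ℕ) + 1 : ℝ)))⌋₊
  let φ (κ : Fin n → ℕ) : (Fin n → ℕ) × ℕ :=
    (fun i => M * κ i + if i = i₁ then N κ % M else 0, N κ / M)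
  let S : Finset (Fin n → ℕ) := Fintype.piFinset fun _ => Finset.Ico (2 ^ k) (2 ^ (k + 1))
  have hd (κ : Fin n → ℕ) (i : Fin n) : (if i = i₁ then N κ % M else 0) < M := by
    split_ifs
    · exact Nat.mod_lt _ hM
    · exact hM
  have hdiv (κ : Fin n → ℕ) (i : Fin n) : (φ κ).1 i / M = κ i := by
    simp only [φ]
    rw [Nat.mul_add_div hM, Nat.div_eq_of_lt (hd κ i), add_zero]
  have hφ : Function.Injective φ := fun κ κ' h => funext fun i => by rw [← hdiv κ, h, hdiv κ']
  have hφ₀ (κ : Fin n → ℕ) : (φ κ).1 i₀ = M * κ i₀ := by simp [φ, hi]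
  have hφ₁ (κ : Fin n → ℕ) : (φ κ).1 i₁ % M = N κ % M := by simp [φ]
  have hmem : ∀ κ ∈ S, φ κ ∈ latticeBlock n M k := fun κ hκ => by
    simp only [S, Fintype.mem_piFinset, Finset.mem_Ico] at hκ
    simp only [latticeBlock, Finset.mem_product, Fintype.mem_piFinset, Finset.mem_Ico,
      Finset.mem_range]
    refine ⟨fun i => ?_, ?_⟩
    · rw [mul_comm M, mul_comm M, ← Nat.le_div_iff_mul_le hM, ← Nat.div_lt_iff_lt_mul hM, hdiv]
      exact hκ i
    · rw [Nat.div_lt_iff_lt_mul hM, Nat.floor_lt (by positivity)]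
      have h1 : M * κ i₀ + 1 ≤ M * (2 * 2 ^ k) := by
        rw [← pow_succ']
        exact Nat.mul_lt_mul_of_pos_left (hκ i₀).2 hM
      have h2 : ((M * κ i₀ : ℕ) : ℝ) + 1 ≤ M * (2 * 2 ^ k) := by exact_mod_cast h1
      calc (M : ℝ) * (4 * π * t * (3 * ((M * κ i₀ : ℕ) + 1 : ℝ)))
          ≤ M * (4 * π * t * (3 * (M * (2 * 2 ^ k)))) := by gcongr
        _ = (24 * π * M * t) * (M * 2 ^ k) := by ring
        _ < 1 * (M * 2 ^ k) := by gcongr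
        _ = ((2 ^ k * M : ℕ) : ℝ) := by push_cast; ring
  calc ((2 : ℝ) ^ k) ^ n * ((2 * π * (7 * n * M * 2 ^ k)) ^ (-s) / 2) ^ 2
      = ∑ κ ∈ S, ((2 * π * (7 * n * M * 2 ^ k)) ^ (-s) / 2) ^ 2 := by
        have : 2 ^ (k + 1) - 2 ^ k = 2 ^ k := by rw [pow_succ, mul_two, Nat.add_sub_cancel]
        rw [Finset.sum_const, Fintype.card_piFinset_const, Nat.card_Ico, this, nsmul_eq_mul]
        push_cast
        rfl
    _ ≤ ∑ κ ∈ S, ‖schrodinger (⇑(𝓕⁻ (latticePacket s M i₀ i₁ (φ κ)) : 𝓢(Rn n, ℂ))) t x‖ ^ 2 := by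
        refine Finset.sum_le_sum fun κ hκ => ?_
        gcongr
        refine le_norm_schrodinger_latticePacket hs hM hM' i₀ i₁ (hmem κ hκ) ht ht' hx ?_
        have hy : (0 : ℝ) ≤ M * (4 * π * t * (3 * ((M * κ i₀ : ℕ) + 1 : ℝ))) := by positivity
        have h1 := Nat.floor_le hy
        have h2 := Nat.lt_floor_add_one (M * (4 * π * t * (3 * ((M * κ i₀ : ℕ) + 1 : ℝ))))
        have h3 : (M : ℝ) * ((N κ / M : ℕ) : ℝ) + ((N κ % M : ℕ) : ℝ) = N κ := by
          exact_mod_cast Nat.div_add_mod (N κ) M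
        rw [latticeCenter, hφ₀, hφ₁]
        have h4 : ((φ κ).2 : ℝ) = ((N κ / M : ℕ) : ℝ) := rfl
        rw [h4, show ((N κ / M : ℕ) : ℝ) + ((N κ % M : ℕ) : ℝ) / M = N κ / M by
          rw [← h3]; field_simp, le_div_iff₀ hMpos, ← abs_of_pos hMpos, ← abs_mul,
          abs_of_pos hMpos, sub_mul, div_mul_cancel₀ _ hMpos.ne', abs_le]
        constructor <;> linarith
    _ = ∑ a ∈ S.map ⟨φ, hφ⟩,
          ‖schrodinger (⇑(𝓕⁻ (latticePacket s M i₀ i₁ a) : 𝓢(Rn n, ℂ))) t x‖ ^ 2 := by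
        rw [Finset.sum_map]
        rfl
    _ ≤ _ := by
        refine Finset.sum_le_sum_of_subset_of_nonneg (fun a ha => ?_) fun _ _ _ => by positivity
        obtain ⟨κ, hκ, rfl⟩ := Finset.mem_map.1 ha
        exact hmem κ hκ

theorem rpow_mul_card_mul_sq {n M k : ℕ} {b s : ℝ} (h : 2 * s = n - (n + 1) * b) :
    ((2 ^ (n + 1) : ℕ) : ℝ) ^ (-(k * b)) *
      ((2 ^ k) ^ n * ((2 * π * (7 * n * M * 2 ^ k)) ^ (-s) / 2) ^ 2)
      = ((2 * π * (7 * n * M)) ^ (-s) / 2) ^ 2 := by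
  have h1 : (2 * π * (7 * n * M * 2 ^ k)) ^ (-s)
      = (2 * π * (7 * n * M)) ^ (-s) * (2 : ℝ) ^ (-(k * s)) := by
    rw [← mul_assoc (2 * π), Real.mul_rpow (by positivity) (by positivity), ← Real.rpow_natCast 2 k,
      ← Real.rpow_mul (by norm_num)]
    ring_nf
  have h2 : (2 : ℝ) ^ (-(((n : ℝ) + 1) * (k * b))) * ((2 : ℝ) ^ ((k : ℝ) * n) *
      ((2 : ℝ) ^ (-(k * s)) * (2 : ℝ) ^ (-(k * s)))) = 1 := by
    rw [← Real.rpow_add two_pos, ← Real.rpow_add two_pos, ← Real.rpow_add two_pos]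
    convert Real.rpow_zero (2 : ℝ) using 2
    linear_combination -(k : ℝ) * h
  have h3 : ((2 ^ (n + 1) : ℕ) : ℝ) ^ (-(k * b)) = (2 : ℝ) ^ (-(((n : ℝ) + 1) * (k * b))) := by
    rw [Nat.cast_pow, ← Real.rpow_natCast, ← Real.rpow_mul (by positivity)]
    push_cast
    ring_nf
  have h4 : ((2 : ℝ) ^ k) ^ n = (2 : ℝ) ^ ((k : ℝ) * n) := by
    rw [← pow_mul, ← Real.rpow_natCast]
    push_cast
    rfl
  rw [h1, h3, h4]
  linear_combination ((2 * π * (7 * n * M)) ^ (-s) / 2) ^ 2 * h2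

/-- An orthonormal family, and coefficients with `K` dyadic levels, whose density is of size `K`
on a fixed space-time box while its Lorentz sequence norm is of size `K^{1/r}`. -/
theorem exists_orthonormalHs_le_density {n : ℕ} (hn : 2 ≤ n) {b s : ℝ} (hs0 : 0 ≤ s) (hb : 0 ≤ b)
    (hs : 2 * s = n - (n + 1) * b) {r : ℝ} (hr : 0 < r) :
    ∃ (f : ℕ → Rn n → ℂ) (c T R E : ℝ), OrthonormalHs s f ∧ 0 < c ∧ 0 < T ∧ 0 < R ∧ 0 ≤ E ∧
      ∀ K : ℕ, 1 ≤ K → ∃ lam : ℕ → ℝ,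
        seqLor b r lam ≤ ENNReal.ofReal (E * (K : ℝ) ^ (1 / r)) ∧
        ∀ t ∈ Icc 0 T, ∀ x ∈ Metric.closedBall (0 : Rn n) R, c * K ≤ density lam f t x := by
  set M := 42 * n with hMdef
  have hM : 1 ≤ M := by omega
  have hnR : (0 : ℝ) < n := by exact_mod_cast (by omega : 0 < n)
  have hMpos : (0 : ℝ) < M := by exact_mod_cast hM
  let i₀ : Fin n := ⟨0, by omega⟩
  let i₁ : Fin n := ⟨1, by omega⟩
  have hi : i₀ ≠ i₁ := by simp [i₀, i₁]
  have : Nonempty (Fin n) := ⟨i₀⟩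
  obtain ⟨e⟩ : Nonempty (ℕ ≃ (Fin n → ℕ) × ℕ) := nonempty_equiv_of_countable
  set B : ℕ → Finset ℕ := fun k => (latticeBlock n M k).map e.symm.toEmbedding with hB
  have hBdisj {k k' j : ℕ} (h : j ∈ B k) (h' : j ∈ B k') : k = k' := by
    simp only [hB, Finset.mem_map_equiv, Equiv.symm_symm] at h h'
    exact eq_of_mem_latticeBlock i₀ h h'
  have hcard (k : ℕ) : (B k).card ≤ M ^ n * (2 ^ (n + 1)) ^ k := by
    rw [hB, Finset.card_map, card_latticeBlock]
  have hMn : 1 ≤ M ^ n := Nat.one_le_pow _ _ hM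
  have hD : 2 ≤ 2 ^ (n + 1) := Nat.le_self_pow (by omega) 2
  set D : ℕ := 2 ^ (n + 1) with hDdef
  have hlogM : 0 ≤ Real.log ((M ^ n : ℕ) : ℝ) := Real.log_natCast_nonneg _
  have hlogD : 0 ≤ Real.log (D : ℝ) := Real.log_natCast_nonneg _
  set L : ℝ := 1 + Real.log ((M ^ n : ℕ) : ℝ) + Real.log (D : ℝ) with hL
  have hL0 : 0 ≤ L := by positivity
  refine ⟨fun j => ⇑(𝓕⁻ (latticePacket s M i₀ i₁ (e j)) : 𝓢(Rn n, ℂ)),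
    ((2 * π * (7 * n * M)) ^ (-s) / 2) ^ 2, 1 / (100 * M), 1 / (21 * n),
    (((M ^ n : ℕ) : ℝ) * D) ^ b * L ^ (1 / r), ?_, by positivity, by positivity, by positivity,
    by positivity, fun K hK => ?_⟩
  · refine orthonormalHs_fourierInv s _ fun j k => ?_
    rw [integral_latticePacket_mul_conj]
    simp only [e.injective.eq_iff]
  refine ⟨fun j => ∑ k ∈ Finset.range K, if j ∈ B k then (D : ℝ) ^ (-(k * b)) else 0, ?_, ?_⟩
  · refine (seqLor_blocks_le (K := K) hb hr hMn hD hcard fun i => ?_).trans ?_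
    · by_cases h : ∃ k < K, i ∈ B k
      · obtain ⟨k, hk, hmem⟩ := h
        refine Or.inr ⟨k, hk, hmem, ?_⟩
        rw [Finset.sum_eq_single_of_mem k (Finset.mem_range.2 hk) fun k' _ hne =>
          if_neg fun h => hne (hBdisj h hmem), if_pos hmem]
      · push Not at h
        exact Or.inl (Finset.sum_eq_zero fun k hk => if_neg (h k (Finset.mem_range.1 hk)))
    · refine ENNReal.ofReal_le_ofReal ?_
      have hK1 : (1 : ℝ) ≤ K := by exact_mod_cast hK
      rw [mul_assoc, ← Real.mul_rpow hL0 (by positivity)]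
      have h0 : 0 ≤ Real.log ((M ^ n * D ^ K : ℕ) : ℝ) := Real.log_natCast_nonneg _
      gcongr
      rw [Nat.cast_mul, Nat.cast_pow D, Real.log_mul (by positivity) (by positivity), Real.log_pow]
      nlinarith
  · intro t ht x hx
    rw [mem_closedBall_zero_iff, le_div_iff₀ (by positivity)] at hx
    have hT : 24 * π * M * t < 1 := by
      have h1 : t * (100 * M) ≤ 1 := (le_div_iff₀ (by positivity)).1 ht.2
      have h2 := Real.pi_lt_d2
      have h3 : 0 ≤ t * M := mul_nonneg ht.1 hMpos.le
      nlinarith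
    rw [density, density2, tsum_sum_ite_mul]
    refine le_of_eq_of_le ?_ (Finset.card_nsmul_le_sum _ _
      (((2 * π * (7 * n * M)) ^ (-s) / 2) ^ 2) fun k _ => ?_)
    · rw [Finset.card_range, nsmul_eq_mul, mul_comm]
    · rw [← rpow_mul_card_mul_sq (k := k) hs, hB, Finset.sum_map]
      simp only [Equiv.coe_toEmbedding, Equiv.apply_symm_apply]
      refine mul_le_mul_of_nonneg_left ?_ (by positivity)
      exact le_sum_latticeBlock hs0 hM le_rfl hi k ht.1 hT (by linarith)
end OS

/-- (Bez–Hong–Lee–Nakamura–Sawano.)  For `n ≥ 3`, `(1/p, 1/q)` on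
the closed segment `[O, A]`, `2s = n - (2/q + n/p)` and `r > 1`, the restricted
weak-type estimate
`‖Σ λ_j |e^{itΔ}f_j|²‖_{L^{q,∞}(ℝ, L^{p,∞}(ℝⁿ))} ≲ ‖λ‖_{ℓ^{q,r}}` fails.  Here
`(a, b) = (1/p, 1/q)` is a point of `[O, A]`. -/
theorem failure_on_OA (n : ℕ) (hn : 3 ≤ n) (a b s r : ℝ)
    (hab : ∃ t ∈ Icc (0 : ℝ) 1, (a, b) = t • ptA n)
    (hs : 2 * s = n - (2 * b + n * a)) (hr : 1 < r) :
    ¬ ∃ C : ℝ, 0 < C ∧ ∀ (f : ℕ → Rn n → ℂ) (lam : ℕ → ℝ),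
      OrthonormalHs s f → seqLor b r lam ≠ ∞ →
      lor volume (expOf b) ∞ (fun t => wLp (expOf a) (density lam f t))
        ≤ ENNReal.ofReal C * seqLor b r lam := by
  rintro ⟨C, hC, hest⟩
  obtain ⟨τ, ⟨hτ0, hτ1⟩, hτ⟩ := hab
  simp only [ptA, Prod.smul_mk, smul_eq_mul, Prod.mk.injEq] at hτ
  obtain ⟨ha, hb⟩ := hτ
  have hb0 : 0 ≤ b := by
    rw [hb]
    positivity
  have hline : ((n : ℝ) + 1) * b = τ * n := by
    rw [hb]
    field_simp
  have hsum : 2 * b + n * a = (n + 1) * b := by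
    rw [ha, hb]
    field_simp
    ring
  have hs0 : 0 ≤ s := by
    have : τ * n ≤ n := mul_le_of_le_one_left (by positivity) hτ1
    linarith
  obtain ⟨f, c, T, R, E, hf, hc, hT, hR, hE, hK⟩ :=
    exists_orthonormalHs_le_density (by omega : 2 ≤ n) hs0 hb0 (by rw [hs, hsum])
      (zero_lt_one.trans hr)
  obtain ⟨c₁, hc₁, hX⟩ := exists_mul_le_lor (volume : Measure (Rn n))
    (S := Metric.closedBall 0 R) (Metric.measure_closedBall_pos _ _ hR).ne'
    measure_closedBall_lt_top.ne (expOf a)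
  obtain ⟨c₂, hc₂, hT'⟩ := exists_mul_le_lor (volume : Measure ℝ) (S := Icc 0 T)
    (by simpa using hT) (by simp) (expOf b)
  refine not_forall_mul_le_mul_rpow (c := c₂ * (c₁ * c)) (E := C * E) (by positivity) hr
    fun K hK1 => ?_
  obtain ⟨lam, hlam, hdens⟩ := hK K hK1
  have hKpos : (0 : ℝ) < K := by exact_mod_cast hK1
  have hlow := hT' (fun t => wLp (expOf a) (density lam f t)) (c₁ * (c * K)) (by positivity)
    fun t ht => hX _ (c * K) (by positivity) fun x hx => by
      rw [← enorm_eq_nnnorm, Real.enorm_eq_ofReal_abs]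
      exact ENNReal.ofReal_le_ofReal ((hdens t ht x hx).trans (le_abs_self _))
  have hup := (hlow.trans (hest f lam hf (hlam.trans_lt ENNReal.ofReal_lt_top).ne)).trans
    (mul_le_mul_right hlam _)
  rw [← ENNReal.ofReal_mul hC.le, ENNReal.ofReal_le_ofReal_iff (by positivity)] at hup
  linarith
end
end
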